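/- arXiv:2004.11896 — 3 statements merged into one kernel-verified Lean document; each statement's English description precedes it below -/
import Mathlib

section
/- Fix coprime positive integers k and m with 0 < k < m, let Φ(m) = {β ∈ F_{2^m} : X^{2^k+1} + X + β has no root in F_{2^m}}, and let N(m) be the number of β ∈ Φ(m) that lie in no proper subfield of F_{2^m} (i.e. β^{2^{m'}} ≠ β for every proper divisor m' of m). Write m = 3^{n_0}·p_1^{n_1}···p_t^{n_t} with n_0 ≥ 0, distinct primes p_1,…,p_t different from 3, and n_i ≥ 1. If t = 0 (i.e. m is a power of 3, including m = 1), then N(m) = (2^m + 1)/3. If t ≥ 1, then 3·N(m) = Σ_{S ⊆ {p_1,…,p_t}} (−1)^{|S|} · 2^{m/Π_{p∈S} p} − ε, where ε = 2 if t = 1 and m ≡ 2 (mod 4), and ε = 0 otherwise. -/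
/-- `Φ(m)` (for a fixed `k`): the set of `β ∈ F_{2^m}` such that `X^(2^k+1) + X + β` has
no root in `F_{2^m}`. -/
def Phi (k m : ℕ) : Set (GaloisField 2 m) :=
  {β | ∀ x : GaloisField 2 m, x ^ (2 ^ k + 1) + x + β ≠ 0}

/-- The elements of `Φ(m)` lying in no proper subfield of `F_{2^m}`,
i.e. `β^(2^(m')) ≠ β` for every proper divisor `m'` of `m`. -/
def PhiNew (k m : ℕ) : Set (GaloisField 2 m) :=
  {β | β ∈ Phi k m ∧ ∀ m' : ℕ, m' ∣ m → m' < m → β ^ 2 ^ m' ≠ β}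

theorem two_z {K : Type*} [Field K] [CharP K 2] : (2 : K) = 0 := by
  exact_mod_cast CharP.cast_eq_zero K 2

theorem add_eq_zero_two {K : Type*} [Field K] [CharP K 2] {a b : K} : a + b = 0 ↔ a = b := by
  rw [← CharTwo.sub_eq_add, sub_eq_zero]

theorem per_iff {K : Type*} [Field K] [CharP K 2] (a : ℕ) (x : K) :
    Function.IsPeriodicPt (frobenius K 2) a x ↔ x ^ 2 ^ a = x := by
  rw [Function.IsPeriodicPt, Function.IsFixedPt, iterate_frobenius]

theorem per_gcd {K : Type*} [Field K] [CharP K 2] {a b : ℕ} {x : K}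
    (ha : x ^ 2 ^ a = x) (hb : x ^ 2 ^ b = x) : x ^ 2 ^ (Nat.gcd a b) = x := by
  rw [← per_iff] at *
  exact ha.gcd hb

theorem per_mul {K : Type*} [Field K] [CharP K 2] {a : ℕ} (b : ℕ) {x : K}
    (ha : x ^ 2 ^ a = x) : x ^ 2 ^ (a * b) = x := by
  rw [← per_iff] at *
  exact ha.mul_const b

theorem pow_card2 {K : Type*} [Field K] [Fintype K] {d : ℕ}
    (hK : Fintype.card K = 2 ^ d) (x : K) : x ^ 2 ^ d = x := by
  rw [← hK]; exact FiniteField.pow_card x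

theorem fix_two {K : Type*} [Field K] [Fintype K] [CharP K 2] {k d : ℕ}
    (hK : Fintype.card K = 2 ^ d) (hg : Nat.gcd k d = 1) {x : K} (hx : x ^ 2 ^ k = x) :
    x = 0 ∨ x = 1 := by
  have := per_gcd hx (pow_card2 hK x)
  rw [hg] at this
  have h : x * (x - 1) = 0 := by linear_combination this
  rcases mul_eq_zero.1 h with h | h
  · exact Or.inl h
  · exact Or.inr (sub_eq_zero.1 h)

theorem exists_kappa {K : Type*} [Field K] [Fintype K] [CharP K 2] {k d : ℕ}
    (hK : Fintype.card K = 2 ^ d) (hg : Nat.gcd k d = 1) (c : K) (hc : c ≠ 0) :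
    ∃ y : K, y ≠ 0 ∧ y ^ 2 ^ k = c * y := by
  have hinj : Function.Injective (fun y : K => y ^ 2 ^ k / y) := by
    intro y z h
    simp only at h
    by_cases hy : y = 0
    · by_contra hne
      have hz : z ≠ 0 := fun h0 => hne (by rw [hy, h0])
      rw [hy, div_zero] at h
      exact (div_ne_zero (pow_ne_zero _ hz) hz) h.symm
    by_cases hz : z = 0
    · rw [hz, div_zero] at h
      exact absurd h (div_ne_zero (pow_ne_zero _ hy) hy)
    have h1 : (y / z) ^ 2 ^ k = y / z := by
      rw [div_pow]
      rw [div_eq_div_iff hy hz] at h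
      rw [div_eq_div_iff (pow_ne_zero _ hz) hz, h]; ring
    rcases fix_two hK hg h1 with h2 | h2
    · exact absurd h2 (div_ne_zero hy hz)
    · exact (div_eq_one_iff_eq hz).1 h2
  obtain ⟨y, hy⟩ := (Finite.injective_iff_surjective.1 hinj) c
  simp only at hy
  have hy0 : y ≠ 0 := by
    rintro rfl
    rw [div_zero] at hy
    exact hc hy.symm
  exact ⟨y, hy0, by rw [← hy]; field_simp⟩

theorem root_shift {K : Type*} [Field K] [CharP K 2] {k : ℕ} {β x0 u : K}
    (h0 : x0 ^ (2 ^ k + 1) + x0 + β = 0) (hu : u ≠ 0) :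
    (x0 + u⁻¹) ^ (2 ^ k + 1) + (x0 + u⁻¹) + β = 0 ↔
      (x0 ^ 2 ^ k + 1) * u ^ 2 ^ k + x0 * u = 1 := by
  have hq : u ^ 2 ^ k ≠ 0 := pow_ne_zero _ hu
  have h2 := two_z (K := K)
  rw [pow_succ, add_pow_char_pow, inv_pow]
  rw [pow_succ] at h0
  generalize x0 ^ 2 ^ k = X at *
  generalize u ^ 2 ^ k = U at *
  have key : (X + U⁻¹) * (x0 + u⁻¹) + (x0 + u⁻¹) + β =
      ((X + 1) * U + x0 * u + 1) * (U⁻¹ * u⁻¹) := by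
    field_simp
    linear_combination U * u * h0
  rw [key, mul_eq_zero, or_iff_left (mul_ne_zero (inv_ne_zero hq) (inv_ne_zero hu)),
    add_eq_zero_two]

theorem third_root {K : Type*} [Field K] [Fintype K] [CharP K 2] {k d : ℕ}
    (hK : Fintype.card K = 2 ^ d) (hg : Nat.gcd k d = 1) {β x0 x1 : K} (hβ : β ≠ 0)
    (h0 : x0 ^ (2 ^ k + 1) + x0 + β = 0) (h1 : x1 ^ (2 ^ k + 1) + x1 + β = 0)
    (hne : x0 ≠ x1) :
    ∃ x2, x2 ≠ x0 ∧ x2 ≠ x1 ∧ x2 ^ (2 ^ k + 1) + x2 + β = 0 ∧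
      ∀ x, x ^ (2 ^ k + 1) + x + β = 0 → x = x0 ∨ x = x1 ∨ x = x2 := by
  have h2 := two_z (K := K)
  have hx0 : x0 ≠ 0 := by
    rintro rfl
    apply hβ
    simpa using h0
  have hx0' : x0 ^ 2 ^ k + 1 ≠ 0 := by
    intro h
    apply hβ
    rw [pow_succ] at h0
    linear_combination h0 - x0 * h
  obtain ⟨κ, hκ, hκe⟩ := exists_kappa hK hg (x0 / (x0 ^ 2 ^ k + 1)) (div_ne_zero hx0 hx0')
  have hκe' : (x0 ^ 2 ^ k + 1) * κ ^ 2 ^ k = x0 * κ := by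
    rw [hκe]; field_simp
  have hform : ∀ x, x ≠ x0 → x0 + ((x0 + x)⁻¹)⁻¹ = x := by
    intro x _
    rw [inv_inv]
    linear_combination x0 * h2
  have hu : ∀ x, x ≠ x0 → (x0 + x)⁻¹ ≠ 0 := by
    intro x hx
    apply inv_ne_zero
    rw [Ne, add_eq_zero_two]
    exact fun h => hx h.symm
  have hsol : ∀ x, x ≠ x0 → (x ^ (2 ^ k + 1) + x + β = 0 ↔
      (x0 ^ 2 ^ k + 1) * ((x0 + x)⁻¹) ^ 2 ^ k + x0 * (x0 + x)⁻¹ = 1) := by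
    intro x hx
    rw [← root_shift h0 (hu x hx), hform x hx]
  have hs1 := (hsol x1 hne.symm).1 h1
  set u1 := (x0 + x1)⁻¹ with hu1
  have hu2s : (x0 ^ 2 ^ k + 1) * (u1 + κ) ^ 2 ^ k + x0 * (u1 + κ) = 1 := by
    rw [add_pow_char_pow]
    linear_combination hs1 + hκe' + x0 * κ * h2
  have hu2 : u1 + κ ≠ 0 := by
    intro h
    rw [h] at hu2s
    simp at hu2s
  refine ⟨x0 + (u1 + κ)⁻¹, ?_, ?_, (root_shift h0 hu2).2 hu2s, ?_⟩
  · simpa using hu2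
  · intro h
    apply hκ
    have : (u1 + κ)⁻¹ = x0 + x1 := by linear_combination h - x0 * h2
    have h3 : u1 + κ = u1 := inv_injective (by rw [this, hu1, inv_inv])
    simpa using h3
  · intro x hx
    by_cases hxx : x = x0
    · exact Or.inl hxx
    right
    have hs := (hsol x hxx).1 hx
    have hf := hform x hxx
    have hf1 := hform x1 hne.symm
    rw [← hu1] at hf1
    set u := (x0 + x)⁻¹ with hudef
    have hd : (x0 ^ 2 ^ k + 1) * (u + u1) ^ 2 ^ k = x0 * (u + u1) := by
      rw [add_pow_char_pow]
      linear_combination hs + hs1 + (1 - x0 * u - x0 * u1) * h2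
    have hq : ((u + u1) / κ) ^ 2 ^ k = (u + u1) / κ := by
      have hκq : κ ^ 2 ^ k ≠ 0 := pow_ne_zero _ hκ
      rw [div_pow, div_eq_div_iff hκq hκ]
      apply mul_left_cancel₀ hx0'
      linear_combination κ * hd - (u + u1) * hκe'
    rcases fix_two hK hg hq with h | h
    · left
      rcases div_eq_zero_iff.1 h with h | h
      · rw [add_eq_zero_two] at h
        rw [← hf, ← hf1, h]
      · exact absurd h hκ
    · right
      rw [div_eq_one_iff_eq hκ] at h
      rw [← hf]
      congr 2
      linear_combination h - u1 * h2

open Classical in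
theorem card_w {K : Type*} [Field K] [Fintype K] [CharP K 2] {k d : ℕ}
    (hK : Fintype.card K = 2 ^ d) (hg : Nat.gcd k d = 1) :
    (Finset.univ.filter (fun w : K => w ^ 2 ^ k + w + 1 = 0)).card =
      if Even d then 2 else 0 := by
  have h2 := two_z (K := K)
  split_ifs with hd
  · have hkodd : ¬ 2 ∣ k := fun h => by
      have := Nat.dvd_gcd h hd.two_dvd
      omega
    have hd0 : d ≠ 0 := by
      rintro rfl
      have := Fintype.one_lt_card (α := K)
      rw [hK] at this
      simp at this
    obtain ⟨w, hw⟩ : ∃ w : K, w ^ 2 + w + 1 = 0 := by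
      have : Fact (Nat.Prime 3) := ⟨Nat.prime_three⟩
      have h3 : 3 ∣ Fintype.card Kˣ := by
        rw [Fintype.card_units, hK]
        obtain ⟨e, rfl⟩ := hd
        rw [← two_mul, pow_mul]
        simpa using Nat.sub_dvd_pow_sub_pow 4 1 e
      obtain ⟨g, hg⟩ := exists_prime_orderOf_dvd_card 3 h3
      have hg3 : (g : K) ^ 3 = 1 := by
        have := pow_orderOf_eq_one g
        rw [hg] at this
        rw [← Units.val_pow_eq_pow_val, this, Units.val_one]
      have hg1 : (g : K) ≠ 1 := by
        intro h
        have : g = 1 := Units.ext h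
        rw [this, orderOf_one] at hg
        omega
      refine ⟨g, mul_left_cancel₀ (sub_ne_zero.2 hg1) ?_⟩
      linear_combination hg3
    have hw2 : w ^ 2 ^ 2 = w := by
      linear_combination (w ^ 2 - w) * hw
    have hwk : w ^ 2 ^ k = w ^ 2 := by
      obtain ⟨j, rfl⟩ := Nat.odd_iff.2 (Nat.two_dvd_ne_zero.1 hkodd)
      rw [pow_succ, pow_mul, per_mul j hw2]
    have : (Finset.univ.filter (fun w : K => w ^ 2 ^ k + w + 1 = 0)) = {w, w + 1} := by
      ext y
      simp only [Finset.mem_filter, Finset.mem_univ, true_and, Finset.mem_insert,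
        Finset.mem_singleton]
      constructor
      · intro hy
        have : (y + w) ^ 2 ^ k = y + w := by
          rw [add_pow_char_pow, hwk]
          linear_combination hy + hw - (1 + y + w) * h2
        rcases fix_two hK hg this with h | h
        · left; exact add_eq_zero_two.1 h
        · right; linear_combination h - w * h2
      · rintro (rfl | rfl)
        · rw [hwk, hw]
        · rw [add_pow_char_pow, hwk, one_pow]
          linear_combination hw + h2
    rw [this, Finset.card_pair]
    intro h
    exact one_ne_zero (left_eq_add.1 h)
  · rw [Finset.card_eq_zero, Finset.filter_eq_empty_iff]
    intro w _ hw
    have h1 : w ^ 2 ^ k = w + 1 := by linear_combination hw - (w + 1) * h2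
    have h3 : w ^ 2 ^ (k * 2) = w := by
      rw [mul_two, pow_add, pow_mul, h1, add_pow_char_pow, h1, one_pow]
      linear_combination h2
    have h4 : Nat.gcd (k * 2) d = 1 :=
      Nat.Coprime.mul_left hg ((Nat.coprime_two_left).2 (Nat.not_even_iff_odd.1 hd))
    rcases fix_two hK h4 h3 with rfl | rfl
    · simp at hw
    · simp at hw
      simp [one_add_one_eq_two, h2] at hw

open Classical in
theorem card_pairs {K : Type*} [Field K] [Fintype K] [CharP K 2] (k : ℕ) :
    (Finset.univ.filter (fun z : K × K => z.1 ≠ z.2 ∧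
      z.1 ^ (2 ^ k + 1) + z.1 = z.2 ^ (2 ^ k + 1) + z.2)).card =
    (Finset.univ.filter (fun w : K => w ^ 2 ^ k + w + 1 ≠ 0)).card := by
  have h2 := two_z (K := K)
  have hinjF : Function.Injective (fun y : K => y ^ 2 ^ k) := by
    intro a b h
    exact (iterateFrobenius K 2 k).injective (by simpa [iterateFrobenius_def] using h)
  have hsurj := Finite.injective_iff_surjective.1 hinjF
  have key : ∀ x z : K, z ≠ 0 →
      (x ^ (2 ^ k + 1) + x = (x + z) ^ (2 ^ k + 1) + (x + z) ↔
        (x / z) ^ 2 ^ k + x / z + 1 = (z⁻¹) ^ 2 ^ k) := by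
    intro x z hz
    have hq : z ^ 2 ^ k ≠ 0 := pow_ne_zero _ hz
    rw [pow_succ, pow_succ, add_pow_char_pow, div_pow, inv_pow]
    generalize x ^ 2 ^ k = X at *
    generalize z ^ 2 ^ k = Z at *
    constructor
    · intro h
      field_simp
      linear_combination -h + (z * X + x * Z + Z * z) * h2 - (X * z + x * Z + Z * z + z) * h2
    · intro h
      field_simp at h
      linear_combination -h + (z * X + x * Z + Z * z) * h2 - (X * z + x * Z + Z * z + z) * h2
  refine Finset.card_bij (fun z _ => z.1 / (z.1 + z.2)) ?_ ?_ ?_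
  · rintro ⟨x, y⟩ h
    simp only [Finset.mem_filter, Finset.mem_univ, true_and] at h ⊢
    have hz : x + y ≠ 0 := by rw [Ne, add_eq_zero_two]; exact h.1
    have hy : x + (x + y) = y := by linear_combination x * h2
    have := (key x (x + y) hz).1 (by rw [hy]; exact h.2)
    rw [this]
    exact pow_ne_zero _ (inv_ne_zero hz)
  · rintro ⟨x, y⟩ h ⟨x', y'⟩ h' he
    simp only [Finset.mem_filter, Finset.mem_univ, true_and] at h h' he
    have hz : x + y ≠ 0 := by rw [Ne, add_eq_zero_two]; exact h.1
    have hy : x + (x + y) = y := by linear_combination x * h2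
    have e1 := (key x (x + y) hz).1 (by rw [hy]; exact h.2)
    have hz' : x' + y' ≠ 0 := by rw [Ne, add_eq_zero_two]; exact h'.1
    have hy' : x' + (x' + y') = y' := by linear_combination x' * h2
    have e2 := (key x' (x' + y') hz').1 (by rw [hy']; exact h'.2)
    rw [he, e2] at e1
    have e3 := inv_injective (hinjF e1)
    rw [e3] at he
    have e4 : x = x' := (div_left_inj' hz).1 he
    subst e4
    have e5 : y' = y := add_left_cancel e3
    rw [e5]
  · intro w hw
    simp only [Finset.mem_filter, Finset.mem_univ, true_and] at hw
    obtain ⟨v, hv⟩ := hsurj (w ^ 2 ^ k + w + 1)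
    simp only at hv
    have hv0 : v ≠ 0 := by
      rintro rfl
      rw [zero_pow (by positivity)] at hv
      exact hw hv.symm
    have hz : v⁻¹ ≠ 0 := inv_ne_zero hv0
    have hwz : w * v⁻¹ / v⁻¹ = w := mul_div_cancel_right₀ _ hz
    refine ⟨(w * v⁻¹, w * v⁻¹ + v⁻¹), ?_, ?_⟩
    · simp only [Finset.mem_filter, Finset.mem_univ, true_and]
      refine ⟨fun h => hz (left_eq_add.1 h), ?_⟩
      rw [key _ _ hz, hwz, inv_inv, hv]
    · simp only
      have : w * v⁻¹ + (w * v⁻¹ + v⁻¹) = v⁻¹ := by linear_combination w * v⁻¹ * h2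
      rw [this, hwz]

open Classical in
theorem count_Phi {K : Type*} [Field K] [Fintype K] [CharP K 2] {k d : ℕ}
    (hK : Fintype.card K = 2 ^ d) (hg : Nat.gcd k d = 1) :
    (3 * (Finset.univ.filter
      (fun β : K => ∀ x : K, x ^ (2 ^ k + 1) + x + β ≠ 0)).card : ℤ) = 2 ^ d - (-1) ^ d := by
  have h2 := two_z (K := K)
  set g : K → K := fun x => x ^ (2 ^ k + 1) + x with hgdef
  set r : K → ℕ := fun β => (Finset.univ.filter (fun x : K => g x = β)).card with hr
  have hsum1 : ∑ β, r β = 2 ^ d := by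
    rw [← hK, ← Finset.card_univ]
    exact (Finset.card_eq_sum_card_fiberwise (fun x _ => Finset.mem_univ (g x))).symm
  have hsum2 : ∑ β, r β * r β =
      (Finset.univ.filter (fun z : K × K => g z.1 = g z.2)).card := by
    rw [Finset.card_eq_sum_card_fiberwise (f := fun z => g z.1) (t := Finset.univ)
      (fun x _ => Finset.mem_univ _)]
    refine Finset.sum_congr rfl fun β _ => ?_
    rw [hr]
    simp only
    rw [← Finset.card_product]
    congr 1
    ext ⟨x, y⟩
    simp only [Finset.mem_product, Finset.mem_filter, Finset.mem_univ, true_and]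
    constructor
    · rintro ⟨h, h'⟩; exact ⟨h.trans h'.symm, h⟩
    · rintro ⟨h, h'⟩; exact ⟨h', h.symm.trans h'⟩
  have hsplit : (Finset.univ.filter (fun z : K × K => g z.1 = g z.2)).card =
      2 ^ d + (Finset.univ.filter (fun z : K × K => z.1 ≠ z.2 ∧ g z.1 = g z.2)).card := by
    rw [← Finset.card_filter_add_card_filter_not (fun z : K × K => z.1 = z.2),
      Finset.filter_filter, Finset.filter_filter]
    congr 1
    · rw [← hK, ← Finset.card_univ]
      symm
      refine Finset.card_bij (fun x _ => (x, x)) ?_ ?_ ?_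
      · intro a _; simp
      · intro a _ b _ h; exact (Prod.ext_iff.1 h).1
      · rintro ⟨a, b⟩ h
        simp only [Finset.mem_filter, Finset.mem_univ, true_and] at h
        exact ⟨a, Finset.mem_univ _, by rw [h.2]⟩
    · congr 1
      ext z
      simp [and_comm]
  have hoff : ((Finset.univ.filter (fun z : K × K => z.1 ≠ z.2 ∧ g z.1 = g z.2)).card : ℤ)
      = 2 ^ d - (if Even d then 2 else 0) := by
    rw [card_pairs]
    have h1 := Finset.card_filter_add_card_filter_not (s := (Finset.univ : Finset K))
      (fun w : K => w ^ 2 ^ k + w + 1 = 0)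
    rw [card_w hK hg, Finset.card_univ, hK] at h1
    have h1' := congrArg (Nat.cast : ℕ → ℤ) h1
    push_cast at h1'
    exact eq_sub_of_add_eq' h1'
  have hpt : ∀ β : K, (3 * (if r β = 0 then 1 else 0) : ℤ) =
      (r β * r β : ℕ) - 4 * r β + 3 + (if β = 0 then 1 else 0) := by
    intro β
    by_cases hβ : β = 0
    · have : r β = 2 := by
        rw [hr]
        simp only
        have : (Finset.univ.filter (fun x : K => g x = β)) = {0, 1} := by
          ext x
          simp only [Finset.mem_filter, Finset.mem_univ, true_and, Finset.mem_insert,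
            Finset.mem_singleton, hβ, hgdef]
          constructor
          · intro h
            by_cases hx : x = 0
            · exact Or.inl hx
            right
            have h1 : (x ^ 2 ^ k - 1) * x = 0 := by
              rw [pow_succ] at h
              linear_combination h - x * h2
            rcases mul_eq_zero.1 h1 with h1 | h1
            · have : (x + 1) ^ 2 ^ k = 0 := by
                rw [add_pow_char_pow, one_pow]
                linear_combination h1 + h2
              have := pow_eq_zero_iff (by positivity) |>.1 this
              exact add_eq_zero_two.1 this
            · exact absurd h1 hx
          · rintro (rfl | rfl)
            · simp
            · simp [one_add_one_eq_two, h2]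
        rw [this, Finset.card_pair zero_ne_one]
      rw [this]; simp [hβ]
    · have hroot : ∀ x, g x = β ↔ x ^ (2 ^ k + 1) + x + β = 0 := by
        intro x; rw [add_eq_zero_two]
      have : r β = 0 ∨ r β = 1 ∨ r β = 3 := by
        by_cases h0 : r β = 0
        · exact Or.inl h0
        right
        by_cases h1 : r β = 1
        · exact Or.inl h1
        right
        have : 1 < r β := by omega
        obtain ⟨x0, hx0, x1, hx1, hne⟩ := Finset.one_lt_card.1 this
        simp only [Finset.mem_filter, Finset.mem_univ, true_and] at hx0 hx1
        rw [hroot] at hx0 hx1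
        obtain ⟨x2, n0, n1, hx2, hall⟩ := third_root hK hg hβ hx0 hx1 hne
        have : (Finset.univ.filter (fun x : K => g x = β)) = {x0, x1, x2} := by
          ext x
          simp only [Finset.mem_filter, Finset.mem_univ, true_and, Finset.mem_insert,
            Finset.mem_singleton, hroot]
          constructor
          · exact hall x
          · rintro (rfl | rfl | rfl) <;> assumption
        rw [hr]
        simp only
        rw [this]
        exact Finset.card_eq_three.2 ⟨x0, x1, x2, hne, n0.symm, n1.symm, rfl⟩
      rcases this with h | h | h <;> rw [h] <;> simp [hβ]
  have hfil : (Finset.univ.filter (fun β : K => ∀ x : K, x ^ (2 ^ k + 1) + x + β ≠ 0)) =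
      Finset.univ.filter (fun β => r β = 0) := by
    ext β
    simp only [Finset.mem_filter, Finset.mem_univ, true_and, hr, Finset.card_eq_zero,
      Finset.filter_eq_empty_iff, hgdef, forall_true_left, Ne, add_eq_zero_two]
  have hN : ((Finset.univ.filter (fun β => r β = 0)).card : ℤ) =
      ∑ β, (if r β = 0 then 1 else 0 : ℤ) := by
    rw [Finset.card_filter]; push_cast; rfl
  rw [hfil, hN, Finset.mul_sum, Finset.sum_congr rfl (fun β _ => hpt β)]
  rw [Finset.sum_add_distrib, Finset.sum_add_distrib, Finset.sum_sub_distrib,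
    ← Nat.cast_sum, hsum2, hsplit, ← Finset.mul_sum, ← Nat.cast_sum, hsum1]
  push_cast
  rw [hoff]
  simp only [Finset.sum_const, Finset.card_univ, hK, Finset.sum_ite_eq', Finset.mem_univ, if_true,
    nsmul_eq_mul]
  push_cast
  split_ifs with hd
  · rw [hd.neg_one_pow]; ring
  · rw [(Nat.not_even_iff_odd.1 hd).neg_one_pow]; ring

open Classical in
theorem card_fix_le {K : Type*} [Field K] [Fintype K] {g : ℕ} (hg : 0 < g) :
    (Finset.univ.filter (fun x : K => x ^ 2 ^ g = x)).card ≤ 2 ^ g := by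
  have h1 : 1 < 2 ^ g := Nat.one_lt_two_pow (by omega)
  have hne := FiniteField.X_pow_card_sub_X_ne_zero K h1
  have hdeg := FiniteField.X_pow_card_sub_X_natDegree_eq K h1
  calc _ ≤ (Polynomial.X ^ 2 ^ g - Polynomial.X : Polynomial K).roots.toFinset.card := by
        apply Finset.card_le_card
        intro x hx
        simp only [Finset.mem_filter, Finset.mem_univ, true_and] at hx
        rw [Multiset.mem_toFinset, Polynomial.mem_roots hne]
        simp [hx]
    _ ≤ _ := Multiset.toFinset_card_le _
    _ ≤ _ := Polynomial.card_roots' _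
    _ = _ := hdeg

/-- The semilinear map whose fixed vectors give roots. -/
def TT {F : Type*} [Field F] (k : ℕ) (β : F) (v : Fin 2 → F) : Fin 2 → F :=
  ![v 1 ^ 2 ^ k, (v 0 ^ 2 ^ k + v 1 ^ 2 ^ k) / β]

theorem TT_add {F : Type*} [Field F] [CharP F 2] (k : ℕ) (β : F) (v w : Fin 2 → F) :
    TT k β (v + w) = TT k β v + TT k β w := by
  ext i
  fin_cases i
  · simp [TT, add_pow_char_pow]
  · simp [TT, add_pow_char_pow]; ring

theorem TT_zero {F : Type*} [Field F] (k : ℕ) (β : F) : TT k β 0 = 0 := by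
  ext i
  fin_cases i <;> simp [TT]

theorem TT_sum {F : Type*} [Field F] [CharP F 2] (k : ℕ) (β : F) (n : ℕ) (f : ℕ → Fin 2 → F) :
    TT k β (∑ i ∈ Finset.range n, f i) = ∑ i ∈ Finset.range n, TT k β (f i) := by
  induction n with
  | zero => simp [TT_zero]
  | succ n ih => rw [Finset.sum_range_succ, Finset.sum_range_succ, TT_add, ih]

theorem TT_smul {F : Type*} [Field F] (k : ℕ) (β c : F) (v : Fin 2 → F) :
    TT k β (c • v) = c ^ 2 ^ k • TT k β v := by
  ext i
  fin_cases i
  · simp [TT, mul_pow]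
  · simp [TT, mul_pow]; ring

theorem TT_iter_smul {F : Type*} [Field F] (k : ℕ) (β c : F) (v : Fin 2 → F) (i : ℕ) :
    (TT k β)^[i] (c • v) = c ^ 2 ^ (k * i) • (TT k β)^[i] v := by
  induction i with
  | zero => simp
  | succ i ih =>
    rw [Function.iterate_succ_apply', ih, TT_smul, Function.iterate_succ_apply', ← pow_mul,
      ← pow_add, Nat.mul_succ]

theorem frob_inj_aux {F : Type*} [Field F] [Fintype F] [CharP F 2] {k m : ℕ}
    (hF : Fintype.card F = 2 ^ m) (hg : Nat.gcd k m = 1) {i j : ℕ} (hij : i ≤ j) (hj : j < m)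
    (h : ∀ x : F, x ^ 2 ^ (k * i) = x ^ 2 ^ (k * j)) : i = j := by
  classical
  by_contra hne
  have hpos : 0 < j - i := by omega
  have h1 : ∀ x : F, x ^ 2 ^ (k * (j - i)) = x := by
    intro x
    apply (iterateFrobenius F 2 (k * i)).injective
    rw [iterateFrobenius_def, iterateFrobenius_def, h x, ← pow_mul, ← pow_add, ← mul_add]
    congr 3
    omega
  have h2 : ∀ x : F, x ^ 2 ^ (Nat.gcd (j - i) m) = x := by
    intro x
    have := per_gcd (h1 x) (pow_card2 hF x)
    rwa [Nat.Coprime.gcd_mul_left_cancel _ hg] at this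
  have hgp : 0 < Nat.gcd (j - i) m := Nat.gcd_pos_of_pos_left _ hpos
  have h3 := card_fix_le (K := F) hgp
  rw [Finset.filter_true_of_mem (fun x _ => h2 x), Finset.card_univ, hF] at h3
  have h4 := (Nat.pow_le_pow_iff_right (by norm_num : 1 < 2)).1 h3
  have h5 := Nat.gcd_le_left m hpos
  omega

theorem hilbert {F : Type*} [Field F] [Fintype F] [CharP F 2] {k m : ℕ} (hm : 0 < m)
    (hF : Fintype.card F = 2 ^ m) (hg : Nat.gcd k m = 1) {β : F} {w : Fin 2 → F} (hw : w ≠ 0)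
    (hT : (TT k β)^[m] w = w) : ∃ v : Fin 2 → F, v ≠ 0 ∧ TT k β v = v := by
  have hfix : ∀ c : F, TT k β (∑ i ∈ Finset.range m, (TT k β)^[i] (c • w)) =
      ∑ i ∈ Finset.range m, (TT k β)^[i] (c • w) := by
    intro c
    have e1 := Finset.sum_range_succ (fun i => (TT k β)^[i] (c • w)) m
    have e2 := Finset.sum_range_succ' (fun i => (TT k β)^[i] (c • w)) m
    have e3 : (TT k β)^[m] (c • w) = c • w := by
      rw [TT_iter_smul, hT, mul_comm, per_mul k (pow_card2 hF c)]
    rw [e1, e3] at e2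
    simp only [Function.iterate_zero, id_eq] at e2
    rw [TT_sum, add_right_cancel e2]
    refine Finset.sum_congr rfl fun i _ => ?_
    rw [Function.iterate_succ_apply']
  by_contra hcon
  push Not at hcon
  have hz : ∀ c : F, ∑ i ∈ Finset.range m, (TT k β)^[i] (c • w) = 0 := by
    intro c
    by_contra h
    exact hcon _ h (hfix c)
  apply hw
  ext j
  have hinj : Function.Injective
      (fun i : Fin m => ((iterateFrobenius F 2 (k * i) : F →+* F) : F →* F)) := by
    intro i i' h
    have h' : ∀ x : F, x ^ 2 ^ (k * (i : ℕ)) = x ^ 2 ^ (k * (i' : ℕ)) := by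
      intro x
      have := DFunLike.congr_fun h x
      simpa [iterateFrobenius_def] using this
    rcases le_total (i : ℕ) i' with hle | hle
    · exact Fin.ext (frob_inj_aux hF hg hle i'.2 h')
    · exact Fin.ext (frob_inj_aux hF hg hle i.2 (fun x => (h' x).symm)).symm
  have hli := (linearIndependent_monoidHom F F).comp _ hinj
  have := Fintype.linearIndependent_iff.1 hli (fun i => (TT k β)^[(i : ℕ)] w j) ?_ ⟨0, hm⟩
  · simpa using this
  · ext c
    have h1 := congrFun (hz c) j
    rw [← Fin.sum_univ_eq_sum_range (fun i => (TT k β)^[i] (c • w)) m] at h1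
    simp only [Finset.sum_apply, TT_iter_smul] at h1
    simp only [Finset.sum_apply, Pi.smul_apply, smul_eq_mul, Pi.zero_apply, Function.comp] at h1 ⊢
    rw [← h1]
    refine Finset.sum_congr rfl fun i _ => ?_
    simp [iterateFrobenius_def, mul_comm]

theorem root_of_fixed {F : Type*} [Field F] [CharP F 2] {k : ℕ} {β : F} (hβ : β ≠ 0)
    {v : Fin 2 → F} (hv : v ≠ 0) (hT : TT k β v = v) :
    ∃ x : F, x ^ (2 ^ k + 1) + x + β = 0 := by
  have h2 := two_z (K := F)
  have e0 : v 1 ^ 2 ^ k = v 0 := by simpa [TT] using congrFun hT 0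
  have e1 : (v 0 ^ 2 ^ k + v 1 ^ 2 ^ k) / β = v 1 := by simpa [TT] using congrFun hT 1
  have hb : v 1 ≠ 0 := by
    intro h
    apply hv
    ext i
    fin_cases i
    · simp [← e0, h]
    · simp [h]
  have ha : v 0 ≠ 0 := by rw [← e0]; exact pow_ne_zero _ hb
  refine ⟨v 0 / v 1, ?_⟩
  rw [div_eq_iff hβ, e0] at e1
  rw [pow_succ, div_pow, e0]
  field_simp
  linear_combination e1 + β * v 1 * h2

theorem TT_map {K F : Type*} [Field K] [Field F] (φ : K →+* F) (k : ℕ) (β : K) (v : Fin 2 → K)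
    (i : ℕ) : (TT k (φ β))^[i] (fun j => φ (v j)) = fun j => φ ((TT k β)^[i] v j) := by
  induction i with
  | zero => rfl
  | succ i ih =>
    rw [Function.iterate_succ_apply', ih, Function.iterate_succ_apply']
    ext j
    fin_cases j <;> simp [TT]

/-- matrix of iterates of `TT` -/
def NN {F : Type*} [Field F] [CharP F 2] (k : ℕ) (β : F) : ℕ → Matrix (Fin 2) (Fin 2) F
  | 0 => 1
  | i + 1 => !![0, 1; 1 / β, 1 / β] * (NN k β i).map (iterateFrobenius F 2 k)

theorem TT_eq {F : Type*} [Field F] [CharP F 2] (k : ℕ) (β : F) (v : Fin 2 → F) :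
    TT k β v = Matrix.mulVec !![0, 1; 1 / β, 1 / β] (fun j => iterateFrobenius F 2 k (v j)) := by
  ext i
  fin_cases i
  · simp [TT, iterateFrobenius_def, Matrix.mulVec, dotProduct]
  · simp [TT, iterateFrobenius_def, Matrix.mulVec, dotProduct]; ring

theorem mulVec_map2 {F : Type*} [Field F] (φ : F →+* F) (M : Matrix (Fin 2) (Fin 2) F)
    (v : Fin 2 → F) :
    (fun j => φ (Matrix.mulVec M v j)) = Matrix.mulVec (M.map φ) (fun j => φ (v j)) := by
  ext j
  simp [Matrix.mulVec, dotProduct]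

theorem TT_iter {F : Type*} [Field F] [CharP F 2] (k : ℕ) (β : F) (v : Fin 2 → F) (i : ℕ) :
    (TT k β)^[i] v = Matrix.mulVec (NN k β i) (fun j => v j ^ 2 ^ (k * i)) := by
  induction i with
  | zero => simp [NN]
  | succ i ih =>
    rw [Function.iterate_succ_apply', ih, TT_eq, mulVec_map2, Matrix.mulVec_mulVec, NN]
    congr 1
    ext j
    rw [iterateFrobenius_def, ← pow_mul, ← pow_add, Nat.mul_succ]

theorem NN_det {F : Type*} [Field F] [CharP F 2] (k : ℕ) {β : F} (hβ : β ≠ 0) (i : ℕ) :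
    (NN k β i).det ≠ 0 := by
  induction i with
  | zero => simp [NN]
  | succ i ih =>
    rw [NN, Matrix.det_mul]
    apply mul_ne_zero
    · simp [Matrix.det_fin_two, hβ]
    · have := RingHom.map_det (iterateFrobenius F 2 k) (NN k β i)
      rw [RingHom.mapMatrix_apply] at this
      rw [← this]
      exact (map_ne_zero _).2 ih

theorem exists_cyc {K : Type*} [Field K] [Fintype K] [CharP K 2] {k d : ℕ}
    (hK : Fintype.card K = 2 ^ d) (hg : Nat.gcd k d = 1) {β : K} (hβ : β ≠ 0) :
    ∃ w : Fin 2 → K, w ≠ 0 ∧ (TT k β)^[3 * d] w = w := by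
  have h2 := two_z (K := K)
  set N := NN k β d with hN
  set A : Matrix (Fin 2) (Fin 2) K := !![0, 1; 1 / β, 1 / β] with hA
  set σ := iterateFrobenius K 2 k with hσ
  have hTd : ∀ v, (TT k β)^[d] v = Matrix.mulVec N v := by
    intro v
    rw [TT_iter]
    congr 1
    ext j
    rw [mul_comm, per_mul k (pow_card2 hK _)]
  have hcomm : N * A = A * N.map σ := by
    apply Matrix.ext_of_mulVec_single
    intro j
    have hs : (fun l => σ ((Pi.single j 1 : Fin 2 → K) l)) = (Pi.single j 1 : Fin 2 → K) := by
      ext l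
      by_cases h : l = j
      · subst h; simp
      · simp [h]
    have h1 : (TT k β)^[d] (TT k β (Pi.single j 1)) = TT k β ((TT k β)^[d] (Pi.single j 1)) := by
      rw [← Function.iterate_succ_apply, Function.iterate_succ_apply']
    rw [hTd, hTd, TT_eq, TT_eq, mulVec_map2, hs, Matrix.mulVec_mulVec, Matrix.mulVec_mulVec] at h1
    exact h1
  have hAdet : A.det ≠ 0 := by simp [hA, Matrix.det_fin_two, hβ]
  have hNdet : N.det ≠ 0 := NN_det k hβ d
  have hdet : N.det = 1 := by
    have h1 := congrArg Matrix.det hcomm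
    rw [Matrix.det_mul, Matrix.det_mul, mul_comm] at h1
    have h3 := mul_left_cancel₀ hAdet h1
    rw [← RingHom.mapMatrix_apply, ← RingHom.map_det, hσ, iterateFrobenius_def] at h3
    rcases fix_two hK hg h3.symm with h | h
    · exact absurd h hNdet
    · exact h
  have htr : N.trace = 0 ∨ N.trace = 1 := by
    have hAu : IsUnit A.det := isUnit_iff_ne_zero.2 hAdet
    have h1 : N.map σ = A⁻¹ * (N * A) := by
      rw [hcomm, ← mul_assoc, Matrix.nonsing_inv_mul _ hAu, one_mul]
    have h3 : (N.map σ).trace = N.trace := by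
      rw [h1, Matrix.trace_mul_comm, mul_assoc, Matrix.mul_nonsing_inv _ hAu, mul_one]
    have h4 : (N.map σ).trace = σ N.trace := by
      simp [Matrix.trace_fin_two]
    rw [h4, hσ, iterateFrobenius_def] at h3
    exact fix_two hK hg h3
  have hCH : N * N = N.trace • N + 1 := by
    rw [Matrix.det_fin_two] at hdet
    rw [Matrix.trace_fin_two]
    ext i j
    fin_cases i <;> fin_cases j <;> simp [Matrix.mul_apply]
    · linear_combination -hdet - h2
    · ring
    · ring
    · linear_combination -hdet - h2
  have hmul : ∀ v, (TT k β)^[3 * d] v = Matrix.mulVec (N * (N * N)) v := by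
    intro v
    have : 3 * d = d + (d + d) := by ring
    rw [this, Function.iterate_add_apply, Function.iterate_add_apply, hTd, hTd, hTd,
      Matrix.mulVec_mulVec, Matrix.mulVec_mulVec, mul_assoc]
  have hMM : ∀ M : Matrix (Fin 2) (Fin 2) K, M + M = 0 := by
    intro M
    ext i j
    simp only [Matrix.add_apply, Matrix.zero_apply]
    linear_combination M i j * h2
  rcases htr with h | h
  · have hz : (N + 1).det = 0 := by
      rw [Matrix.det_fin_two] at hdet ⊢
      rw [Matrix.trace_fin_two] at h
      simp
      linear_combination hdet + h + h2
    obtain ⟨v, hv, hv0⟩ := Matrix.exists_mulVec_eq_zero_iff.2 hz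
    refine ⟨v, hv, ?_⟩
    have hv1 : Matrix.mulVec N v = v := by
      rw [Matrix.add_mulVec, Matrix.one_mulVec] at hv0
      ext i
      have := congrFun hv0 i
      simp only [Pi.add_apply, Pi.zero_apply] at this
      exact add_eq_zero_two.1 this
    rw [hmul, ← Matrix.mulVec_mulVec, ← Matrix.mulVec_mulVec, hv1, hv1, hv1]
  · have h3 : N * (N * N) = 1 := by
      rw [hCH, h, one_smul, mul_add, mul_one, hCH, h, one_smul, add_right_comm, hMM, zero_add]
    refine ⟨Pi.single 0 1, ?_, ?_⟩
    · intro h0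
      simpa using congrFun h0 0
    · rw [hmul, h3, Matrix.one_mulVec]

theorem transfer {K F : Type*} [Field K] [Fintype K] [CharP K 2] [Field F] [Fintype F] [CharP F 2]
    {k d e : ℕ} (φ : K →+* F) (hd : 0 < d) (he : 0 < e) (hK : Fintype.card K = 2 ^ d)
    (hF : Fintype.card F = 2 ^ (d * e)) (hg : Nat.gcd k (d * e) = 1)
    (hrange : ∀ x : F, x ^ 2 ^ d = x → ∃ y, φ y = x) (β : K) :
    (∀ x : F, x ^ (2 ^ k + 1) + x + φ β ≠ 0) ↔
      ¬ 3 ∣ e ∧ ∀ x : K, x ^ (2 ^ k + 1) + x + β ≠ 0 := by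
  have hgd : Nat.gcd k d = 1 := Nat.Coprime.coprime_mul_right_right hg
  have hβd : (φ β) ^ 2 ^ d = φ β := by rw [← map_pow, pow_card2 hK]
  constructor
  · intro h
    have hK0 : ∀ x : K, x ^ (2 ^ k + 1) + x + β ≠ 0 := by
      intro x hx
      apply h (φ x)
      rw [← map_pow, ← map_add, ← map_add, hx, map_zero]
    refine ⟨?_, hK0⟩
    rintro ⟨f, rfl⟩
    have hβ : β ≠ 0 := by
      rintro rfl
      exact hK0 0 (by simp)
    obtain ⟨w, hw, hTw⟩ := exists_cyc hK hgd hβ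
    have hTw' : (TT k β)^[d * (3 * f)] w = w := by
      have : Function.IsPeriodicPt (TT k β) (3 * d) w := hTw
      have := this.mul_const f
      rwa [show 3 * d * f = d * (3 * f) by ring] at this
    have hφ := TT_map φ k β w (d * (3 * f))
    rw [hTw'] at hφ
    have hw' : (fun j => φ (w j)) ≠ 0 := by
      intro h0
      apply hw
      ext j
      exact (map_eq_zero φ).1 (congrFun h0 j)
    obtain ⟨v, hv, hv1⟩ := hilbert (Nat.mul_pos hd he) hF hg hw' hφ
    obtain ⟨x, hx⟩ := root_of_fixed ((map_ne_zero φ).2 hβ) hv hv1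
    exact h x hx
  · rintro ⟨h3, hK0⟩ x hx
    have hβ : φ β ≠ 0 := by
      intro h0
      rw [(map_eq_zero φ).1 h0] at hK0
      exact hK0 0 (by simp)
    set τ := iterateFrobenius F 2 d with hτ
    have hτβ : τ (φ β) = φ β := by rw [hτ, iterateFrobenius_def, hβd]
    have hτr : ∀ y, y ^ (2 ^ k + 1) + y + φ β = 0 → (τ y) ^ (2 ^ k + 1) + τ y + φ β = 0 := by
      intro y hy
      rw [← hτβ, ← map_pow, ← map_add, ← map_add, hy, map_zero]
    have hnf : ∀ y, y ^ (2 ^ k + 1) + y + φ β = 0 → τ y ≠ y := by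
      intro y hy hf
      rw [hτ, iterateFrobenius_def] at hf
      obtain ⟨z, rfl⟩ := hrange y hf
      apply hK0 z
      apply φ.injective
      rw [map_add, map_add, map_pow, hy, map_zero]
    have hinj := τ.injective
    obtain ⟨x2, n0, n1, hx2, hall⟩ := third_root hF hg hβ hx (hτr x hx) (hnf x hx).symm
    have hττ : τ (τ x) ≠ x := by
      intro hh
      rcases hall _ (hτr _ hx2) with h | h | h
      · rw [← hh] at h
        exact n1 (hinj h)
      · exact n0 (hinj h)
      · exact hnf _ hx2 h
    have hx2e : τ (τ x) = x2 := by
      rcases hall _ (hτr _ (hτr _ hx)) with h | h | h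
      · exact absurd h hττ
      · exact absurd h (hnf _ (hτr _ hx))
      · exact h
    have hτ3 : τ (τ (τ x)) = x := by
      rcases hall _ (hτr _ (hτr _ (hτr _ hx))) with h | h | h
      · exact h
      · exact absurd (hinj h) hττ
      · exact absurd (h.trans hx2e.symm) (hnf _ (hτr _ (hτr _ hx)))
    have hx3 : x ^ 2 ^ (d * 3) = x := by
      rw [hτ, iterateFrobenius_def, iterateFrobenius_def, iterateFrobenius_def, ← pow_mul,
        ← pow_mul, ← pow_add, ← pow_add] at hτ3
      rwa [show d * 3 = d + (d + d) by ring]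
    have := per_gcd hx3 (pow_card2 hF x)
    rw [Nat.gcd_mul_left, (Nat.Prime.coprime_iff_not_dvd Nat.prime_three).2 h3, mul_one] at this
    exact hnf x hx (by rw [hτ, iterateFrobenius_def, this])

open Classical in
theorem count_sub {K F : Type*} [Field K] [Fintype K] [CharP K 2] [Field F] [Fintype F] [CharP F 2]
    {k d e : ℕ} (φ : K →+* F) (hd : 0 < d) (he : 0 < e) (hK : Fintype.card K = 2 ^ d)
    (hF : Fintype.card F = 2 ^ (d * e)) (hg : Nat.gcd k (d * e) = 1) :
    (3 * (Finset.univ.filter (fun β : F => (∀ x : F, x ^ (2 ^ k + 1) + x + β ≠ 0) ∧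
      β ^ 2 ^ d = β)).card : ℤ) = if 3 ∣ e then 0 else 2 ^ d - (-1) ^ d := by
  have hgd : Nat.gcd k d = 1 := Nat.Coprime.coprime_mul_right_right hg
  have himg : Finset.univ.image φ = Finset.univ.filter (fun x : F => x ^ 2 ^ d = x) := by
    apply Finset.eq_of_subset_of_card_le
    · intro x hx
      obtain ⟨y, _, rfl⟩ := Finset.mem_image.1 hx
      simp only [Finset.mem_filter, Finset.mem_univ, true_and]
      rw [← map_pow, pow_card2 hK]
    · rw [Finset.card_image_of_injective _ φ.injective, Finset.card_univ, hK]
      exact card_fix_le hd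
  have hrange : ∀ x : F, x ^ 2 ^ d = x → ∃ y, φ y = x := by
    intro x hx
    have : x ∈ Finset.univ.image φ := by rw [himg]; simpa using hx
    obtain ⟨y, _, hy⟩ := Finset.mem_image.1 this
    exact ⟨y, hy⟩
  have htr := transfer φ hd he hK hF hg hrange
  split_ifs with h3
  · rw [Finset.filter_false_of_mem]
    · simp
    · rintro β _ ⟨h1, h2⟩
      obtain ⟨y, rfl⟩ := hrange β h2
      exact ((htr y).1 h1).1 h3
  · rw [← count_Phi hK hgd, ← Finset.card_image_of_injective (Finset.univ.filter
      (fun β : K => ∀ x : K, x ^ (2 ^ k + 1) + x + β ≠ 0)) φ.injective]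
    congr 3
    ext β
    simp only [Finset.mem_filter, Finset.mem_univ, true_and, Finset.mem_image]
    constructor
    · rintro ⟨h1, h2⟩
      obtain ⟨y, rfl⟩ := hrange β h2
      exact ⟨y, ((htr y).1 h1).2, rfl⟩
    · rintro ⟨y, hy, rfl⟩
      exact ⟨(htr y).2 ⟨h3, hy⟩, by rw [← map_pow, pow_card2 hK]⟩

noncomputable instance fintypeGF (m : ℕ) : Fintype (GaloisField 2 m) := Fintype.ofFinite _

theorem card_GF {m : ℕ} (hm : 0 < m) : Fintype.card (GaloisField 2 m) = 2 ^ m := by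
  rw [← Nat.card_eq_fintype_card]
  exact GaloisField.card 2 m (by omega)

open Classical in
theorem count_GF {k m d e : ℕ} (hm : m = d * e) (hd : 0 < d) (he : 0 < e)
    (hg : Nat.gcd k m = 1) :
    (3 * (Finset.univ.filter (fun β : GaloisField 2 m => β ∈ Phi k m ∧
      β ^ 2 ^ d = β)).card : ℤ) = if 3 ∣ e then 0 else 2 ^ d - (-1) ^ d := by
  subst hm
  have hde := Nat.mul_pos hd he
  obtain ⟨φ⟩ := FiniteField.nonempty_algHom_of_finrank_dvd (F := ZMod 2)
    (K := GaloisField 2 d) (L := GaloisField 2 (d * e))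
    (by rw [GaloisField.finrank 2 (by omega), GaloisField.finrank 2 (by omega)]
        exact dvd_mul_right _ _)
  have h := count_sub φ.toRingHom hd he (card_GF hd) (card_GF hde) hg
  rw [← h]
  congr 3
  ext β
  simp only [Finset.mem_filter, Finset.mem_univ, true_and, Phi, Set.mem_setOf_eq]

theorem fix_inter {K : Type*} [Field K] [Fintype K] [CharP K 2] {m t : ℕ} (hm : 0 < m)
    (hK : Fintype.card K = 2 ^ m) {p : Fin t → ℕ} (hp : ∀ i, Nat.Prime (p i))
    (hpinj : Function.Injective p) (hdvd : ∏ i, p i ∣ m) (β : K) (S : Finset (Fin t)) :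
    (∀ i ∈ S, β ^ 2 ^ (m / p i) = β) ↔ β ^ 2 ^ (m / ∏ i ∈ S, p i) = β := by
  have hSm : ∀ S : Finset (Fin t), ∏ i ∈ S, p i ∣ m := fun S =>
    (Finset.prod_dvd_prod_of_subset _ _ p (Finset.subset_univ S)).trans hdvd
  constructor
  · induction S using Finset.induction_on with
    | empty => intro _; simpa using pow_card2 hK β
    | insert a s ha ih =>
      intro h
      have h1 := ih (fun i hi => h i (Finset.mem_insert_of_mem hi))
      have h2 := h a (Finset.mem_insert_self _ _)
      have h3 := per_gcd h2 h1
      have hcop : Nat.Coprime (p a) (∏ i ∈ s, p i) := by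
        apply Nat.Coprime.prod_right
        intro i hi
        rw [Nat.coprime_primes (hp a) (hp i)]
        intro he
        rw [hpinj he] at ha
        exact ha hi
      have hd := hSm (insert a s)
      rw [Finset.prod_insert ha] at hd ⊢
      obtain ⟨c, hc⟩ := hd
      have hpa := (hp a).pos
      have hps : 0 < ∏ i ∈ s, p i := Finset.prod_pos fun i _ => (hp i).pos
      generalize ∏ i ∈ s, p i = P at *
      generalize p a = q at *
      have e1 : m / q = P * c := by
        rw [hc, mul_assoc]; exact Nat.mul_div_cancel_left _ hpa
      have e2 : m / P = q * c := by
        rw [hc, mul_comm q P, mul_assoc]; exact Nat.mul_div_cancel_left _ hps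
      have e3 : m / (q * P) = c := by
        rw [hc]; exact Nat.mul_div_cancel_left _ (Nat.mul_pos hpa hps)
      rw [e1, e2, Nat.gcd_mul_right, hcop.symm, one_mul] at h3
      rw [e3, h3]
  · intro h i hi
    have hd : p i ∣ ∏ i ∈ S, p i := Finset.dvd_prod_of_mem _ hi
    obtain ⟨c, hc⟩ := hSm S
    obtain ⟨b, hb⟩ := hd
    have hps : 0 < ∏ i ∈ S, p i := Finset.prod_pos fun i _ => (hp i).pos
    have e3 : m / ∏ i ∈ S, p i = c := by
      rw [hc]; exact Nat.mul_div_cancel_left _ hps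
    have e1 : m / p i = c * b := by
      rw [hc, hb, mul_assoc, mul_comm b c]; exact Nat.mul_div_cancel_left _ (hp i).pos
    rw [e1]
    rw [e3] at h
    exact per_mul b h

theorem sum_sign {t : ℕ} (f : Fin t → ℤ) (i : Fin t) (hi : f i = -1) :
    ∑ S : Finset (Fin t), ∏ i ∈ S, f i = 0 := by
  have := Finset.prod_one_add (f := f) Finset.univ
  rw [Finset.powerset_univ] at this
  rw [← this]
  exact Finset.prod_eq_zero (Finset.mem_univ i) (by rw [hi]; norm_num)

theorem alt_sign_total (m t : ℕ) (p : Fin t → ℕ) (hp : ∀ i, Nat.Prime (p i)) (hm0 : 0 < m)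
    (hpinj : Function.Injective p) (hdvd : ∏ i, p i ∣ m) (h2 : 2 ∣ m → ∃ j, p j = 2)
    (ht : 1 ≤ t) :
    ∑ S : Finset (Fin t), (-1 : ℤ) ^ S.card * (-1) ^ (m / ∏ i ∈ S, p i) =
      if t = 1 ∧ m % 4 = 2 then 2 else 0 := by
  have hSm : ∀ S : Finset (Fin t), (m / ∏ i ∈ S, p i) * ∏ i ∈ S, p i = m := fun S =>
    Nat.div_mul_cancel ((Finset.prod_dvd_prod_of_subset _ _ p (Finset.subset_univ S)).trans hdvd)
  have hbase : ∑ S : Finset (Fin t), (-1 : ℤ) ^ S.card = 0 := by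
    have := sum_sign (fun _ : Fin t => (-1 : ℤ)) ⟨0, ht⟩ rfl
    simpa using this
  rcases Nat.even_or_odd m with hev | hodd
  · obtain ⟨j, hj⟩ := h2 hev.two_dvd
    have hoddp : ∀ S : Finset (Fin t), j ∉ S → Odd (∏ i ∈ S, p i) := by
      intro S hS
      rw [← Nat.not_even_iff_odd, even_iff_two_dvd]
      intro h
      obtain ⟨i, hi, hd⟩ := (Nat.prime_two.prime.dvd_finsetProd_iff _).1 h
      have := (Nat.prime_dvd_prime_iff_eq Nat.prime_two (hp i)).1 hd
      rw [← hj] at this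
      rw [hpinj this] at hS
      exact hS hi
    have hPS : ∀ S : Finset (Fin t), j ∈ S → ∃ R, Odd R ∧ ∏ i ∈ S, p i = 2 * R := by
      intro S hS
      refine ⟨∏ i ∈ S.erase j, p i, hoddp _ (Finset.notMem_erase _ _), ?_⟩
      rw [← hj, Finset.mul_prod_erase _ _ hS]
    have hnot : ∀ S : Finset (Fin t), j ∉ S → Even (m / ∏ i ∈ S, p i) := by
      intro S hS
      have h1 := hSm S
      rw [← h1, Nat.even_mul] at hev
      exact hev.resolve_right (Nat.not_even_iff_odd.2 (hoddp S hS))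
    by_cases h4 : m % 4 = 2
    · have hin : ∀ S : Finset (Fin t), j ∈ S → Odd (m / ∏ i ∈ S, p i) := by
        intro S hS
        obtain ⟨R, hR, hRe⟩ := hPS S hS
        have h1 := hSm S
        rw [hRe] at h1 ⊢
        rw [← Nat.not_even_iff_odd]
        rintro ⟨c, hc⟩
        rw [hc] at h1
        have : m = 4 * (c * R) := by rw [← h1]; ring
        omega
      have hterm : ∀ S : Finset (Fin t), (-1 : ℤ) ^ S.card * (-1) ^ (m / ∏ i ∈ S, p i) =
          ∏ i ∈ S, (if i = j then 1 else -1 : ℤ) := by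
        intro S
        by_cases hS : j ∈ S
        · rw [(hin S hS).neg_one_pow, ← Finset.mul_prod_erase S _ hS, if_pos rfl, one_mul,
            Finset.prod_congr rfl (fun i hi => if_neg (Finset.ne_of_mem_erase hi)),
            Finset.prod_const, ← Finset.card_erase_add_one hS, pow_succ]
          ring
        · rw [(hnot S hS).neg_one_pow, mul_one,
            Finset.prod_congr rfl (fun i hi => if_neg (fun h : i = j => hS (h ▸ hi))),
            Finset.prod_const]
      rw [Finset.sum_congr rfl (fun S _ => hterm S)]
      by_cases ht1 : t = 1
      · subst ht1
        have := Finset.prod_one_add (f := fun i => (if i = j then 1 else -1 : ℤ)) Finset.univ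
        rw [Finset.powerset_univ] at this
        rw [← this]
        have hj0 : j = 0 := Subsingleton.elim _ _
        simp [h4, hj0]
      · rw [if_neg (fun h => ht1 h.1)]
        have : Nontrivial (Fin t) := Fin.nontrivial_iff_two_le.2 (by omega)
        obtain ⟨i, hi⟩ := exists_ne j
        exact sum_sign _ i (if_neg hi)
    · rw [if_neg (fun h => h4 h.2), ← hbase]
      refine Finset.sum_congr rfl fun S _ => ?_
      have : Even (m / ∏ i ∈ S, p i) := by
        by_cases hS : j ∈ S
        · obtain ⟨R, hR, hRe⟩ := hPS S hS
          have h1 := hSm S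
          rw [hRe] at h1 ⊢
          by_contra hc
          rw [Nat.not_even_iff_odd] at hc
          obtain ⟨a, ha⟩ := hc.mul hR
          have : m = 2 * (2 * a + 1) := by rw [← ha]; linarith
          omega
        · exact hnot S hS
      rw [this.neg_one_pow, mul_one]
  · have hmo := Nat.odd_iff.1 hodd
    rw [if_neg (fun h => by omega), ← neg_eq_zero, ← hbase, ← Finset.sum_neg_distrib]
    refine Finset.sum_congr rfl fun S _ => ?_
    have : Odd (m / ∏ i ∈ S, p i) := by
      have h1 := hSm S
      rw [← h1, Nat.odd_mul] at hodd
      exact hodd.1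
    rw [this.neg_one_pow]; ring

open Classical in
theorem count_main (k m : ℕ) (hm0 : 0 < m) (hgcd : Nat.gcd k m = 1)
    (n₀ t : ℕ) (p n : Fin t → ℕ)
    (hp : ∀ i, Nat.Prime (p i)) (hp3 : ∀ i, p i ≠ 3)
    (hpinj : Function.Injective p) (hdvd : ∏ i, p i ∣ m)
    (hm : m = 3 ^ n₀ * ∏ i, p i ^ n i) :
    (3 * (PhiNew k m).ncard : ℤ) =
      ∑ S : Finset (Fin t), (-1 : ℤ) ^ S.card *
        (2 ^ (m / ∏ i ∈ S, p i) - (-1) ^ (m / ∏ i ∈ S, p i)) := by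
  have hpm : ∀ i, p i ∣ m := fun i => (Finset.dvd_prod_of_mem p (Finset.mem_univ i)).trans hdvd
  have hnew : ∀ β : GaloisField 2 m, β ∈ PhiNew k m ↔
      β ∈ Phi k m ∧ ∀ i, β ^ 2 ^ (m / p i) ≠ β := by
    intro β
    constructor
    · rintro ⟨h1, h2⟩
      exact ⟨h1, fun i => h2 _ (Nat.div_dvd_of_dvd (hpm i)) (Nat.div_lt_self hm0 (hp i).one_lt)⟩
    · rintro ⟨h1, h2⟩
      refine ⟨h1, fun m' hd hlt hfix => ?_⟩
      obtain ⟨e, he⟩ := hd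
      have he1 : e ≠ 1 := by rintro rfl; omega
      obtain ⟨q, hq, hqe⟩ := Nat.exists_prime_and_dvd he1
      obtain ⟨f, hf⟩ := hqe
      have hmq : m = (m' * f) * q := by rw [he, hf]; ring
      have hfix' := per_mul f hfix
      have hqm : q ∣ m := ⟨m' * f, by rw [hmq]; ring⟩
      have hmf : 0 < m' * f := by
        rcases Nat.eq_zero_or_pos (m' * f) with h | h
        · rw [h, zero_mul] at hmq; omega
        · exact h
      have hmdiv : m / q = m' * f := by
        conv_lhs => rw [hmq]
        exact Nat.mul_div_cancel _ hq.pos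
      have hcases : q = 3 ∨ ∃ i, p i = q := by
        have h3 : q ∣ 3 ^ n₀ * ∏ i, p i ^ n i := hm ▸ hqm
        rcases hq.dvd_mul.1 h3 with h | h
        · left
          exact (Nat.prime_dvd_prime_iff_eq hq Nat.prime_three).1 (hq.dvd_of_dvd_pow h)
        · right
          obtain ⟨i, _, hi⟩ := (hq.prime.dvd_finsetProd_iff _).1 h
          exact ⟨i, ((Nat.prime_dvd_prime_iff_eq hq (hp i)).1 (hq.dvd_of_dvd_pow hi)).symm⟩
      rcases hcases with h | ⟨i, hi⟩
      · have hc := count_GF hmq hmf hq.pos hgcd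
        rw [if_pos (by rw [h])] at hc
        have hc' : (Finset.univ.filter (fun β : GaloisField 2 m => β ∈ Phi k m ∧
          β ^ 2 ^ (m' * f) = β)).card = 0 := by omega
        rw [Finset.card_eq_zero, Finset.filter_eq_empty_iff] at hc'
        exact hc' (Finset.mem_univ β) ⟨h1, hfix'⟩
      · apply h2 i
        rw [hi, hmdiv, hfix']
  have hcard : ((PhiNew k m).ncard : ℤ) = ∑ β : GaloisField 2 m,
      (if β ∈ Phi k m then 1 else 0 : ℤ) *
        ∏ i, (1 + -(if β ^ 2 ^ (m / p i) = β then 1 else 0 : ℤ)) := by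
    have : PhiNew k m = ↑(Finset.univ.filter (fun β : GaloisField 2 m => β ∈ PhiNew k m)) := by
      ext β; simp
    rw [this, Set.ncard_coe_finset, Finset.card_filter]
    push_cast
    refine Finset.sum_congr rfl fun β _ => ?_
    by_cases h1 : β ∈ Phi k m
    · by_cases h2 : ∀ i, β ^ 2 ^ (m / p i) ≠ β
      · rw [if_pos ((hnew β).2 ⟨h1, h2⟩), if_pos h1, Finset.prod_eq_one]
        · simp
        · intro i _; simp [h2 i]
      · rw [if_neg (fun h => h2 ((hnew β).1 h).2)]
        push Not at h2
        obtain ⟨i, hi⟩ := h2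
        rw [Finset.prod_eq_zero (Finset.mem_univ i) (by simp [hi]), mul_zero]
    · rw [if_neg (fun h => h1 ((hnew β).1 h).1), if_neg h1, zero_mul]
  have hprod : ∀ β : GaloisField 2 m, (if β ∈ Phi k m then 1 else 0 : ℤ) *
        ∏ i, (1 + -(if β ^ 2 ^ (m / p i) = β then 1 else 0 : ℤ)) =
      ∑ S : Finset (Fin t), (-1 : ℤ) ^ S.card *
        (if β ∈ Phi k m ∧ β ^ 2 ^ (m / ∏ i ∈ S, p i) = β then 1 else 0 : ℤ) := by
    intro β
    rw [Finset.prod_one_add, Finset.powerset_univ, Finset.mul_sum]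
    refine Finset.sum_congr rfl fun S _ => ?_
    rw [Finset.prod_neg, Finset.prod_ite_zero, Finset.prod_const_one]
    simp only [fix_inter hm0 (card_GF hm0) hp hpinj hdvd β S]
    by_cases h1 : β ∈ Phi k m <;> simp [h1]
  rw [hcard, Finset.sum_congr rfl (fun β _ => hprod β), Finset.sum_comm, Finset.mul_sum]
  refine Finset.sum_congr rfl fun S _ => ?_
  rw [← Finset.mul_sum, mul_left_comm]
  congr 1
  have hSm : (m / ∏ i ∈ S, p i) * ∏ i ∈ S, p i = m :=
    Nat.div_mul_cancel ((Finset.prod_dvd_prod_of_subset _ _ p (Finset.subset_univ S)).trans hdvd)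
  have hps : 0 < ∏ i ∈ S, p i := Finset.prod_pos fun i _ => (hp i).pos
  have hdp : 0 < m / ∏ i ∈ S, p i := by
    rcases Nat.eq_zero_or_pos (m / ∏ i ∈ S, p i) with h | h
    · rw [h, zero_mul] at hSm; omega
    · exact h
  have hc := count_GF hSm.symm hdp hps hgcd
  have h3 : ¬ 3 ∣ ∏ i ∈ S, p i := by
    intro h
    obtain ⟨i, _, hi⟩ := (Nat.prime_three.prime.dvd_finsetProd_iff _).1 h
    exact hp3 i ((Nat.prime_dvd_prime_iff_eq Nat.prime_three (hp i)).1 hi).symm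
  rw [if_neg h3] at hc
  rw [← hc, Finset.card_filter]
  push_cast
  rfl

/-- Counting formula for `N(m) = |PhiNew k m|`. -/
theorem count_new_beta (k m : ℕ) (hk : 0 < k) (hkm : k < m) (hgcd : Nat.gcd k m = 1)
    (n₀ t : ℕ) (p n : Fin t → ℕ)
    (hp : ∀ i, Nat.Prime (p i)) (hp3 : ∀ i, p i ≠ 3)
    (hpinj : Function.Injective p) (hn : ∀ i, 1 ≤ n i)
    (hm : m = 3 ^ n₀ * ∏ i, p i ^ n i) :
    (t = 0 → 3 * (PhiNew k m).ncard = 2 ^ m + 1) ∧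
    (1 ≤ t → (3 * (PhiNew k m).ncard : ℤ) =
      (∑ S : Finset (Fin t), (-1 : ℤ) ^ S.card * 2 ^ (m / ∏ i ∈ S, p i)) -
        (if t = 1 ∧ m % 4 = 2 then 2 else 0)) := by
  have hm0 : 0 < m := by omega
  have hdvd : ∏ i, p i ∣ m := by
    rw [hm]
    exact Dvd.dvd.mul_left (Finset.prod_dvd_prod_of_dvd _ _
      (fun i _ => dvd_pow_self _ (by have := hn i; omega))) _
  have hmain := count_main k m hm0 hgcd n₀ t p n hp hp3 hpinj hdvd hm
  constructor
  · rintro rfl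
    have hodd : Odd m := by
      rw [hm]; simp only [Finset.univ_eq_empty, Finset.prod_empty, mul_one]
      exact Odd.pow (by decide)
    have hu : (Finset.univ : Finset (Finset (Fin 0))) = {∅} := by
      ext S; simp only [Finset.mem_univ, Finset.mem_singleton, Finset.eq_empty_of_isEmpty S]
    rw [hu, Finset.sum_singleton] at hmain
    simp only [Finset.card_empty, pow_zero, one_mul, Finset.prod_empty, Nat.div_one,
      hodd.neg_one_pow, sub_neg_eq_add] at hmain
    exact_mod_cast hmain
  · intro ht
    have h2 : 2 ∣ m → ∃ j, p j = 2 := by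
      intro h
      rw [hm] at h
      rcases Nat.prime_two.dvd_mul.1 h with h | h
      · have := Nat.prime_two.dvd_of_dvd_pow h
        omega
      · obtain ⟨i, _, hi⟩ := (Nat.prime_two.prime.dvd_finsetProd_iff _).1 h
        exact ⟨i, ((Nat.prime_dvd_prime_iff_eq Nat.prime_two (hp i)).1
          (Nat.prime_two.dvd_of_dvd_pow hi)).symm⟩
    rw [hmain, ← alt_sign_total m t p hp hm0 hpinj hdvd h2 ht, ← Finset.sum_sub_distrib]
    exact Finset.sum_congr rfl fun S _ => by ring
end

section
/- Fix coprime positive integers k and m with 0 < k < m. Let Φ(m) = {β ∈ F_{2^m} : X^{2^k+1} + X + β has no root in F_{2^m}}, let b(m) be the number of orbits of Φ(m) under the Frobenius action β ↦ β^2 (equivalently, the number of sets {β^{2^i} : 0 ≤ i ≤ m−1} with β ∈ Φ(m)), and for each divisor m' of m let N(m') be the number of β ∈ Φ(m) lying in the subfield F_{2^{m'}} but in no proper subfield of F_{2^{m'}}. Then b(m) = Σ_{m' ∣ m, 3 ∤ (m/m')} N(m')/m'. -/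
/-- `b(m)`: the number of orbits of `Φ(m)` under the Frobenius action `β ↦ β^2`,
i.e. the number of sets `{β^(2^i) : 0 ≤ i ≤ m-1}` with `β ∈ Φ(m)`. -/
noncomputable def orbitCount (k m : ℕ) : ℕ :=
  {S : Set (GaloisField 2 m) |
    ∃ β ∈ Phi k m, S = {γ | ∃ i : ℕ, i < m ∧ γ = β ^ 2 ^ i}}.ncard

/-- `N(m')` for a divisor `m'` of `m`: the number of `β ∈ Φ(m)` lying in the subfield
`F_{2^(m')}` but in no proper subfield thereof. -/
noncomputable def newCount (k m m' : ℕ) : ℕ :=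
  {β : GaloisField 2 m | β ∈ Phi k m ∧ β ^ 2 ^ m' = β ∧
    ∀ d : ℕ, d ∣ m' → d < m' → β ^ 2 ^ d ≠ β}.ncard

open Function
open scoped Matrix

lemma orbit_aux {α : Type*} [Fintype α] (f : α → α) (m : ℕ) (hm : 0 < m)
    (hf : ∀ x, f^[m] x = x) (P : Set α) (hP : ∀ x ∈ P, f x ∈ P) :
    {S : Set α | ∃ β ∈ P, S = {γ | ∃ i : ℕ, i < m ∧ γ = f^[i] β}}.ncard =
      ∑ d ∈ m.divisors, {β | β ∈ P ∧ minimalPeriod f β = d}.ncard / d := by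
  classical
  have hper : ∀ x, IsPeriodicPt f m x := fun x => hf x
  have hPi : ∀ i, ∀ x ∈ P, f^[i] x ∈ P := by
    intro i
    induction i with
    | zero => intro x hx; simpa using hx
    | succ n ih => intro x hx; rw [iterate_succ_apply]; exact ih _ (hP x hx)
  let O : α → Finset α := fun β => (Finset.range m).image (fun i => f^[i] β)
  have hO : ∀ β γ, γ ∈ O β ↔ ∃ i, f^[i] β = γ := by
    intro β γ
    simp only [O, Finset.mem_image, Finset.mem_range]
    constructor
    · rintro ⟨i, _, h⟩; exact ⟨i, h⟩
    · rintro ⟨i, h⟩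
      exact ⟨i % m, Nat.mod_lt _ hm, by rw [(hper β).iterate_mod_apply, h]⟩
  have hself : ∀ β, β ∈ O β := fun β => (hO β β).2 ⟨0, rfl⟩
  have hsymm : ∀ β γ, γ ∈ O β → β ∈ O γ := by
    intro β γ h
    simp only [O, Finset.mem_image, Finset.mem_range] at h
    obtain ⟨i, hi, rfl⟩ := h
    refine (hO _ _).2 ⟨m - i, ?_⟩
    rw [← iterate_add_apply, Nat.sub_add_cancel hi.le, hf]
  have htrans : ∀ β γ δ, γ ∈ O β → δ ∈ O γ → δ ∈ O β := by
    intro β γ δ h1 h2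
    obtain ⟨i, rfl⟩ := (hO _ _).1 h1
    obtain ⟨j, rfl⟩ := (hO _ _).1 h2
    exact (hO _ _).2 ⟨j + i, iterate_add_apply _ _ _ _⟩
  have heq : ∀ β γ, O γ = O β ↔ γ ∈ O β := by
    intro β γ
    constructor
    · intro h; rw [← h]; exact hself γ
    · intro h; ext δ
      exact ⟨htrans _ _ _ h, htrans _ _ _ (hsymm _ _ h)⟩
  have hmp : ∀ β, β ∈ periodicPts f := fun β => ⟨m, hm, hper β⟩
  have hperO : ∀ β γ, γ ∈ O β → minimalPeriod f γ = minimalPeriod f β := by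
    intro β γ h
    obtain ⟨i, rfl⟩ := (hO _ _).1 h
    exact minimalPeriod_apply_iterate (hmp β) i
  have hcard : ∀ β, (O β).card = minimalPeriod f β := by
    intro β
    have : O β = (Finset.range (minimalPeriod f β)).image (fun i => f^[i] β) := by
      ext γ
      rw [hO]
      simp only [Finset.mem_image, Finset.mem_range]
      constructor
      · rintro ⟨i, h⟩
        exact ⟨i % minimalPeriod f β, Nat.mod_lt _ (minimalPeriod_pos_of_mem_periodicPts (hmp β)),
          by rw [iterate_mod_minimalPeriod_eq, h]⟩
      · rintro ⟨i, _, h⟩; exact ⟨i, h⟩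
    rw [this, Finset.card_image_of_injOn, Finset.card_range]
    intro i hi j hj h
    simp only [Finset.coe_range, Set.mem_Iio] at hi hj
    exact (iterate_eq_iterate_iff_of_lt_minimalPeriod hi hj).1 h
  let PF : Finset α := Finset.univ.filter (· ∈ P)
  let T : ℕ → Finset α := fun d => PF.filter (fun β => minimalPeriod f β = d)
  have h1 : {S : Set α | ∃ β ∈ P, S = {γ | ∃ i : ℕ, i < m ∧ γ = f^[i] β}}.ncard
      = (PF.image O).card := by
    have : {S : Set α | ∃ β ∈ P, S = {γ | ∃ i : ℕ, i < m ∧ γ = f^[i] β}}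
        = (fun s : Finset α => (s : Set α)) '' ((PF.image O : Finset (Finset α)) : Set (Finset α)) := by
      ext S
      simp only [Set.mem_ofPred_eq, Finset.coe_image, Set.mem_image, exists_exists_and_eq_and, PF,
        Finset.coe_filter, Finset.mem_univ, true_and]
      refine exists_congr fun β => and_congr_right fun _ => ?_
      have : ((O β : Finset α) : Set α) = {γ | ∃ i : ℕ, i < m ∧ γ = f^[i] β} := by
        ext γ; simp [O, eq_comm]
      rw [this]; exact eq_comm
    rw [this, Set.ncard_image_of_injective _ Finset.coe_injective, Set.ncard_coe_finset]
  rw [h1]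
  rw [Finset.card_eq_sum_card_fiberwise (f := Finset.card) (t := m.divisors)]
  · refine Finset.sum_congr rfl fun d hd => ?_
    have hd0 : 0 < d := Nat.pos_of_mem_divisors hd
    have e1 : (PF.image O).filter (fun s => s.card = d) = (T d).image O := by
      ext s
      simp only [Finset.mem_filter, Finset.mem_image, T]
      constructor
      · rintro ⟨⟨β, hβ, rfl⟩, h⟩; exact ⟨β, ⟨hβ, by rw [← hcard, h]⟩, rfl⟩
      · rintro ⟨β, ⟨hβ, h⟩, rfl⟩; exact ⟨⟨β, hβ, rfl⟩, by rw [hcard, h]⟩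
    have e2 : {β | β ∈ P ∧ minimalPeriod f β = d}.ncard = (T d).card := by
      rw [← Set.ncard_coe_finset]; congr 1; ext; simp [T, PF]
    have e3 : (T d).card = ((T d).image O).card * d := by
      rw [Finset.card_eq_sum_card_image O (T d), Finset.sum_const_nat]
      intro s hs
      obtain ⟨β, hβ, rfl⟩ := Finset.mem_image.1 hs
      have hb := hβ
      simp only [T, PF, Finset.mem_filter, Finset.mem_univ, true_and] at hb
      rw [← hb.2, ← hcard]
      congr 1
      ext γ
      simp only [T, PF, Finset.mem_filter, Finset.mem_univ, true_and, heq]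
      constructor
      · exact fun h => h.2
      · intro h
        refine ⟨⟨?_, by rw [hcard]; exact hperO _ _ h⟩, h⟩
        obtain ⟨i, rfl⟩ := (hO _ _).1 h
        exact hPi i _ hb.1
    rw [e1, e2, e3, Nat.mul_div_cancel _ hd0]
  · intro s hs
    obtain ⟨β, hβ, rfl⟩ := Finset.mem_image.1 hs
    simp only [Finset.mem_coe, Nat.mem_divisors, hcard]
    exact ⟨(hper β).minimalPeriod_dvd, hm.ne'⟩

lemma key_aux {F : Type*} [Field F] [CharP F 2] (σ : F →+* F) (m d : ℕ) (hm0 : 0 < m)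
    (hm : ∀ x, σ^[m] x = x)
    (hinj : ∀ i < m, ∀ j < m, (∀ x, σ^[i] x = σ^[j] x) → i = j)
    (hfix : ∀ x, σ x = x → x = 0 ∨ x = 1) (β : F) (hβ : β ≠ 0) (hd : d * 3 ∣ m)
    (hβd : σ^[d] β = β) : ∃ x, σ x * x + x + β = 0 := by
  classical
  have h2 : (2 : F) = 0 := CharTwo.two_eq_zero
  let s : Matrix (Fin 2) (Fin 2) F →+* Matrix (Fin 2) (Fin 2) F := σ.mapMatrix
  have hs : ∀ A, s A = A.map σ := fun A => rfl
  have hsi : ∀ i A, s^[i] A = A.map σ^[i] := by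
    intro i
    induction i with
    | zero => intro A; ext; simp
    | succ n ih => intro A; rw [iterate_succ_apply, ih, hs]; ext; simp
  let B : Matrix (Fin 2) (Fin 2) F := !![β⁻¹, β⁻¹; 1, 0]
  have hdB : B.det ≠ 0 := by simp [B, Matrix.det_fin_two, hβ]
  obtain ⟨c, c0, cs⟩ : ∃ c : ℕ → Matrix (Fin 2) (Fin 2) F,
      c 0 = 1 ∧ ∀ i, c (i + 1) = B * s (c i) :=
    ⟨fun i => Nat.rec 1 (fun _ A => B * s A) i, rfl, fun i => rfl⟩
  have c1 : c 1 = B := by rw [← zero_add 1, cs, c0, map_one, mul_one]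
  have cadd : ∀ i j, c (i + j) = c i * s^[i] (c j) := by
    intro i j
    induction i with
    | zero => simp [c0]
    | succ n ih =>
      rw [show n + 1 + j = (n + j) + 1 by ring, cs, ih, cs, map_mul, iterate_succ_apply', mul_assoc]
  have hsB : s^[d] B = B := by
    rw [hsi]
    have : σ^[d] β⁻¹ = β⁻¹ := by rw [← RingHom.coe_pow, map_inv₀, RingHom.coe_pow, hβd]
    ext i j
    fin_cases i <;> fin_cases j <;> simp [B, this, iterate_map_one, iterate_map_zero]
  have hsc : ∀ i, s^[d] (c i) = c i := by
    intro i
    induction i with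
    | zero => rw [c0, iterate_map_one]
    | succ n ih => rw [cs, iterate_map_mul, hsB, ← iterate_succ_apply, iterate_succ_apply', ih]
  obtain ⟨N, hN⟩ : ∃ N, N = c d := ⟨_, rfl⟩
  have hsN : s^[d] N = N := by rw [hN, hsc]
  have hcomm : B * s N = N * B := by
    rw [hN, ← cs, cadd d 1, c1, hsB]
  have hpow : ∀ j, c (d * j) = N ^ j := by
    intro j
    induction j with
    | zero => simp [c0]
    | succ n ih => rw [Nat.mul_succ, add_comm, cadd, hsc, ih, ← hN, pow_succ']
  have hdet0 : ∀ i, (c i).det ≠ 0 := by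
    intro i
    induction i with
    | zero => simp [c0]
    | succ n ih =>
      rw [cs, Matrix.det_mul]
      refine mul_ne_zero hdB ?_
      have : (s (c n)).det = σ (c n).det := (RingHom.map_det σ _).symm
      rw [this]
      exact (map_ne_zero σ).2 ih
  have hdet : N.det = 1 := by
    refine (hfix _ ?_).resolve_left (hN ▸ hdet0 d)
    have h := congrArg Matrix.det hcomm
    rw [Matrix.det_mul, Matrix.det_mul, mul_comm] at h
    have h' := mul_right_cancel₀ hdB h
    exact (RingHom.map_det σ N).trans h'
  have htr : σ N.trace = N.trace := by
    have e : s N = B⁻¹ * (N * B) := by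
      rw [← hcomm, ← mul_assoc, Matrix.nonsing_inv_mul _ (isUnit_iff_ne_zero.2 hdB), one_mul]
    have : (s N).trace = N.trace := by
      rw [e, Matrix.trace_mul_comm, mul_assoc, Matrix.mul_nonsing_inv _ (isUnit_iff_ne_zero.2 hdB),
        mul_one]
    refine Eq.trans ?_ this
    simp only [Matrix.trace, map_sum, hs, Matrix.diag_apply, Matrix.map_apply]
  have hCH : N * N = N.trace • N + 1 := by
    have h1 := hdet
    rw [Matrix.det_fin_two] at h1
    ext i j
    fin_cases i <;> fin_cases j <;>
      simp [Matrix.mul_apply, Fin.sum_univ_two, Matrix.trace_fin_two] <;>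
      first
        | ring1
        | linear_combination - h1 - h2
  have M2 : ∀ A : Matrix (Fin 2) (Fin 2) F, A + A = 0 := by
    intro A; ext i j; simp [CharTwo.add_self_eq_zero]
  obtain ⟨v, hv0, hvd, hvN⟩ : ∃ v : Fin 2 → F, v ≠ 0 ∧ σ^[d] ∘ v = v ∧ N ^ 3 *ᵥ v = v := by
    have hone : (![1, 0] : Fin 2 → F) ≠ 0 ∧ σ^[d] ∘ (![1, 0] : Fin 2 → F) = ![1, 0] := by
      constructor
      · intro h; simpa using congrFun h 0
      · ext i; fin_cases i <;> simp [iterate_map_one, iterate_map_zero]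
    rcases hfix _ htr with ht | ht
    · rw [ht, zero_smul, zero_add] at hCH
      by_cases hN1 : N + 1 = 0
      · have : N = 1 := by
          have := M2 1
          rw [← hN1] at this; exact (add_right_cancel this).symm
        exact ⟨_, hone.1, hone.2, by simp [this]⟩
      · obtain ⟨j, hj⟩ : ∃ j, (fun i => (N + 1) i j) ≠ 0 := by
          by_contra! h
          exact hN1 (by ext i j; exact congrFun (h j) i)
        refine ⟨_, hj, ?_, ?_⟩
        · have h : s^[d] (N + 1) = N + 1 := by
            rw [iterate_map_add, hsN, iterate_map_one]
          rw [hsi] at h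
          ext i
          exact congrFun (congrFun h i) j
        · have h : N ^ 3 * (N + 1) = N + 1 := by
            rw [pow_succ, pow_two, hCH, one_mul, mul_add, hCH, mul_one, add_comm]
          ext i
          exact congrFun (congrFun h i) j
    · rw [ht, one_smul] at hCH
      have : N ^ 3 = 1 := by
        rw [pow_succ, pow_two, hCH, add_mul, hCH, one_mul, add_right_comm, M2, zero_add]
      exact ⟨_, hone.1, hone.2, by simp [this]⟩
  obtain ⟨e, he⟩ := hd
  have hvm : c m *ᵥ v = v := by
    rw [he, mul_assoc, hpow, pow_mul]
    clear he
    induction e with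
    | zero => simp
    | succ n ih => rw [pow_succ, ← Matrix.mulVec_mulVec, hvN, ih]
  let w : ℕ → Fin 2 → F := fun i => c i *ᵥ (σ^[i] ∘ v)
  have w0 : w 0 = v := by simp only [w, c0, Matrix.one_mulVec]; rfl
  have wm : w m = v := by
    have : σ^[m] ∘ v = v := by ext i; exact hm _
    simp only [w, this, hvm]
  have ws : ∀ i, B *ᵥ (σ ∘ w i) = w (i + 1) := by
    intro i
    have : σ ∘ w i = s (c i) *ᵥ (σ^[i+1] ∘ v) := by
      ext j
      simp only [w, comp_apply, RingHom.map_mulVec, hs, iterate_succ', comp_assoc]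
    simp only [this, Matrix.mulVec_mulVec, ← cs, w]
  let W : F → Fin 2 → F := fun a => ∑ i ∈ Finset.range m, σ^[i] a • w i
  have hW : ∀ a, B *ᵥ (σ ∘ W a) = W a := by
    intro a
    have e1 : σ ∘ W a = ∑ i ∈ Finset.range m, σ^[i+1] a • (σ ∘ w i) := by
      ext j
      simp [W, Finset.sum_apply, iterate_succ_apply']
    rw [e1, Matrix.mulVec_sum]
    simp only [Matrix.mulVec_smul, ws]
    have e2 := Finset.sum_range_succ (fun i => σ^[i] a • w i) m
    rw [Finset.sum_range_succ'] at e2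
    simp only [hm, wm, iterate_zero, id, w0] at e2
    exact add_right_cancel e2
  obtain ⟨a, ha⟩ : ∃ a, W a ≠ 0 := by
    by_contra! h
    apply hv0
    have hli := linearIndependent_monoidHom F F
    let g : Fin m → (F →* F) := fun i => ((σ ^ (i : ℕ) : F →+* F) : F →* F)
    have hg : ∀ i x, g i x = σ^[i] x := by
      intro i x
      change (σ ^ (i : ℕ)) x = _
      rw [RingHom.coe_pow]
    have hgi : Injective g := by
      intro i j hij
      refine Fin.ext (hinj i i.2 j j.2 fun x => ?_)
      rw [← hg, ← hg, hij]
    have hli' := Fintype.linearIndependent_iff.1 (hli.comp g hgi)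
    ext j
    have := hli' (fun i => w i j) (by
      ext x
      have hx := congrFun (h x) j
      simp only [W, Finset.sum_apply, Pi.smul_apply, smul_eq_mul, Pi.zero_apply] at hx
      rw [← Fin.sum_univ_eq_sum_range (fun i => σ^[i] x * w i j)] at hx
      simp only [Finset.sum_apply, Pi.smul_apply, smul_eq_mul, comp_apply, hg, Pi.zero_apply]
      rw [← hx]
      exact Finset.sum_congr rfl fun i _ => mul_comm _ _) ⟨0, hm0⟩
    simpa [w0] using this
  have hWa := hW a
  have q0 := congrFun hWa 0
  have q1 := congrFun hWa 1
  simp [B, Matrix.mulVec, dotProduct, Fin.sum_univ_two] at q0 q1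
  have hu : W a 0 ≠ 0 := by
    intro h
    apply ha
    rw [h, map_zero] at q1
    ext i
    fin_cases i
    · exact h
    · exact q1.symm
  generalize W a 0 = u at *
  rw [← q1] at q0
  refine ⟨σ u / u, ?_⟩
  have hsu : σ u ≠ 0 := (map_ne_zero σ).2 hu
  rw [map_div₀]
  field_simp at q0 ⊢
  linear_combination q0 + β * u * h2

theorem orbit_count_formula (k m : ℕ) (hk : 0 < k) (hkm : k < m)
    (hgcd : Nat.gcd k m = 1) :
    orbitCount k m =
      ∑ m' ∈ m.divisors.filter (fun d => ¬ (3 ∣ m / d)), newCount k m m' / m' := by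
  have hm0 : 0 < m := hk.trans hkm
  have : Finite (GaloisField 2 m) := Nat.finite_of_card_ne_zero (by
    rw [GaloisField.card 2 m hm0.ne']; positivity)
  let _ : Fintype (GaloisField 2 m) := Fintype.ofFinite _
  let f : GaloisField 2 m → GaloisField 2 m := fun x => x ^ 2
  have hfi : ∀ i x, f^[i] x = x ^ 2 ^ i := by
    intro i x
    simp only [f, pow_iterate]
  have hfm : ∀ x, f^[m] x = x := by
    intro x
    rw [hfi]
    have h := FiniteField.pow_card x
    rwa [← Nat.card_eq_fintype_card, GaloisField.card 2 m hm0.ne'] at h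
  have hpp : ∀ i x, x ^ 2 ^ i = x ↔ IsPeriodicPt f i x := by
    intro i x
    rw [← hfi]; rfl
  have hord : ∀ i, (∀ x : GaloisField 2 m, x ^ 2 ^ i = x) → m ∣ i := by
    intro i h
    have h1 := FiniteField.orderOf_frobeniusAlgHom (ZMod 2) (GaloisField 2 m)
    rw [GaloisField.finrank 2 hm0.ne'] at h1
    rw [← h1]
    refine orderOf_dvd_of_pow_eq_one (AlgHom.ext fun x => ?_)
    rw [AlgHom.coe_pow, FiniteField.coe_frobeniusAlgHom, pow_iterate, ZMod.card]
    exact h x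
  have hsq : ∀ i, Function.Surjective (fun x : GaloisField 2 m => x ^ 2 ^ i) := by
    intro i
    apply Finite.surjective_of_injective
    intro x y h
    exact (iterateFrobenius (GaloisField 2 m) 2 i).injective
      (by simpa [iterateFrobenius_def] using h)
  -- the key vanishing
  have hkey : ∀ d ∈ m.divisors, 3 ∣ m / d → ∀ β ∈ Phi k m, β ^ 2 ^ d ≠ β := by
    intro d hd h3 β hβ hβd
    have hdm := Nat.dvd_of_mem_divisors hd
    by_cases hβ0 : β = 0
    · subst hβ0
      exact hβ 0 (by simp)
    let σ := iterateFrobenius (GaloisField 2 m) 2 k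
    have hσ : ∀ x, σ x = x ^ 2 ^ k := fun x => iterateFrobenius_def 2 k x
    have hσi : ∀ i x, σ^[i] x = x ^ 2 ^ (k * i) := by
      intro i x
      have : (σ : GaloisField 2 m → GaloisField 2 m) = fun x => x ^ 2 ^ k := funext hσ
      rw [this, pow_iterate, pow_mul 2 k i]
    have hσm : ∀ x, σ^[m] x = x := by
      intro x
      rw [hσi, hpp]
      exact IsPeriodicPt.const_mul (hfm x) k
    have hlt : ∀ i j, i ≤ j → j < m → (∀ x, σ^[i] x = σ^[j] x) → i = j := by
      intro i j hij hj h
      have h1 : m ∣ k * (j - i) := by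
        apply hord
        intro x
        rw [← hσi]
        apply (σ.injective.iterate i)
        rw [← iterate_add_apply, Nat.add_sub_cancel' hij, h]
      have h2 : m ∣ j - i := (Nat.Coprime.symm hgcd).dvd_of_dvd_mul_left h1
      have := Nat.eq_zero_of_dvd_of_lt h2 (by omega)
      omega
    obtain ⟨x, hx⟩ := key_aux σ m d hm0 hσm (by
        intro i hi j hj h
        rcases le_total i j with hij | hij
        · exact hlt i j hij hj h
        · exact (hlt j i hij hi fun x => (h x).symm).symm)
      (by
        intro x hx
        rw [hσ, hpp] at hx
        have h1 : IsPeriodicPt f (Nat.gcd k m) x := hx.gcd (hfm x)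
        rw [hgcd, ← hpp] at h1
        have : x * (x - 1) = 0 := by linear_combination h1
        rcases mul_eq_zero.1 this with h | h
        · exact Or.inl h
        · exact Or.inr (sub_eq_zero.1 h))
      β hβ0 (by
        obtain ⟨e, he⟩ := h3
        refine ⟨e, ?_⟩
        rw [mul_assoc, ← he, Nat.mul_div_cancel' hdm])
      (by
        rw [hσi, hpp]
        exact IsPeriodicPt.const_mul ((hpp _ _).1 hβd) k)
    refine hβ x ?_
    rw [pow_succ, ← hσ]; exact hx
  have hnew : ∀ d ∈ m.divisors,
      newCount k m d = {β | β ∈ Phi k m ∧ minimalPeriod f β = d}.ncard := by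
    intro d hd
    have hd0 := Nat.pos_of_mem_divisors hd
    unfold newCount
    congr 1
    ext β
    refine and_congr_right fun _ => ?_
    simp only [ne_eq, hpp]
    constructor
    · rintro ⟨h1, h2⟩
      by_contra hne
      have hdv := h1.minimalPeriod_dvd
      exact h2 _ hdv (lt_of_le_of_ne (Nat.le_of_dvd hd0 hdv) hne) (isPeriodicPt_minimalPeriod f β)
    · rintro rfl
      exact ⟨isPeriodicPt_minimalPeriod f β, fun e he hlt h =>
        not_isPeriodicPt_of_pos_of_lt_minimalPeriod (Nat.pos_of_dvd_of_pos he hd0).ne' hlt h⟩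
  have hPhi : ∀ β ∈ Phi k m, f β ∈ Phi k m := by
    intro β hβ y hy
    obtain ⟨x, rfl⟩ := hsq 1 y
    refine hβ x ?_
    have : (x ^ (2 ^ k + 1) + x + β) ^ 2 = 0 := by
      rw [CharTwo.add_sq, CharTwo.add_sq, ← hy]
      simp only [f, pow_one, ← pow_mul, mul_comm]
    exact pow_eq_zero_iff (two_ne_zero) |>.1 this
  have hmain := orbit_aux f m hm0 hfm (Phi k m) hPhi
  simp only [hfi] at hmain
  unfold orbitCount
  rw [hmain, Finset.sum_filter]
  refine Finset.sum_congr rfl fun d hd => ?_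
  split_ifs with h
  · have : {β | β ∈ Phi k m ∧ minimalPeriod f β = d} = ∅ := by
      ext β
      simp only [Set.mem_empty_iff_false, iff_false]
      rintro ⟨h1, h2⟩
      exact hkey d hd h β h1 ((hpp _ _).2 (h2 ▸ isPeriodicPt_minimalPeriod f β))
    rw [this, Set.ncard_empty, Nat.zero_div]
  · rw [hnew d hd]
end

section
/- Let m ≥ 3 and let n(m) denote the number of CCZ-equivalence classes among all APN Taniguchi functions f_{k,α,β} on F_{2^m} × F_{2^m}. Then n(m) ≥ (φ(m)/2)·⌈(2^m + 1)/(3m)⌉, where φ denotes Euler's totient function. In particular, the number of pairwise CCZ-inequivalent APN functions on F_{2^{2m}} grows exponentially in m. -/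
/-- The Taniguchi function `f_{k,α,β}` on `K × K`. -/
def taniguchi {K : Type*} [Field K] (k : ℕ) (α β : K) : K × K → K × K :=
  fun p => (p.1 ^ (2 ^ (2 * k) * (2 ^ k + 1)) + α * p.1 ^ (2 ^ (2 * k)) * p.2 ^ (2 ^ k)
      + β * p.2 ^ (2 ^ k + 1), p.1 * p.2)

/-- Two functions `f, g` on a finite-dimensional `F_2`-vector space `V` are CCZ-equivalent
if some affine permutation of `V × V` (an `F_2`-linear bijection composed with a
translation) maps the graph of `f` onto the graph of `g`. -/
def CCZEquivalent {V : Type*} [AddCommGroup V] [Module (ZMod 2) V] (f g : V → V) : Prop :=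
  ∃ (A : V × V → V × V) (c : V × V), IsLinearMap (ZMod 2) A ∧ Function.Bijective A ∧
    (fun p => A p + c) '' {p : V × V | p.2 = f p.1} = {p : V × V | p.2 = g p.1}

/-- The set of all APN Taniguchi functions on `F_{2^m} × F_{2^m}`. -/
def TanSet (m : ℕ) :
    Set ((GaloisField 2 m × GaloisField 2 m) → (GaloisField 2 m × GaloisField 2 m)) :=
  {f | ∃ (k : ℕ) (α β : GaloisField 2 m), 0 < k ∧ k < m ∧ Nat.gcd k m = 1 ∧ β ≠ 0 ∧
    (∀ x : GaloisField 2 m, x ^ (2 ^ k + 1) + α * x + β ≠ 0) ∧ f = taniguchi k α β}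

/-- `n(m)`: the number of CCZ-equivalence classes among all APN Taniguchi functions on
`F_{2^m} × F_{2^m}`. -/
noncomputable def numTaniguchiClasses (m : ℕ) : ℕ :=
  {C : Set ((GaloisField 2 m × GaloisField 2 m) → (GaloisField 2 m × GaloisField 2 m)) |
    ∃ f ∈ TanSet m, C = {g | g ∈ TanSet m ∧ CCZEquivalent f g}}.ncard


set_option linter.unusedSectionVars false
namespace Tani

section basics
variable {F : Type*} [Field F] [Fintype F] [CharP F 2] {m : ℕ} [NeZero m]

/-- Frobenius power indexed by `ZMod m`. -/
def fr (i : ZMod m) (x : F) : F := x ^ (2 ^ i.val)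

lemma fr_add (i : ZMod m) (x y : F) : fr i (x + y) = fr i x + fr i y := by
  unfold fr; exact add_pow_char_pow ..

lemma fr_mul (i : ZMod m) (x y : F) : fr i (x * y) = fr i x * fr i y := by
  unfold fr; exact mul_pow ..

lemma fr_zero (i : ZMod m) : fr i (0 : F) = 0 := by
  unfold fr; simp

lemma fr_one (i : ZMod m) : fr i (1 : F) = 1 := by
  unfold fr; simp

lemma fr_eq_zero {i : ZMod m} {x : F} : fr i x = 0 ↔ x = 0 := by
  unfold fr; simp

lemma fr_sub (i : ZMod m) (x y : F) : fr i (x - y) = fr i x - fr i y := by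
  rw [CharTwo.sub_eq_add, CharTwo.sub_eq_add, fr_add]

lemma fr_inj {i : ZMod m} {x y : F} (h : fr i x = fr i y) : x = y := by
  have : fr i (x - y) = 0 := by rw [fr_sub, h, sub_self]
  exact sub_eq_zero.1 (fr_eq_zero.1 this)

lemma fr_sum {ι : Type*} (s : Finset ι) (g : ι → F) (i : ZMod m) :
    fr i (∑ j ∈ s, g j) = ∑ j ∈ s, fr i (g j) := by
  classical
  induction s using Finset.induction_on with
  | empty => simp [fr_zero]
  | insert a s ha ih => rw [Finset.sum_insert ha, Finset.sum_insert ha, fr_add, ih]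

lemma pow_mod (hq : Fintype.card F = 2 ^ m) (n : ℕ) (x : F) : x ^ (2 ^ (n % m)) = x ^ (2 ^ n) := by
  conv_rhs => rw [← Nat.mod_add_div n m]
  rw [pow_add, pow_mul, pow_mul 2 m, ← hq, FiniteField.pow_card_pow]

lemma fr_natCast (hq : Fintype.card F = 2 ^ m) (n : ℕ) (x : F) :
    fr (n : ZMod m) x = x ^ (2 ^ n) := by
  unfold fr
  rw [ZMod.val_natCast, pow_mod hq]

lemma fr_fr (hq : Fintype.card F = 2 ^ m) (i j : ZMod m) (x : F) :
    fr i (fr j x) = fr (i + j) x := by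
  have h1 : i + j = ((j.val + i.val : ℕ) : ZMod m) := by
    simp [add_comm]
  rw [h1, fr_natCast hq, pow_add, pow_mul]
  rfl

lemma fr_idx_zero (x : F) : fr (0 : ZMod m) x = x := by
  unfold fr; simp

lemma fr_surj (hq : Fintype.card F = 2 ^ m) (i : ZMod m) (x : F) : ∃ y : F, fr i y = x :=
  ⟨fr (-i) x, by rw [fr_fr hq]; simp [fr_idx_zero]⟩

/-- linearized polynomial -/
def lin (c : ZMod m → F) (x : F) : F := ∑ i, c i * fr i x

lemma lin_add (c : ZMod m → F) (x y : F) : lin c (x + y) = lin c x + lin c y := by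
  simp [lin, fr_add, mul_add, Finset.sum_add_distrib]

lemma lin_zero (c : ZMod m → F) : lin c 0 = 0 := by
  simp [lin, fr_zero]

/-- twist of coefficients -/
def tw (t : ZMod m) (c : ZMod m → F) : ZMod m → F := fun j => fr t (c (j - t))

lemma fr_lin (hq : Fintype.card F = 2 ^ m) (t : ZMod m) (c : ZMod m → F) (x : F) :
    fr t (lin c x) = lin (tw t c) x := by
  unfold lin tw
  rw [fr_sum]
  refine Fintype.sum_equiv (Equiv.addRight t) _ _ fun i => ?_
  rw [fr_mul, fr_fr hq]
  simp [add_comm]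

lemma lin_coeff_zero (hq : Fintype.card F = 2 ^ m) (c : ZMod m → F)
    (h : ∀ x, lin c x = 0) : c = 0 := by
  classical
  let p : Polynomial F := ∑ i : ZMod m, Polynomial.C (c i) * Polynomial.X ^ (2 ^ i.val)
  have hp : p = 0 := by
    apply Polynomial.eq_zero_of_natDegree_lt_card_of_eval_eq_zero' p Finset.univ
    · intro x _
      have := h x
      simp only [p, Polynomial.eval_finsetSum, Polynomial.eval_mul, Polynomial.eval_C,
        Polynomial.eval_pow, Polynomial.eval_X]
      exact this
    · rw [Finset.card_univ, hq]
      refine lt_of_le_of_lt (Polynomial.natDegree_sum_le_of_forall_le (n := 2 ^ m - 1) _ _ ?_) ?_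
      · intro i _
        refine (Polynomial.natDegree_C_mul_X_pow_le _ _).trans ?_
        have : 2 ^ i.val < 2 ^ m := Nat.pow_lt_pow_right (by norm_num) (ZMod.val_lt i)
        omega
      · have : 0 < 2 ^ m := by positivity
        omega
  funext i
  have := congrArg (fun r => Polynomial.coeff r (2 ^ i.val)) hp
  simp only [p, Polynomial.finsetSum_coeff, Polynomial.coeff_C_mul, Polynomial.coeff_X_pow,
    Polynomial.coeff_zero] at this
  rw [Finset.sum_eq_single i] at this
  · simpa using this
  · intro j _ hj
    rw [if_neg]
    · simp
    · intro h2
      exact hj (ZMod.val_injective m (Nat.pow_right_injective (le_refl 2) h2).symm)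
  · simp

lemma exists_lin (hq : Fintype.card F = 2 ^ m) (M : F →+ F) : ∃ c : ZMod m → F, ∀ x, M x = lin c x := by
  classical
  let _ : Algebra (ZMod 2) F := ZMod.algebra F 2
  have hfin : Module.finrank (ZMod 2) F = m := by
    have h1 := Module.card_eq_pow_finrank (K := ZMod 2) (V := F)
    rw [hq, ZMod.card] at h1
    exact (Nat.pow_right_injective (le_refl 2) h1).symm
  let e : ZMod m → (F →ₗ[ZMod 2] F) := fun i =>
    AddMonoidHom.toZModLinearMap 2
      { toFun := fr i, map_zero' := fr_zero i, map_add' := fr_add i }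
  have he : ∀ i x, e i x = fr i x := fun i x => rfl
  have hli : LinearIndependent F e := by
    rw [Fintype.linearIndependent_iff]
    intro g hg i
    have : g = 0 := by
      apply lin_coeff_zero hq
      intro x
      have := congrArg (fun r : F →ₗ[ZMod 2] F => r x) hg
      simpa [lin, he] using this
    rw [this]; rfl
  have hs := hli.span_eq_top_of_card_eq_finrank (by
    rw [Module.finrank_linearMap, hfin, ZMod.card, Module.finrank_self, mul_one])
  have hM : AddMonoidHom.toZModLinearMap 2 M ∈ Submodule.span F (Set.range e) := by
    rw [hs]; trivial
  rw [Submodule.mem_span_range_iff_exists_fun] at hM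
  obtain ⟨c, hc⟩ := hM
  refine ⟨c, fun x => ?_⟩
  have := congrArg (fun r : F →ₗ[ZMod 2] F => r x) hc
  simpa [lin, he] using this.symm

lemma exists_lin2 (hq : Fintype.card F = 2 ^ m) (M : F × F → F)
    (hM : ∀ u v, M (u + v) = M u + M v) :
    ∃ c d : ZMod m → F, ∀ v, M v = lin c v.1 + lin d v.2 := by
  have h0 : M 0 = 0 := by simpa using hM 0 0
  obtain ⟨c, hc⟩ := exists_lin (m := m) hq
    { toFun := fun x => M (x, 0), map_zero' := h0, map_add' := fun x y => by rw [← hM]; simp }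
  obtain ⟨d, hd⟩ := exists_lin (m := m) hq
    { toFun := fun x => M (0, x), map_zero' := h0, map_add' := fun x y => by rw [← hM]; simp }
  refine ⟨c, d, fun v => ?_⟩
  rw [← hc, ← hd]
  simp [← hM]

end basics
end Tani

set_option linter.unusedSectionVars false
set_option linter.unusedSimpArgs false
namespace Tani
section W
variable {F : Type*} [Field F] [Fintype F] [CharP F 2] {m : ℕ} [NeZero m]

/-- the embedding of `F × F` into the split form -/
def hat (v : F × F) : (ZMod m → F) × (ZMod m → F) := (fun i => fr i v.1, fun i => fr i v.2)

/-- coordinate vectors -/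
def ex (a : ZMod m) : (ZMod m → F) × (ZMod m → F) := (Pi.single a 1, 0)
/-- coordinate vectors -/
def ey (a : ZMod m) : (ZMod m → F) × (ZMod m → F) := (0, Pi.single a 1)

/-- linear functional with coefficients `p`, `r` -/
def fn (p r : ZMod m → F) (w : (ZMod m → F) × (ZMod m → F)) : F :=
  ∑ i, (p i * w.1 i + r i * w.2 i)

lemma fn_isLin (p r : ZMod m → F) : IsLinearMap F (fn p r) := by
  constructor
  · intro a b
    simp only [fn, ← Finset.sum_add_distrib, Prod.fst_add, Prod.snd_add, Pi.add_apply]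
    exact Finset.sum_congr rfl fun i _ => by ring
  · intro c a
    simp only [fn, smul_eq_mul, Finset.mul_sum, Prod.smul_fst, Prod.smul_snd, Pi.smul_apply]
    exact Finset.sum_congr rfl fun i _ => by ring

lemma fn_ex (p r : ZMod m → F) (a : ZMod m) : fn p r (ex a) = p a := by
  simp [fn, ex, Pi.single_apply]

lemma fn_ey (p r : ZMod m → F) (a : ZMod m) : fn p r (ey a) = r a := by
  simp [fn, ey, Pi.single_apply]

lemma fn_hat (p r : ZMod m → F) (v : F × F) : fn p r (hat v) = lin p v.1 + lin r v.2 := by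
  simp [fn, hat, lin, Finset.sum_add_distrib]

lemma isLin_eq_fn {φ : (ZMod m → F) × (ZMod m → F) → F} (h : IsLinearMap F φ) :
    φ = fn (fun i => φ (ex i)) (fun i => φ (ey i)) := by
  funext w
  have hw : w = ∑ i, (w.1 i • ex i + w.2 i • ey i) := by
    ext j
    · simp [ex, ey, Prod.fst_sum, Finset.sum_apply, Pi.single_apply]
    · simp [ex, ey, Prod.snd_sum, Finset.sum_apply, Pi.single_apply]
  let ψ : (ZMod m → F) × (ZMod m → F) →ₗ[F] F := h.mk' φ
  have hψ : ∀ w, φ w = ψ w := fun _ => rfl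
  rw [hψ]
  conv_lhs => rw [hw]
  simp only [map_sum, map_add, map_smul, smul_eq_mul, fn]
  exact Finset.sum_congr rfl fun i _ => by rw [hψ, hψ]; ring

lemma ext1 (hq : Fintype.card F = 2 ^ m) {φ : (ZMod m → F) × (ZMod m → F) → F}
    (h : IsLinearMap F φ) (h0 : ∀ v, φ (hat v) = 0) (w) : φ w = 0 := by
  rw [isLin_eq_fn h] at h0 ⊢
  have h1 : (fun i => φ (ex i)) = 0 := by
    apply lin_coeff_zero hq
    intro x
    have := h0 (x, 0)
    rwa [fn_hat, lin_zero, add_zero] at this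
  have h2 : (fun i => φ (ey i)) = 0 := by
    apply lin_coeff_zero hq
    intro x
    have := h0 (0, x)
    rwa [fn_hat, lin_zero, zero_add] at this
  rw [h1, h2]
  simp [fn]

lemma ext2 (hq : Fintype.card F = 2 ^ m)
    {φ : (ZMod m → F) × (ZMod m → F) → (ZMod m → F) × (ZMod m → F) → F}
    (h1 : ∀ b, IsLinearMap F (fun a => φ a b)) (h2 : ∀ a, IsLinearMap F (fun b => φ a b))
    (h0 : ∀ u v, φ (hat u) (hat v) = 0) (a b) : φ a b = 0 :=
  ext1 hq (h1 b) (fun u => ext1 hq (h2 _) (fun v => h0 u v) b) a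

lemma ext3 (hq : Fintype.card F = 2 ^ m)
    {φ : (ZMod m → F) × (ZMod m → F) → (ZMod m → F) × (ZMod m → F) →
      (ZMod m → F) × (ZMod m → F) → F}
    (h1 : ∀ b c, IsLinearMap F (fun a => φ a b c)) (h2 : ∀ a c, IsLinearMap F (fun b => φ a b c))
    (h3 : ∀ a b, IsLinearMap F (fun c => φ a b c))
    (h0 : ∀ u v w, φ (hat u) (hat v) (hat w) = 0) (a b c) : φ a b c = 0 :=
  ext1 hq (h1 b c) (fun u => ext2 hq (h2 _) (h3 _) (h0 u) b c) a

lemma ext4 (hq : Fintype.card F = 2 ^ m)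
    {φ : (ZMod m → F) × (ZMod m → F) → (ZMod m → F) × (ZMod m → F) →
      (ZMod m → F) × (ZMod m → F) → (ZMod m → F) × (ZMod m → F) → F}
    (h1 : ∀ b c d, IsLinearMap F (fun a => φ a b c d))
    (h2 : ∀ a c d, IsLinearMap F (fun b => φ a b c d))
    (h3 : ∀ a b d, IsLinearMap F (fun c => φ a b c d))
    (h4 : ∀ a b c, IsLinearMap F (fun d => φ a b c d))
    (h0 : ∀ u v w x, φ (hat u) (hat v) (hat w) (hat x) = 0) (a b c d) : φ a b c d = 0 :=
  ext1 hq (h1 b c d) (fun u => ext3 hq (h2 _) (h3 _) (h4 _) (h0 u) b c d) a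

/-- the polar forms of linear images of the Taniguchi function -/
def Bh (k : ZMod m) (β : F) (p r : ZMod m → F) (w w' : (ZMod m → F) × (ZMod m → F)) : F :=
  ∑ i, (p i * (w.1 (i + 2 * k) * w'.1 (i + 3 * k) + w.1 (i + 3 * k) * w'.1 (i + 2 * k)
      + (w.1 (i + 2 * k) * w'.2 (i + k) + w.2 (i + k) * w'.1 (i + 2 * k))
      + fr i β * (w.2 i * w'.2 (i + k) + w.2 (i + k) * w'.2 i))
    + r i * (w.1 i * w'.2 i + w.2 i * w'.1 i))

lemma Bh_comm (k : ZMod m) (β : F) (p r : ZMod m → F) (w w') :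
    Bh k β p r w w' = Bh k β p r w' w := by
  unfold Bh
  exact Finset.sum_congr rfl fun i _ => by ring

lemma Bh_isLin (k : ZMod m) (β : F) (p r : ZMod m → F) (w) : IsLinearMap F (Bh k β p r w) := by
  constructor
  · intro a b
    simp only [Bh, ← Finset.sum_add_distrib, Prod.fst_add, Prod.snd_add, Pi.add_apply]
    exact Finset.sum_congr rfl fun i _ => by ring
  · intro c a
    simp only [Bh, smul_eq_mul, Finset.mul_sum, Prod.smul_fst, Prod.smul_snd, Pi.smul_apply]
    exact Finset.sum_congr rfl fun i _ => by ring

lemma Bh_add_right (k : ZMod m) (β : F) (p r : ZMod m → F) (w a b) :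
    Bh k β p r w (a + b) = Bh k β p r w a + Bh k β p r w b := (Bh_isLin k β p r w).map_add a b
lemma Bh_smul_right (k : ZMod m) (β : F) (p r : ZMod m → F) (w a) (c : F) :
    Bh k β p r w (c • a) = c * Bh k β p r w a := (Bh_isLin k β p r w).map_smul c a
lemma Bh_add_left (k : ZMod m) (β : F) (p r : ZMod m → F) (w a b) :
    Bh k β p r (a + b) w = Bh k β p r a w + Bh k β p r b w := by
  rw [Bh_comm, Bh_add_right, Bh_comm _ _ _ _ w, Bh_comm _ _ _ _ w]
lemma Bh_smul_left (k : ZMod m) (β : F) (p r : ZMod m → F) (w a) (c : F) :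
    Bh k β p r (c • a) w = c * Bh k β p r a w := by
  rw [Bh_comm, Bh_smul_right, Bh_comm]

lemma Bh_xx (k : ZMod m) (β : F) (p r : ZMod m → F) (a b : ZMod m) :
    Bh k β p r (ex a) (ex b) = (if b = a + k then p (a - 2 * k) else 0)
      + (if a = b + k then p (b - 2 * k) else 0) := by
  unfold Bh ex
  simp only [Pi.single_apply, Pi.zero_apply, mul_zero, zero_mul, add_zero,
    mul_add, Finset.sum_add_distrib]
  congr 1
  · by_cases h : b = a + k
    · rw [if_pos h, Finset.sum_eq_single (a - 2 * k)] <;> grind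
    · rw [if_neg h]
      apply Finset.sum_eq_zero
      grind
  · by_cases h : a = b + k
    · rw [if_pos h, Finset.sum_eq_single (b - 2 * k)] <;> grind
    · rw [if_neg h]
      apply Finset.sum_eq_zero
      grind

lemma Bh_yy (k : ZMod m) (β : F) (p r : ZMod m → F) (a b : ZMod m) :
    Bh k β p r (ey a) (ey b) = (if b = a + k then p a * fr a β else 0)
      + (if a = b + k then p b * fr b β else 0) := by
  unfold Bh ey
  simp only [Pi.single_apply, Pi.zero_apply, mul_zero, zero_mul, add_zero, zero_add,
    mul_add, Finset.sum_add_distrib]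
  congr 1
  · by_cases h : b = a + k
    · rw [if_pos h, Finset.sum_eq_single a] <;> grind
    · rw [if_neg h]
      apply Finset.sum_eq_zero
      grind
  · by_cases h : a = b + k
    · rw [if_pos h, Finset.sum_eq_single b] <;> grind
    · rw [if_neg h]
      apply Finset.sum_eq_zero
      grind

lemma Bh_xy (k : ZMod m) (β : F) (p r : ZMod m → F) (a b : ZMod m) :
    Bh k β p r (ex a) (ey b) = (if a = b + k then p (b - k) else 0)
      + (if a = b then r a else 0) := by
  unfold Bh ex ey
  simp only [Pi.single_apply, Pi.zero_apply, mul_zero, zero_mul, add_zero, zero_add,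
    mul_add, Finset.sum_add_distrib]
  congr 1
  · by_cases h : a = b + k
    · rw [if_pos h, Finset.sum_eq_single (b - k)] <;> grind
    · rw [if_neg h]
      apply Finset.sum_eq_zero
      grind
  · by_cases h : a = b
    · rw [if_pos h, Finset.sum_eq_single a] <;> grind
    · rw [if_neg h]
      apply Finset.sum_eq_zero
      grind

lemma Bh_yx (k : ZMod m) (β : F) (p r : ZMod m → F) (a b : ZMod m) :
    Bh k β p r (ey b) (ex a) = (if a = b + k then p (b - k) else 0)
      + (if a = b then r a else 0) := by
  rw [Bh_comm, Bh_xy]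

end W
end Tani

set_option linter.unusedSectionVars false
set_option linter.unusedSimpArgs false
namespace Tani
section C
variable {F : Type*} [Field F] [Fintype F] [CharP F 2] {m : ℕ} [NeZero m]

/-- the polarised product of two alternating forms -/
def Quart {X : Type*} (B C : X → X → F) (a b c d : X) : F :=
  B a b * C c d + B c d * C a b + B a c * C b d + B b d * C a c + B a d * C b c + B b c * C a d

lemma ix1 (i k : ZMod m) : i + 3 * k - 2 * k = i + k := by ring
lemma ix2 (i k : ZMod m) : i + 4 * k - 2 * k = i + 2 * k := by ring
lemma ix3 (i k : ZMod m) : i + 3 * k - k = i + 2 * k := by ring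
lemma ix4 (i k : ZMod m) : i + k - 2 * k = i - k := by ring
lemma ix5 (i k : ZMod m) : i + 2 * k - k = i + k := by ring
lemma ix6 (i k : ZMod m) : i + 4 * k - k = i + 3 * k := by ring

lemma minors_pp {k : ZMod m} (hk1 : k ≠ 0) (hk2 : 2 * k ≠ 0) (hk3 : 3 * k ≠ 0)
    {β : F} {p1 r1 p2 r2 : ZMod m → F}
    (h : ∀ a b c d, Quart (Bh k β p1 r1) (Bh k β p2 r2) a b c d = 0) (i j : ZMod m) :
    p1 i * p2 j + p1 j * p2 i = 0 := by
  have key : ∀ i, p1 i * p2 (i + k) + p1 (i + k) * p2 i = 0 := by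
    intro i
    have := h (ex (i + 2 * k)) (ex (i + 3 * k)) (ex (i + 4 * k)) (ey (i + k))
    simp only [Quart, Bh_xx, Bh_xy, add_sub_cancel_right, ix1, ix2, ix3, ix4, ix5, ix6] at this
    clear h
    grind (splits := 30)
  by_cases hij : i = j
  · subst hij; rw [CharTwo.add_self_eq_zero]
  by_cases h1 : j = i + k
  · subst h1; exact key i
  by_cases h2 : i = j + k
  · subst h2; rw [add_comm]; exact key j
  have := h (ex (i + 2 * k)) (ex (i + 3 * k)) (ex (j + 2 * k)) (ey (j + k))
  simp only [Quart, Bh_xx, Bh_xy, add_sub_cancel_right, ix1, ix2, ix3, ix4, ix5, ix6] at this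
  clear key h
  grind (splits := 30)

lemma minors_pr {k : ZMod m} (hk1 : k ≠ 0) (hk2 : 2 * k ≠ 0) (hk3 : 3 * k ≠ 0)
    {β : F} (hβ : β ≠ 0) {p1 r1 p2 r2 : ZMod m → F}
    (h : ∀ a b c d, Quart (Bh k β p1 r1) (Bh k β p2 r2) a b c d = 0) (i j : ZMod m) :
    p1 i * r2 j + r1 j * p2 i = 0 := by
  have hpp := minors_pp hk1 hk2 hk3 h
  have hb : fr i β ≠ 0 := fun h => hβ (fr_eq_zero.1 h)
  by_cases h1 : j = i + 2 * k ∨ j = i + 3 * k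
  · have := h (ey i) (ey (i + k)) (ex j) (ey j)
    simp only [Quart, Bh_xx, Bh_xy, Bh_yx, Bh_yy, add_sub_cancel_right, ix1, ix2, ix3, ix4, ix5, ix6] at this
    have h2 : fr i β * (p1 i * r2 j + r1 j * p2 i) = 0 := by
      have e1 := hpp i (j - k)
      clear h hpp
      rcases h1 with rfl | rfl
      · simp only [add_sub_cancel_right, ix1, ix2, ix3, ix4, ix5, ix6] at this e1
        grind (splits := 30)
      · simp only [add_sub_cancel_right, ix1, ix2, ix3, ix4, ix5, ix6] at this e1
        grind (splits := 30)
    simpa [hb] using h2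
  · push Not at h1
    have := h (ex (i + 2 * k)) (ex (i + 3 * k)) (ex j) (ey j)
    simp only [Quart, Bh_xx, Bh_xy, Bh_yx, Bh_yy, add_sub_cancel_right, ix1, ix2, ix3, ix4, ix5, ix6] at this
    have e1 := hpp i (j - k)
    clear h hpp
    grind (splits := 30)

lemma minors_rr {k : ZMod m} (hk1 : k ≠ 0) (hk2 : 2 * k ≠ 0) (hk3 : 3 * k ≠ 0)
    {β : F} (hβ : β ≠ 0) {p1 r1 p2 r2 : ZMod m → F}
    (h : ∀ a b c d, Quart (Bh k β p1 r1) (Bh k β p2 r2) a b c d = 0) (i j : ZMod m) :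
    r1 i * r2 j + r1 j * r2 i = 0 := by
  have hpp := minors_pp hk1 hk2 hk3 h
  have hpr := minors_pr hk1 hk2 hk3 hβ h
  have key : ∀ i, r1 i * r2 (i + k) + r1 (i + k) * r2 i = 0 := by
    intro i
    have := h (ex i) (ey i) (ex (i + k)) (ey (i + k))
    simp only [Quart, Bh_xx, Bh_xy, Bh_yx, Bh_yy, add_sub_cancel_right, ix1, ix2, ix3, ix4, ix5, ix6] at this
    have e1 := hpp (i - 2 * k) i
    clear h
    grind (splits := 30)
  by_cases hij : i = j
  · subst hij; rw [CharTwo.add_self_eq_zero]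
  by_cases h1 : j = i + k
  · subst h1; exact key i
  by_cases h2 : i = j + k
  · subst h2; rw [add_comm]; exact key j
  have := h (ex i) (ey i) (ex j) (ey j)
  simp only [Quart, Bh_xx, Bh_xy, Bh_yx, Bh_yy, add_sub_cancel_right, ix1, ix2, ix3, ix4, ix5, ix6] at this
  clear h
  grind (splits := 30)

/-- Pluecker relation -/
def Plu {X : Type*} (B : X → X → F) : Prop :=
  ∀ a b c d, B a b * B c d + B a c * B b d + B a d * B b c = 0

lemma plu_Bh {k : ZMod m} (hk1 : k ≠ 0) (hk2 : 2 * k ≠ 0) (hk3 : 3 * k ≠ 0)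
    {β : F} (hβ : β ≠ 0) {p r : ZMod m → F} (h : Plu (Bh k β p r)) :
    p = 0 ∧ ∀ i j, i ≠ j → r i * r j = 0 := by
  have hp : p = 0 := by
    funext i
    have := h (ex (i + 2 * k)) (ex (i + 3 * k)) (ey i) (ey (i + k))
    have hb : fr i β ≠ 0 := fun h => hβ (fr_eq_zero.1 h)
    simp only [Bh_xx, Bh_xy, Bh_yx, Bh_yy, add_sub_cancel_right, ix1, ix2, ix3, ix4, ix5, ix6] at this
    have h2 : fr i β * (p i * p i) = 0 := by grind
    simpa [hb] using h2
  refine ⟨hp, fun i j hij => ?_⟩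
  subst hp
  have := h (ex i) (ey i) (ex j) (ey j)
  simp only [Bh_xx, Bh_xy, Bh_yx, Bh_yy, Pi.zero_apply, add_sub_cancel_right, ix1, ix2, ix3, ix4, ix5, ix6] at this
  clear h
  grind (splits := 30)

lemma plu_of_decomp {X : Type*} {f g : X → F} : Plu (fun a b => f a * g b + f b * g a) := by
  intro a b c d
  have h2 : (2 : F) = 0 := CharTwo.two_eq_zero
  linear_combination (f a * f c * g b * g d + f a * f d * g b * g c + f b * f c * g a * g d
    + f b * f d * g a * g c + f a * f b * g c * g d + f c * f d * g a * g b) * h2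

lemma plu_of_cubic {X : Type*} {f : X → F} {B : X → X → F} {a0 : X} (h0 : f a0 ≠ 0)
    (h : ∀ a b c, f a * B b c + f b * B a c + f c * B a b = 0) : Plu B := by
  have : B = fun a b => f a * (B a0 b / f a0) + f b * (B a0 a / f a0) := by
    funext a b
    have := h a0 a b
    rw [add_assoc, CharTwo.add_eq_zero] at this
    field_simp
    linear_combination this
  rw [this]
  exact plu_of_decomp
end C
end Tani

set_option linter.unusedSectionVars false
set_option linter.unusedSimpArgs false
namespace Tani
section D
variable {F : Type*} [Field F]

/-- `φ` is a (non-homogeneous) quadratic map with polar form `B` -/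
structure Quad {V : Type*} [AddCommGroup V] (φ : V → F) (B : V → V → F) : Prop where
  map : ∀ u v, φ (u + v) = φ u + φ v - φ 0 + B u v
  add_left : ∀ u v w, B (u + v) w = B u w + B v w
  add_right : ∀ u v w, B u (v + w) = B u v + B u w

/-- second difference -/
def D2 {V : Type*} [AddCommGroup V] (h : V → F) (a b : V) : F :=
  h (a + b) - h a - h b + h 0
/-- third difference -/
def D3 {V : Type*} [AddCommGroup V] (h : V → F) (a b c : V) : F :=
  h (a + b + c) - h (a + b) - h (a + c) - h (b + c) + h a + h b + h c - h 0
/-- fourth difference -/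
def D4 {V : Type*} [AddCommGroup V] (h : V → F) (a b c d : V) : F :=
  h (a + b + c + d) - h (a + b + c) - h (a + b + d) - h (a + c + d) - h (b + c + d)
   + h (a + b) + h (a + c) + h (a + d) + h (b + c) + h (b + d) + h (c + d)
   - h a - h b - h c - h d + h 0

variable {V : Type*} [AddCommGroup V] {φ ψ : V → F} {B C : V → V → F}

lemma D2_quad (h : Quad φ B) (a b : V) : D2 φ a b = B a b := by
  simp only [D2, h.map]; ring
lemma D3_quad (h : Quad φ B) (a b c : V) : D3 φ a b c = 0 := by
  simp only [D3, h.map, h.add_left, h.add_right]; ring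
lemma D4_quad (h : Quad φ B) (a b c d : V) : D4 φ a b c d = 0 := by
  simp only [D4, h.map, h.add_left, h.add_right]; ring
lemma D4_mul (h : Quad φ B) (h' : Quad ψ C) (a b c d : V) :
    D4 (fun v => φ v * ψ v) a b c d = Quart B C a b c d := by
  simp only [D4, h.map, h.add_left, h.add_right, h'.map, h'.add_left, h'.add_right, Quart]; ring
lemma D3_mul {ℓ : V → F} (hl : Quad ℓ (fun _ _ => 0)) (h : Quad φ B) (a b c : V) :
    D3 (fun v => ℓ v * φ v) a b c =
      (ℓ a - ℓ 0) * B b c + (ℓ b - ℓ 0) * B a c + (ℓ c - ℓ 0) * B a b := by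
  simp only [D3, h.map, h.add_left, h.add_right, hl.map]; ring
lemma D3_sq [CharP F 2] (h : Quad φ B) (a b c : V) : D3 (fun v => φ v * φ v) a b c = 0 := by
  have h2 : (2 : F) = 0 := CharTwo.two_eq_zero
  simp only [D3, h.map, h.add_left, h.add_right]
  linear_combination (B a b * B a c + B a b * B b c + B a c * B b c
    + (φ a - φ 0) * B b c + (φ b - φ 0) * B a c + (φ c - φ 0) * B a b) * h2
lemma D2_mul {ℓ ℓ' : V → F} (hl : Quad ℓ (fun _ _ => 0)) (hl' : Quad ℓ' (fun _ _ => 0)) (a b : V) :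
    D2 (fun v => ℓ v * ℓ' v) a b =
      (ℓ a - ℓ 0) * (ℓ' b - ℓ' 0) + (ℓ b - ℓ 0) * (ℓ' a - ℓ' 0) := by
  simp only [D2, hl.map, hl'.map]; ring
end D

section DD
variable {F : Type*} [Field F] [Fintype F] [CharP F 2] {m : ℕ} [NeZero m]

lemma hat_add (u v : F × F) : (hat (u + v) : (ZMod m → F) × (ZMod m → F)) = hat u + hat v := by
  ext i <;> simp [hat, fr_add]

lemma hat_zero : (hat (0 : F × F) : (ZMod m → F) × (ZMod m → F)) = 0 := by
  ext i <;> simp [hat, fr_zero]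

/-- first component of the Taniguchi function with `α = 1` -/
def f1 (k : ZMod m) (β : F) (v : F × F) : F :=
  fr (2 * k) v.1 * fr (3 * k) v.1 + fr (2 * k) v.1 * fr k v.2 + β * (v.2 * fr k v.2)

/-- canonical shape of the coordinate functions -/
def Form (k : ZMod m) (β : F) (φ : F × F → F) (c : F) (a b p r : ZMod m → F) : Prop :=
  ∀ v, φ v = c + fn a b (hat v) + (lin p (f1 k β v) + lin r (v.1 * v.2))

lemma Bh_hat (hq : Fintype.card F = 2 ^ m) (k : ZMod m) (β : F) (p r : ZMod m → F) (u v : F × F) :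
    Bh k β p r (hat u) (hat v) =
      lin p (fr (2 * k) u.1 * fr (3 * k) v.1 + fr (3 * k) u.1 * fr (2 * k) v.1
       + (fr (2 * k) u.1 * fr k v.2 + fr k u.2 * fr (2 * k) v.1)
       + β * (u.2 * fr k v.2 + fr k u.2 * v.2)) + lin r (u.1 * v.2 + u.2 * v.1) := by
  simp only [Bh, lin, hat, ← Finset.sum_add_distrib, fr_add, fr_mul, fr_fr hq]

lemma lin_sub (c : ZMod m → F) (x y : F) : lin c (x - y) = lin c x - lin c y := by
  rw [eq_sub_iff_add_eq, ← lin_add]; simp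

lemma Form.quad (hq : Fintype.card F = 2 ^ m) {k : ZMod m} {β : F} {φ : F × F → F} {c : F}
    {a b p r : ZMod m → F} (h : Form k β φ c a b p r) :
    Quad φ (fun u v => Bh k β p r (hat u) (hat v)) where
  map u v := by
    rw [h, h, h, h, Bh_hat hq, hat_add, hat_zero, (fn_isLin a b).map_add, (fn_isLin a b).map_zero]
    have e1 : f1 k β (u + v) = f1 k β u + f1 k β v +
      (fr (2 * k) u.1 * fr (3 * k) v.1 + fr (3 * k) u.1 * fr (2 * k) v.1
       + (fr (2 * k) u.1 * fr k v.2 + fr k u.2 * fr (2 * k) v.1)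
       + β * (u.2 * fr k v.2 + fr k u.2 * v.2)) := by
      simp only [f1, Prod.fst_add, Prod.snd_add, fr_add]; ring
    have e2 : (u + v).1 * (u + v).2 = u.1 * u.2 + v.1 * v.2 + (u.1 * v.2 + u.2 * v.1) := by
      simp only [Prod.fst_add, Prod.snd_add]; ring
    have e3 : f1 k β 0 = 0 := by simp [f1, fr_zero]
    have e4 : (0 : F × F).1 * (0 : F × F).2 = 0 := by simp
    rw [e1, e2, e3, e4]
    simp only [lin_add, lin_zero]
    ring
  add_left u v w := by rw [hat_add, Bh_add_left]
  add_right u v w := by rw [hat_add, Bh_add_right]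

lemma Form.affine (hq : Fintype.card F = 2 ^ m) {k : ZMod m} {β : F} {φ : F × F → F} {c : F}
    {a b : ZMod m → F} (h : Form k β φ c a b 0 0) :
    Quad φ (fun _ _ => 0) ∧ ∀ v, φ v - φ 0 = fn a b (hat v) := by
  have h0 : ∀ v, φ v = c + fn a b (hat v) := by
    intro v; rw [h]; simp [lin]
  refine ⟨⟨fun u v => ?_, by simp, by simp⟩, fun v => ?_⟩
  · rw [h0, h0, h0, h0, hat_add, hat_zero, (fn_isLin a b).map_add, (fn_isLin a b).map_zero]; ring
  · rw [h0, h0, hat_zero, (fn_isLin a b).map_zero]; ring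

lemma fn_tw (hq : Fintype.card F = 2 ^ m) (t : ZMod m) (a b : ZMod m → F) (v : F × F) :
    fr t (fn a b (hat v)) = fn (tw t a) (tw t b) (hat v) := by
  rw [fn_hat, fn_hat, fr_add, fr_lin hq, fr_lin hq]

lemma Form.fr (hq : Fintype.card F = 2 ^ m) {k : ZMod m} {β : F} {φ : F × F → F} {c : F}
    {a b p r : ZMod m → F} (h : Form k β φ c a b p r) (t : ZMod m) :
    Form k β (fun v => fr t (φ v)) (fr t c) (tw t a) (tw t b) (tw t p) (tw t r) := by
  intro v
  simp only
  rw [h, fr_add, fr_add, fr_add, fn_tw hq, fr_lin hq, fr_lin hq]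

lemma lin_lc (c1 c2 : F) (p q : ZMod m → F) (x : F) :
    lin (fun i => c1 * p i + c2 * q i) x = c1 * lin p x + c2 * lin q x := by
  simp only [lin, Finset.mul_sum, ← Finset.sum_add_distrib]
  exact Finset.sum_congr rfl fun i _ => by ring

lemma fn_lc (c1 c2 : F) (a b a' b' : ZMod m → F) (w) :
    fn (fun i => c1 * a i + c2 * a' i) (fun i => c1 * b i + c2 * b' i) w
      = c1 * fn a b w + c2 * fn a' b' w := by
  simp only [fn, Finset.mul_sum, ← Finset.sum_add_distrib]
  exact Finset.sum_congr rfl fun i _ => by ring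

lemma Form.lc {k : ZMod m} {β : F} {φ φ' : F × F → F} {c c' : F}
    {a b p r a' b' p' r' : ZMod m → F} (h : Form k β φ c a b p r) (h' : Form k β φ' c' a' b' p' r')
    (c1 c2 : F) :
    Form k β (fun v => c1 * φ v + c2 * φ' v) (c1 * c + c2 * c') (fun i => c1 * a i + c2 * a' i)
     (fun i => c1 * b i + c2 * b' i) (fun i => c1 * p i + c2 * p' i)
     (fun i => c1 * r i + c2 * r' i) := by
  intro v
  simp only
  rw [h, h', fn_lc, lin_lc, lin_lc]
  ring

end DD
end Tani

set_option linter.unusedSectionVars false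
set_option linter.unusedSimpArgs false
namespace Tani
section E
variable {F : Type*} [Field F] [Fintype F] [CharP F 2] {m : ℕ} [NeZero m]

lemma quart_ext (hq : Fintype.card F = 2 ^ m) {k : ZMod m} {β : F} {p1 r1 p2 r2 : ZMod m → F}
    (h : ∀ a b c d, Quart (Bh k β p1 r1) (Bh k β p2 r2) (hat a) (hat b) (hat c) (hat d) = 0)
    (a b c d) : Quart (Bh k β p1 r1) (Bh k β p2 r2) a b c d = 0 := by
  refine ext4 hq (φ := Quart (Bh k β p1 r1) (Bh k β p2 r2)) ?_ ?_ ?_ ?_ h a b c d <;>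
  · intros
    constructor
    · intros
      simp only [Quart, Bh_add_left, Bh_add_right]; ring
    · intros
      simp only [Quart, Bh_smul_left, Bh_smul_right, smul_eq_mul]; ring

lemma quart_ext3 (hq : Fintype.card F = 2 ^ m) {k : ZMod m} {β e : F}
    {p1 r1 p2 r2 p3 r3 p4 r4 : ZMod m → F}
    (h : ∀ a b c d, Quart (Bh k β p1 r1) (Bh k β p2 r2) (hat a) (hat b) (hat c) (hat d)
     + Quart (Bh k β p1 r1) (Bh k β p3 r3) (hat a) (hat b) (hat c) (hat d)
     + e * Quart (Bh k β p4 r4) (Bh k β p3 r3) (hat a) (hat b) (hat c) (hat d) = 0)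
    (a b c d) : Quart (Bh k β p1 r1) (Bh k β p2 r2) a b c d
     + Quart (Bh k β p1 r1) (Bh k β p3 r3) a b c d
     + e * Quart (Bh k β p4 r4) (Bh k β p3 r3) a b c d = 0 := by
  refine ext4 hq (φ := fun a b c d => Quart (Bh k β p1 r1) (Bh k β p2 r2) a b c d
     + Quart (Bh k β p1 r1) (Bh k β p3 r3) a b c d
     + e * Quart (Bh k β p4 r4) (Bh k β p3 r3) a b c d) ?_ ?_ ?_ ?_ h a b c d <;>
  · intros
    constructor
    · intros
      simp only [Quart, Bh_add_left, Bh_add_right]; ring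
    · intros
      simp only [Quart, Bh_smul_left, Bh_smul_right, smul_eq_mul]; ring

lemma cubic_ext (hq : Fintype.card F = 2 ^ m) {k : ZMod m} {β : F} {p1 r1 p2 r2 : ZMod m → F}
    (h : ∀ a b c, fn p1 r1 (hat a) * Bh k β p2 r2 (hat b) (hat c)
      + fn p1 r1 (hat b) * Bh k β p2 r2 (hat a) (hat c)
      + fn p1 r1 (hat c) * Bh k β p2 r2 (hat a) (hat b) = 0)
    (a b c) : fn p1 r1 a * Bh k β p2 r2 b c
      + fn p1 r1 b * Bh k β p2 r2 a c + fn p1 r1 c * Bh k β p2 r2 a b = 0 := by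
  refine ext3 hq (φ := fun a b c => fn p1 r1 a * Bh k β p2 r2 b c
      + fn p1 r1 b * Bh k β p2 r2 a c + fn p1 r1 c * Bh k β p2 r2 a b) ?_ ?_ ?_ h a b c <;>
  · intros
    constructor
    · intros
      simp only [(fn_isLin p1 r1).map_add, Bh_add_left, Bh_add_right]; ring
    · intros
      simp only [(fn_isLin p1 r1).map_smul, Bh_smul_left, Bh_smul_right, smul_eq_mul]; ring

lemma wedge_ext (hq : Fintype.card F = 2 ^ m) {k : ZMod m} {β : F}
    {a1 b1 a2 b2 p r : ZMod m → F}
    (h : ∀ u v, fn a1 b1 (hat u) * fn a2 b2 (hat v) + fn a1 b1 (hat v) * fn a2 b2 (hat u)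
      = Bh k β p r (hat u) (hat v)) (u v) :
    fn a1 b1 u * fn a2 b2 v + fn a1 b1 v * fn a2 b2 u = Bh k β p r u v := by
  rw [← sub_eq_zero]
  refine ext2 hq (φ := fun u v => fn a1 b1 u * fn a2 b2 v + fn a1 b1 v * fn a2 b2 u
    - Bh k β p r u v) ?_ ?_ (fun u v => sub_eq_zero.2 (h u v)) u v <;>
  · intros
    constructor
    · intros
      simp only [(fn_isLin _ _).map_add, Bh_add_left, Bh_add_right]; ring
    · intros
      simp only [(fn_isLin _ _).map_smul, Bh_smul_left, Bh_smul_right, smul_eq_mul]; ring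

lemma wedge_ext3 (hq : Fintype.card F = 2 ^ m) {k : ZMod m} {β e : F}
    {a1 b1 a2 b2 a3 b3 a4 b4 p r : ZMod m → F}
    (h : ∀ u v, fn a1 b1 (hat u) * fn a2 b2 (hat v) + fn a1 b1 (hat v) * fn a2 b2 (hat u)
      + (fn a1 b1 (hat u) * fn a3 b3 (hat v) + fn a1 b1 (hat v) * fn a3 b3 (hat u))
      + e * (fn a4 b4 (hat u) * fn a3 b3 (hat v) + fn a4 b4 (hat v) * fn a3 b3 (hat u))
      = Bh k β p r (hat u) (hat v)) (u v) :
    fn a1 b1 u * fn a2 b2 v + fn a1 b1 v * fn a2 b2 u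
      + (fn a1 b1 u * fn a3 b3 v + fn a1 b1 v * fn a3 b3 u)
      + e * (fn a4 b4 u * fn a3 b3 v + fn a4 b4 v * fn a3 b3 u) = Bh k β p r u v := by
  rw [← sub_eq_zero]
  refine ext2 hq (φ := fun u v => fn a1 b1 u * fn a2 b2 v + fn a1 b1 v * fn a2 b2 u
      + (fn a1 b1 u * fn a3 b3 v + fn a1 b1 v * fn a3 b3 u)
      + e * (fn a4 b4 u * fn a3 b3 v + fn a4 b4 v * fn a3 b3 u)
    - Bh k β p r u v) ?_ ?_ (fun u v => sub_eq_zero.2 (h u v)) u v <;>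
  · intros
    constructor
    · intros
      simp only [(fn_isLin _ _).map_add, Bh_add_left, Bh_add_right]; ring
    · intros
      simp only [(fn_isLin _ _).map_smul, Bh_smul_left, Bh_smul_right, smul_eq_mul]; ring

lemma exists_dep {X : Type*} {s t : X → F} (h : ∀ i j, s i * t j + s j * t i = 0) :
    ∃ c1 c2 : F, (c1 ≠ 0 ∨ c2 ≠ 0) ∧ ∀ i, c1 * s i + c2 * t i = 0 := by
  by_cases h0 : ∃ i, s i ≠ 0
  · obtain ⟨i, hi⟩ := h0
    exact ⟨t i, s i, Or.inr hi, fun j => by rw [← h i j]; ring⟩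
  · push Not at h0
    exact ⟨1, 0, by simp, fun i => by simp [h0]⟩

/-- the affine-combination step -/
lemma plu_step (hq : Fintype.card F = 2 ^ m) {k : ZMod m} {β : F}
    {φ ℓ γ : F × F → F} {c c' : F} {a b p r a' b' : ZMod m → F} {B : F × F → F × F → F}
    (h : Form k β φ c a b p r) (hl : Form k β ℓ c' a' b' 0 0) (hγ : Quad γ B) {e e' : F}
    (heq : ∀ v, e * γ v = ℓ v * φ v + e' * (φ v * φ v)) {v0 : F × F}
    (hv : fn a' b' (hat v0) ≠ 0) : Plu (Bh k β p r) := by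
  refine plu_of_cubic (f := fn a' b') hv (cubic_ext hq fun u v w => ?_)
  obtain ⟨hl1, hl2⟩ := hl.affine hq
  have e1 := D3_mul hl1 (h.quad hq) u v w
  have e2 := D3_sq (h.quad hq) u v w
  have e3 := D3_quad hγ u v w
  rw [hl2, hl2, hl2] at e1
  rw [← e1]
  simp only [D3] at e1 e2 e3 ⊢
  linear_combination e * e3 - e' * e2 - heq (u + v + w) + heq (u + v) + heq (u + w) + heq (v + w)
    - heq u - heq v - heq w + heq 0

lemma step12 (hq : Fintype.card F = 2 ^ m) {k : ZMod m} (hk1 : k ≠ 0) (hk2 : 2 * k ≠ 0)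
    (hk3 : 3 * k ≠ 0) {β : F} (hβ : β ≠ 0) {F1 F2 G : F × F → F} {c1 c2 c3 : F}
    {a1 b1 p1 r1 a2 b2 p2 r2 a3 b3 p3 r3 : ZMod m → F}
    (h1 : Form k β F1 c1 a1 b1 p1 r1) (h2 : Form k β F2 c2 a2 b2 p2 r2)
    (h3 : Form k β G c3 a3 b3 p3 r3) (hs : ∀ x y, ∃ v, F1 v = x ∧ F2 v = y)
    (hG : ∀ v, G v = F1 v * F2 v) :
    p1 = 0 ∧ p2 = 0 ∧ ∃ i, ∀ j, j ≠ i → r1 j = 0 ∧ r2 j = 0 := by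
  have hQ := quart_ext hq (k := k) (β := β) (p1 := p1) (r1 := r1) (p2 := p2) (r2 := r2) (by
    intro a b c d
    have := D4_mul (h1.quad hq) (h2.quad hq) a b c d
    simp only [← hG] at this
    rw [show (fun v => G v) = G from rfl, D4_quad (h3.quad hq)] at this
    exact this.symm)
  have mpp := minors_pp hk1 hk2 hk3 hQ
  have mpr := minors_pr hk1 hk2 hk3 hβ hQ
  have mrr := minors_rr hk1 hk2 hk3 hβ hQ
  obtain ⟨d1, d2, hd, hdep⟩ := exists_dep (s := Sum.elim p1 r1) (t := Sum.elim p2 r2) (by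
    rintro (i | i) (j | j)
    · exact mpp i j
    · exact mpr i j
    · have := mpr j i
      simp only [Sum.elim_inl, Sum.elim_inr]
      linear_combination this
    · exact mrr i j)
  have hl := h1.lc h2 d1 d2
  have e1 : (fun i => d1 * p1 i + d2 * p2 i) = 0 := by
    funext i; exact hdep (Sum.inl i)
  have e2 : (fun i => d1 * r1 i + d2 * r2 i) = 0 := by
    funext i; exact hdep (Sum.inr i)
  rw [e1, e2] at hl
  have hex : ∃ v, fn (fun i => d1 * a1 i + d2 * a2 i) (fun i => d1 * b1 i + d2 * b2 i) (hat v) ≠ 0 := by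
    by_contra hcon
    push Not at hcon
    have := (hl.affine hq).2
    simp only [hcon] at this
    obtain ⟨v, hv1, hv2⟩ := hs 0 0
    obtain ⟨v', hv1', hv2'⟩ := hs 1 0
    obtain ⟨v'', hv1'', hv2''⟩ := hs 0 1
    have t1 := this v
    have t2 := this v'
    have t3 := this v''
    rw [hv1, hv2] at t1
    rw [hv1', hv2'] at t2
    rw [hv1'', hv2''] at t3
    rcases hd with hd | hd
    · apply hd; linear_combination t2 - t1
    · apply hd; linear_combination t3 - t1
  obtain ⟨v0, hv0⟩ := hex
  have h20 : (2 : F) = 0 := CharTwo.two_eq_zero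
  have P1 := plu_step hq (e := d2) (e' := d1) h1 hl (h3.quad hq) (fun v => by
    rw [hG]; linear_combination (- d1 * F1 v * F1 v) * h20) hv0
  have P2 := plu_step hq (e := d1) (e' := d2) h2 hl (h3.quad hq) (fun v => by
    rw [hG]; linear_combination (- d2 * F2 v * F2 v) * h20) hv0
  obtain ⟨z1, s1⟩ := plu_Bh hk1 hk2 hk3 hβ P1
  obtain ⟨z2, s2⟩ := plu_Bh hk1 hk2 hk3 hβ P2
  refine ⟨z1, z2, ?_⟩
  by_cases t1 : ∃ i, r1 i ≠ 0
  · obtain ⟨i, hi⟩ := t1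
    refine ⟨i, fun j hj => ?_⟩
    have hj1 : r1 j = 0 := (mul_eq_zero.1 (s1 j i hj)).resolve_right hi
    refine ⟨hj1, ?_⟩
    have := mrr i j
    rw [hj1, zero_mul, add_zero] at this
    exact (mul_eq_zero.1 this).resolve_left hi
  · push Not at t1
    by_cases t2 : ∃ i, r2 i ≠ 0
    · obtain ⟨i, hi⟩ := t2
      exact ⟨i, fun j hj => ⟨t1 j, (mul_eq_zero.1 (s2 j i hj)).resolve_right hi⟩⟩
    · push Not at t2
      exact ⟨0, fun j _ => ⟨t1 j, t2 j⟩⟩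

lemma tw_zero (t : ZMod m) : tw t (0 : ZMod m → F) = 0 := by
  funext j; simp [tw, fr_zero]

lemma tw_apply_add (t i : ZMod m) (c : ZMod m → F) : tw t c (i + t) = fr t (c i) := by
  simp [tw]

lemma tw_apply_ne {t i j : ZMod m} {c : ZMod m → F} (h : ∀ j, j ≠ i → c j = 0) (hj : j ≠ i + t) :
    tw t c j = 0 := by
  simp only [tw]
  rw [h, fr_zero]
  intro h'
  exact hj (by rw [← h']; ring)

/-- the second Taniguchi function composed with the coordinate functions -/
lemma step3 (hq : Fintype.card F = 2 ^ m) {k l : ZMod m} (hk1 : l ≠ 0) (hk2 : 2 * l ≠ 0)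
    (hk3 : 3 * l ≠ 0) {β β' : F} (hβ : β' ≠ 0) {F1 F2 G : F × F → F} {c1 c2 c3 : F}
    {a1 b1 r1 a2 b2 r2 a3 b3 p3 r3 : ZMod m → F}
    (h1 : Form k β F1 c1 a1 b1 0 r1) (h2 : Form k β F2 c2 a2 b2 0 r2)
    (h3 : Form k β G c3 a3 b3 p3 r3)
    (hG : ∀ v, G v = f1 l β' (F1 v, F2 v)) {i : ZMod m}
    (hi : ∀ j, j ≠ i → r1 j = 0 ∧ r2 j = 0) : r1 = 0 ∧ r2 = 0 := by
  have i1 : ∀ j, j ≠ i → r1 j = 0 := fun j hj => (hi j hj).1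
  have i2 : ∀ j, j ≠ i → r2 j = 0 := fun j hj => (hi j hj).2
  have hQ := quart_ext3 hq (k := k) (β := β) (e := β') (p1 := tw (2 * l) 0) (r1 := tw (2 * l) r1)
    (p2 := tw (3 * l) 0) (r2 := tw (3 * l) r1) (p3 := tw l 0) (r3 := tw l r2)
    (p4 := 0) (r4 := r2) (by
    intro a b c d
    have t1 := D4_mul ((h1.fr hq (2 * l)).quad hq) ((h1.fr hq (3 * l)).quad hq) a b c d
    have t2 := D4_mul ((h1.fr hq (2 * l)).quad hq) ((h2.fr hq l).quad hq) a b c d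
    have t3 := D4_mul (h2.quad hq) ((h2.fr hq l).quad hq) a b c d
    have t4 := D4_quad (h3.quad hq) a b c d
    simp only [Quart] at t1 t2 t3 ⊢
    rw [← t1, ← t2, ← t3, ← t4]
    simp only [D4, hG, f1]
    ring)
  simp only [tw_zero] at hQ
  have d1 : i + l ≠ i := by intro h; apply hk1; linear_combination h
  have d2 : i + 2 * l ≠ i := by intro h; apply hk2; linear_combination h
  have d3 : i + 3 * l ≠ i := by intro h; apply hk3; linear_combination h
  have d21 : i + 2 * l ≠ i + l := by intro h; apply hk1; linear_combination h
  have d31 : i + 3 * l ≠ i + l := by intro h; apply hk2; linear_combination h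
  have d32 : i + 3 * l ≠ i + 2 * l := by intro h; apply hk1; linear_combination h
  have z1 : r1 i = 0 := by
    have := hQ (ex (i + 2 * l)) (ey (i + 2 * l)) (ex (i + 3 * l)) (ey (i + 3 * l))
    simp only [Quart, Bh_xx, Bh_xy, Bh_yx, Bh_yy, Pi.zero_apply, zero_mul, ite_self, zero_add,
      add_zero, if_true, d32, d32.symm, if_false, mul_zero] at this
    rw [tw_apply_add, tw_apply_add, tw_apply_ne i1 d32, tw_apply_ne i2 d21, tw_apply_ne i2 d31,
      i2 _ d2, i2 _ d3] at this
    simp only [zero_mul, mul_zero, add_zero, mul_eq_zero, fr_eq_zero, or_self] at this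
    exact this
  have z1' : r1 = 0 := by
    funext j
    by_cases hj : j = i
    · rw [hj, z1]; rfl
    · exact i1 j hj
  have z2 : r2 i = 0 := by
    have := hQ (ex i) (ey i) (ex (i + l)) (ey (i + l))
    simp only [z1', tw_zero, Quart, Bh_xx, Bh_xy, Bh_yx, Bh_yy, Pi.zero_apply, zero_mul, ite_self,
      zero_add, add_zero, if_true, d1, d1.symm, if_false, mul_zero] at this
    rw [tw_apply_add, i2 _ d1] at this
    simpa [hβ, fr_eq_zero] using this
  refine ⟨z1', ?_⟩
  funext j
  by_cases hj : j = i
  · rw [hj, z2]; rfl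
  · exact i2 j hj

end E
end Tani

set_option linter.unusedSectionVars false
set_option linter.unusedSimpArgs false
namespace Tani
section G
variable {F : Type*} [Field F] [Fintype F] [CharP F 2] {m : ℕ} [NeZero m]

lemma step4 (hq : Fintype.card F = 2 ^ m) {k : ZMod m} (hk1 : k ≠ 0) (hk2 : 2 * k ≠ 0)
    (hk3 : 3 * k ≠ 0) {β : F} (hβ : β ≠ 0) {F1 F2 G : F × F → F} {c1 c2 c3 : F}
    {a1 b1 a2 b2 a3 b3 p3 r3 : ZMod m → F}
    (h1 : Form k β F1 c1 a1 b1 0 0) (h2 : Form k β F2 c2 a2 b2 0 0)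
    (h3 : Form k β G c3 a3 b3 p3 r3) (hs : ∀ x y, ∃ v, F1 v = x ∧ F2 v = y)
    (hG : ∀ v, G v = F1 v * F2 v) :
    ∃ i, a1 i * b2 i + b1 i * a2 i ≠ 0 ∧ ∀ j, j ≠ i → a1 j = 0 ∧ b1 j = 0 ∧ a2 j = 0 ∧ b2 j = 0 := by
  obtain ⟨q1, l1⟩ := h1.affine hq
  obtain ⟨q2, l2⟩ := h2.affine hq
  have hW := wedge_ext hq (k := k) (β := β) (a1 := a1) (b1 := b1) (a2 := a2) (b2 := b2)
    (p := p3) (r := r3) (by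
    intro u v
    rw [← l1, ← l1, ← l2, ← l2, ← D2_mul q1 q2]
    simp only [← hG]
    exact D2_quad (h3.quad hq) u v)
  have hP : Plu (Bh k β p3 r3) := by
    have : Bh k β p3 r3 = fun u v => fn a1 b1 u * fn a2 b2 v + fn a1 b1 v * fn a2 b2 u := by
      funext u v; exact (hW u v).symm
    rw [this]
    exact plu_of_decomp
  obtain ⟨z, s⟩ := plu_Bh hk1 hk2 hk3 hβ hP
  subst z
  have hr : ∃ i, r3 i ≠ 0 := by
    by_contra hcon
    push Not at hcon
    have hr0 : r3 = 0 := funext hcon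
    subst hr0
    have hW0 : ∀ u v, fn a1 b1 (hat u) * fn a2 b2 (hat v) + fn a1 b1 (hat v) * fn a2 b2 (hat u) = 0 := by
      intro u v
      rw [hW]; simp [Bh]
    obtain ⟨v, hv1, hv2⟩ := hs (F1 0 + 1) (F2 0)
    obtain ⟨w, hw1, hw2⟩ := hs (F1 0) (F2 0 + 1)
    have := hW0 v w
    rw [← l1, ← l1, ← l2, ← l2, hv1, hv2, hw1, hw2] at this
    simp at this
  obtain ⟨i, hi⟩ := hr
  have hs' : ∀ j, j ≠ i → r3 j = 0 := fun j hj => (mul_eq_zero.1 (s j i hj)).resolve_right hi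
  have hdet : a1 i * b2 i + b1 i * a2 i = r3 i := by
    have := hW (ex i) (ey i)
    rw [Bh_xy] at this
    simpa [fn_ex, fn_ey] using this
  have key : ∀ w, Bh k β 0 r3 w (ex i) = 0 → Bh k β 0 r3 w (ey i) = 0 →
      fn a1 b1 w = 0 ∧ fn a2 b2 w = 0 := by
    intro w w1 w2
    have e1 := hW w (ex i)
    have e2 := hW w (ey i)
    rw [w1, fn_ex, fn_ex] at e1
    rw [w2, fn_ey, fn_ey] at e2
    have h20 : (2 : F) = 0 := CharTwo.two_eq_zero
    constructor
    · have : r3 i * fn a1 b1 w = 0 := by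
        rw [← hdet]; linear_combination a1 i * e2 + b1 i * e1 - a1 i * b1 i * fn a2 b2 w * h20
      exact (mul_eq_zero.1 this).resolve_left hi
    · have : r3 i * fn a2 b2 w = 0 := by
        rw [← hdet]; linear_combination a2 i * e2 + b2 i * e1 - a2 i * b2 i * fn a1 b1 w * h20
      exact (mul_eq_zero.1 this).resolve_left hi
  refine ⟨i, by rwa [hdet], fun j hj => ?_⟩
  obtain ⟨x1, x2⟩ := key (ex j) (by rw [Bh_xx]; simp) (by rw [Bh_xy]; simp [hj])
  obtain ⟨y1, y2⟩ := key (ey j) (by rw [Bh_yx]; simp [hj.symm]) (by rw [Bh_yy]; simp)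
  rw [fn_ex] at x1 x2
  rw [fn_ey] at y1 y2
  exact ⟨x1, y1, x2, y2⟩

lemma step5 (hq : Fintype.card F = 2 ^ m) {k l : ZMod m}
    (hk1 : k ≠ 0) (hk2 : 2 * k ≠ 0) (hk3 : 3 * k ≠ 0)
    (hl1 : l ≠ 0) (hl2 : 2 * l ≠ 0) (hl3 : 3 * l ≠ 0) (hkl : k + l ≠ 0)
    {β β' : F} (hβ : β ≠ 0) (hβ' : β' ≠ 0) {F1 F2 G : F × F → F} {c1 c2 c3 : F}
    {a1 b1 a2 b2 a3 b3 P R : ZMod m → F}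
    (h1 : Form k β F1 c1 a1 b1 0 0) (h2 : Form k β F2 c2 a2 b2 0 0)
    (h3 : Form k β G c3 a3 b3 P R)
    (hG : ∀ v, G v = f1 l β' (F1 v, F2 v)) {i : ZMod m}
    (hdet : a1 i * b2 i + b1 i * a2 i ≠ 0)
    (hi : ∀ j, j ≠ i → a1 j = 0 ∧ b1 j = 0 ∧ a2 j = 0 ∧ b2 j = 0) :
    k = l ∧ ∃ i : ZMod m, β' = fr i β := by
  have iA : ∀ j, j ≠ i → a1 j = 0 := fun j hj => (hi j hj).1
  have iB : ∀ j, j ≠ i → b1 j = 0 := fun j hj => (hi j hj).2.1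
  have iC : ∀ j, j ≠ i → a2 j = 0 := fun j hj => (hi j hj).2.2.1
  have iD : ∀ j, j ≠ i → b2 j = 0 := fun j hj => (hi j hj).2.2.2
  have hW := wedge_ext3 hq (k := k) (β := β) (e := β')
    (a1 := tw (2 * l) a1) (b1 := tw (2 * l) b1) (a2 := tw (3 * l) a1) (b2 := tw (3 * l) b1)
    (a3 := tw l a2) (b3 := tw l b2) (a4 := a2) (b4 := b2) (p := P) (r := R) (by
    intro u v
    have F20 := h1.fr hq (2 * l)
    have F30 := h1.fr hq (3 * l)
    have F10 := h2.fr hq l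
    simp only [tw_zero] at F20 F30 F10
    obtain ⟨q1, l1⟩ := F20.affine hq
    obtain ⟨q2, l2⟩ := F30.affine hq
    obtain ⟨q3, l3⟩ := F10.affine hq
    obtain ⟨q4, l4⟩ := h2.affine hq
    have t1 := D2_mul q1 q2 u v
    have t2 := D2_mul q1 q3 u v
    have t3 := D2_mul q4 q3 u v
    have t4 := D2_quad (h3.quad hq) u v
    rw [l1, l1, l2, l2] at t1
    rw [l1, l1, l3, l3] at t2
    rw [l4, l4, l3, l3] at t3
    rw [← t1, ← t2, ← t3, ← t4]
    simp only [D2, hG, f1]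
    ring)
  have d1 : i + l ≠ i := by intro h; apply hl1; linear_combination h
  have d2 : i + 2 * l ≠ i := by intro h; apply hl2; linear_combination h
  have d3 : i + 3 * l ≠ i := by intro h; apply hl3; linear_combination h
  have d21 : i + 2 * l ≠ i + l := by intro h; apply hl1; linear_combination h
  have d31 : i + 3 * l ≠ i + l := by intro h; apply hl2; linear_combination h
  have d32 : i + 3 * l ≠ i + 2 * l := by intro h; apply hl1; linear_combination h
  have eX : i + l ≠ i + 2 * l := d21.symm
  have kl : k = l := by
    by_contra hne
    have x1 := hW (ex (i + 2 * l)) (ex (i + 3 * l))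
    have x2 := hW (ex i) (ex (i + l))
    have n1 : i + 3 * l ≠ i + 2 * l + k := by
      intro h; apply hne; linear_combination -h
    have n2 : i + 2 * l ≠ i + 3 * l + k := by
      intro h; apply hkl; linear_combination -h
    have n3 : i + l ≠ i + k := by
      intro h; apply hne; linear_combination -h
    have n4 : i ≠ i + l + k := by
      intro h; apply hkl; linear_combination -h
    simp only [fn_ex, fn_ey, Bh_xx, n1, n2, n3, n4, if_false, tw_apply_add, add_zero,
      tw_apply_ne iA d32, tw_apply_ne iA d32.symm, tw_apply_ne iC d21, tw_apply_ne iC d31,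
      iC _ d2, iC _ d3, tw_apply_ne iA d2.symm, tw_apply_ne iA d3.symm, tw_apply_ne iA d21.symm,
      tw_apply_ne iA d31.symm, tw_apply_ne iC d1.symm, iC _ d1, mul_zero, zero_mul, zero_add,
      mul_eq_zero, fr_eq_zero, or_self, hβ', false_or] at x1 x2
    apply hdet
    rw [x1, x2]; ring
  refine ⟨kl, i, ?_⟩
  subst kl
  have a20 := tw_apply_ne iA d2.symm
  have n24 : i + 2 * k ≠ i + 3 * k + k := by intro h; apply hk2; linear_combination -h
  have n13 : i + k ≠ i + 2 * k + k := by intro h; apply hk2; linear_combination -h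
  have n02 : i ≠ i + k + k := by intro h; apply hk2; linear_combination -h
  have y23 : i + 3 * k = i + 2 * k + k := by ring
  have y12 : i + 2 * k = i + k + k := by ring
  have n24' : i + 2 * k ≠ i + 2 * k + k + k := by intro h; apply hk2; linear_combination -h
  have x1 := hW (ex (i + 2 * k)) (ey (i + 3 * k))
  have x2 := hW (ex (i + k)) (ey (i + 2 * k))
  have x3 := hW (ex i) (ey (i + k))
  have x4 := hW (ex (i + 2 * k)) (ex (i + 3 * k))
  have x5 := hW (ex (i + 2 * k)) (ey (i + k))
  have x6 := hW (ey i) (ey (i + k))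
  rw [Bh_xy, if_neg n24, if_neg d32.symm] at x1
  rw [Bh_xy, if_neg n13, if_neg d21.symm] at x2
  rw [Bh_xy, if_neg n02, if_neg d1.symm] at x3
  rw [Bh_xx, if_pos y23, if_neg n24, add_sub_cancel_right] at x4
  rw [Bh_xy, if_pos y12, if_neg d21, add_sub_cancel_right] at x5
  rw [Bh_yy, if_pos rfl, if_neg n02] at x6
  simp only [fn_ex, fn_ey, tw_apply_add, add_zero,
      tw_apply_ne iA d32, tw_apply_ne iA d32.symm, tw_apply_ne iC d21, tw_apply_ne iC d31,
      iC _ d2, iC _ d3, tw_apply_ne iA d2.symm, tw_apply_ne iA d3.symm, tw_apply_ne iA d21.symm,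
      tw_apply_ne iA d31.symm, tw_apply_ne iC d1.symm, iC _ d1,
      tw_apply_ne iB d32, tw_apply_ne iB d32.symm, tw_apply_ne iD d21, tw_apply_ne iD d31,
      iD _ d2, iD _ d3, tw_apply_ne iB d2.symm, tw_apply_ne iB d3.symm, tw_apply_ne iB d21.symm,
      tw_apply_ne iB d31.symm, tw_apply_ne iD d1.symm, iD _ d1, mul_zero, zero_mul, zero_add,
      mul_eq_zero, fr_eq_zero, hβ', false_or] at x1 x2 x3 x4 x5 x6
  have ha : a1 i ≠ 0 := by
    intro h
    rcases x2 with h' | h' <;> simp [h, h'] at hdet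
  have hd : b2 i ≠ 0 := by
    intro h
    rcases x2 with h' | h' <;> simp [h, h'] at hdet
  have fa : fr (2 * k) (a1 i) ≠ 0 := fun h => ha (fr_eq_zero.1 h)
  have fd : fr k (b2 i) ≠ 0 := fun h => hd (fr_eq_zero.1 h)
  have e1 : fr (3 * k) (a1 i) = fr k (b2 i) := mul_left_cancel₀ fa (x4.trans x5.symm)
  have e2 : fr (2 * k) (a1 i) = b2 i := by
    refine fr_inj (i := k) ?_
    rw [fr_fr hq, ← e1]
    congr 1; ring
  rw [← x4, e1, e2] at x6
  have : (b2 i * fr k (b2 i)) * β' = (b2 i * fr k (b2 i)) * fr i β := by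
    linear_combination x6
  exact mul_left_cancel₀ (mul_ne_zero hd fd) this

end G
end Tani

set_option linter.unusedSectionVars false
set_option linter.unusedSimpArgs false
namespace Tani
section H
variable {F : Type*} [Field F] [Fintype F] [CharP F 2] {m : ℕ} [NeZero m]

lemma tani_eq (hq : Fintype.card F = 2 ^ m) (k : ℕ) (β : F) (v : F × F) :
    taniguchi k 1 β v = (f1 (k : ZMod m) β v, v.1 * v.2) := by
  simp only [taniguchi, f1]
  have e1 : ((2 : ZMod m) * (k : ZMod m)) = ((2 * k : ℕ) : ZMod m) := by push_cast; ring
  have e2 : ((3 : ZMod m) * (k : ZMod m)) = ((3 * k : ℕ) : ZMod m) := by push_cast; ring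
  rw [e1, e2, fr_natCast hq, fr_natCast hq, fr_natCast hq]
  congr 1
  have : (2 : ℕ) ^ (2 * k) * (2 ^ k + 1) = 2 ^ (2 * k) + 2 ^ (3 * k) := by
    rw [mul_add, ← pow_add]; ring_nf
  rw [this, pow_add, pow_succ]
  ring

lemma form_of (hq : Fintype.card F = 2 ^ m) (k : ℕ) (β : F) (M : (F × F) × (F × F) → F)
    (hM : ∀ u v, M (u + v) = M u + M v) (c : F) :
    ∃ a b p r, Form (k : ZMod m) β (fun v => M (v, taniguchi k 1 β v) + c) c a b p r := by
  obtain ⟨a, b, h1⟩ := exists_lin2 hq (fun v : F × F => M (v, 0)) (fun u v => by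
    rw [← hM]; simp)
  obtain ⟨p, r, h2⟩ := exists_lin2 hq (fun v : F × F => M (0, v)) (fun u v => by
    rw [← hM]; simp)
  refine ⟨a, b, p, r, fun v => ?_⟩
  simp only
  have : M (v, taniguchi k 1 β v) = M (v, 0) + M (0, taniguchi k 1 β v) := by
    rw [← hM]; simp
  rw [this, fn_hat, ← h1 v]
  have h3 := h2 (taniguchi k 1 β v)
  rw [h3, tani_eq hq]
  ring

theorem main_ineq [Module (ZMod 2) (F × F)] (hq : Fintype.card F = 2 ^ m) {k l : ℕ}
    (hk1 : (k : ZMod m) ≠ 0) (hk2 : 2 * (k : ZMod m) ≠ 0) (hk3 : 3 * (k : ZMod m) ≠ 0)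
    (hl1 : (l : ZMod m) ≠ 0) (hl2 : 2 * (l : ZMod m) ≠ 0) (hl3 : 3 * (l : ZMod m) ≠ 0)
    (hkl : (k : ZMod m) + l ≠ 0)
    {β β' : F} (hβ : β ≠ 0) (hβ' : β' ≠ 0)
    (h : CCZEquivalent (taniguchi k 1 β) (taniguchi l 1 β')) :
    (k : ZMod m) = l ∧ ∃ i : ZMod m, β' = fr i β := by
  obtain ⟨A, c, hA, -, hgr⟩ := h
  have hadd : ∀ u v, A (u + v) = A u + A v := hA.map_add
  obtain ⟨a1, b1, p1, r1, h1⟩ := form_of hq k β (fun x => (A x).1.1) (fun u v => by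
    simp [hadd]) c.1.1
  obtain ⟨a2, b2, p2, r2, h2⟩ := form_of hq k β (fun x => (A x).1.2) (fun u v => by
    simp [hadd]) c.1.2
  obtain ⟨a3, b3, p3, r3, h3⟩ := form_of hq k β (fun x => (A x).2.1) (fun u v => by
    simp [hadd]) c.2.1
  obtain ⟨a4, b4, p4, r4, h4⟩ := form_of hq k β (fun x => (A x).2.2) (fun u v => by
    simp [hadd]) c.2.2
  have hmem : ∀ v : F × F, (A (v, taniguchi k 1 β v) + c).2
      = taniguchi l 1 β' (A (v, taniguchi k 1 β v) + c).1 := by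
    intro v
    have : A (v, taniguchi k 1 β v) + c ∈ {p : (F × F) × (F × F) | p.2 = taniguchi l 1 β' p.1} := by
      rw [← hgr]
      exact ⟨(v, taniguchi k 1 β v), rfl, rfl⟩
    exact this
  have hs : ∀ x y : F, ∃ v : F × F, (A (v, taniguchi k 1 β v)).1.1 + c.1.1 = x ∧
      (A (v, taniguchi k 1 β v)).1.2 + c.1.2 = y := by
    intro x y
    have : ((x, y), taniguchi l 1 β' (x, y)) ∈
        {p : (F × F) × (F × F) | p.2 = taniguchi l 1 β' p.1} := rfl
    rw [← hgr] at this
    obtain ⟨⟨v, w⟩, hw, hv⟩ := this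
    simp only [Set.mem_ofPred_eq] at hw
    subst hw
    refine ⟨v, ?_, ?_⟩
    · exact congrArg (fun z => z.1.1) hv
    · exact congrArg (fun z => z.1.2) hv
  have hG1 : ∀ v, (A (v, taniguchi k 1 β v)).2.1 + c.2.1 = f1 (l : ZMod m) β'
      ((A (v, taniguchi k 1 β v)).1.1 + c.1.1, (A (v, taniguchi k 1 β v)).1.2 + c.1.2) := by
    intro v
    have := hmem v
    rw [tani_eq hq l] at this
    exact congrArg Prod.fst this
  have hG2 : ∀ v, (A (v, taniguchi k 1 β v)).2.2 + c.2.2 =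
      ((A (v, taniguchi k 1 β v)).1.1 + c.1.1) * ((A (v, taniguchi k 1 β v)).1.2 + c.1.2) := by
    intro v
    have := hmem v
    rw [tani_eq hq l] at this
    exact congrArg Prod.snd this
  obtain ⟨z1, z2, i, hi⟩ := step12 hq hk1 hk2 hk3 hβ h1 h2 h4 hs hG2
  subst z1 z2
  obtain ⟨z1, z2⟩ := step3 hq hl1 hl2 hl3 hβ' h1 h2 h3 hG1 hi
  subst z1 z2
  obtain ⟨i, hd, hi⟩ := step4 hq hk1 hk2 hk3 hβ h1 h2 h4 hs hG2
  exact step5 hq hk1 hk2 hk3 hl1 hl2 hl3 hkl hβ hβ' h1 h2 h3 hG1 hd hi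

end H
end Tani

set_option linter.unusedSectionVars false
set_option linter.unusedSimpArgs false
namespace Tani
section I
variable {F : Type*} [Field F] [Fintype F] [CharP F 2] {m : ℕ} [NeZero m]

lemma fr_iter (hq : Fintype.card F = 2 ^ m) {k : ZMod m} {x e : F} (he : fr k e = e)
    (h : fr k x = x + e) (n : ℕ) : fr ((n : ZMod m) * k) x = x + n * e := by
  induction n with
  | zero => simp [fr_idx_zero]
  | succ n ih =>
    rw [show (((n + 1 : ℕ) : ZMod m) * k) = k + (n : ZMod m) * k by push_cast; ring, ← fr_fr hq, ih,
      fr_add, h, fr_mul, he]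
    have : fr k (n : F) = n := by
      clear ih
      induction n with
      | zero => simp [fr_zero]
      | succ n ih => push_cast; rw [fr_add, ih, fr_one]
    rw [this]; push_cast; ring

lemma fr_fix (hq : Fintype.card F = 2 ^ m) {k : ZMod m} (hk : IsUnit k) {x : F}
    (h : fr k x = x) : x = 0 ∨ x = 1 := by
  obtain ⟨u, rfl⟩ := hk
  have h1 := fr_iter hq (k := (u : ZMod m)) (x := x) (e := 0) (fr_zero _) (by simpa using h)
    ((u⁻¹ : (ZMod m)ˣ) : ZMod m).val
  rw [ZMod.natCast_zmod_val, Units.inv_mul, mul_zero, add_zero] at h1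
  have h2 := fr_natCast hq 1 x
  rw [Nat.cast_one, h1, pow_one] at h2
  have : x * (x - 1) = 0 := by linear_combination -h2
  rcases mul_eq_zero.1 this with h | h
  · exact Or.inl h
  · exact Or.inr (sub_eq_zero.1 h)

lemma no_one (hq : Fintype.card F = 2 ^ m) (hm : Odd m) {k : ZMod m} (w : F) :
    fr k w + w ≠ 1 := by
  intro h
  have h0 : fr k w = w + 1 := by
    rw [← h]
    have h20 : (2 : F) = 0 := CharTwo.two_eq_zero
    linear_combination -w * h20
  have := fr_iter hq (k := k) (e := 1) (fr_one _) h0 m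
  rw [ZMod.natCast_self, zero_mul, fr_idx_zero, mul_one] at this
  have h3 : (m : F) = 0 := by linear_combination -this
  rw [CharP.cast_eq_zero_iff F 2] at h3
  exact (Nat.not_even_iff_odd.2 hm) (even_iff_two_dvd.2 h3)

open Classical in
lemma card_im (hq : Fintype.card F = 2 ^ m) {k : ZMod m} (hk : IsUnit k) :
    2 ^ m ≤ 2 * (Finset.univ.image (fun w : F => fr k w + w)).card := by
  rw [← hq, ← Finset.card_univ]
  apply Finset.card_le_mul_card_image
  intro b hb
  obtain ⟨w, -, rfl⟩ := Finset.mem_image.1 hb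
  refine (Finset.card_le_card (t := {w, w + 1}) ?_).trans Finset.card_le_two
  intro z hz
  simp only [Finset.mem_filter, Finset.mem_univ, true_and] at hz
  have : fr k (z - w) = z - w := by
    rw [fr_sub]
    have h20 : (2 : F) = 0 := CharTwo.two_eq_zero
    linear_combination hz + (w - z) * h20
  rcases fr_fix hq hk this with h | h
  · rw [sub_eq_zero.1 h]; simp
  · rw [sub_eq_iff_eq_add'.1 h]; simp

/-- the map whose non-values are the good `β` -/
def hh (k : ZMod m) (x : F) : F := x * fr k x + x

lemma hh_zero_iff {k : ZMod m} {x : F} : hh k x = 0 ↔ x = 0 ∨ x = 1 := by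
  constructor
  · intro h
    have : x * (fr k x + 1) = 0 := by rw [← h, hh]; ring
    rcases mul_eq_zero.1 this with h | h
    · exact Or.inl h
    · right
      rw [CharTwo.add_eq_zero] at h
      exact fr_inj (i := k) (by rw [h, fr_one])
  · rintro (rfl | rfl)
    · simp [hh]
    · simp [hh, fr_one, CharTwo.add_self_eq_zero]

/-- two further preimages -/
lemma hh_pre {k : ZMod m} {x t w : F} (hw : w ≠ 0) (ht : fr k t + t ≠ 0)
    (htw : fr k w + w = t) (hx : fr k x * (fr k t + t) = t) : hh k (x + x * t / w) = hh k x := by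
  have h20 : (2 : F) = 0 := CharTwo.two_eq_zero
  have hw' : fr k w ≠ 0 := fun h => hw (fr_eq_zero.1 h)
  have e : x * t / w = x * (t / w) := by ring
  obtain ⟨s, hs⟩ : ∃ s, s = t / w := ⟨_, rfl⟩
  have hsw : s * w = t := by rw [hs]; field_simp
  have hsw' : fr k s * fr k w = fr k t := by rw [← hsw, fr_mul]
  rw [e, ← hs]
  simp only [hh, fr_add, fr_mul]
  -- reduce to `fr k x * (fr k s + s + s * fr k s) = s`
  have key : fr k x * (fr k s + s + s * fr k s) = s := by
    have h1 : (w * fr k w) * (fr k s + s + s * fr k s) = fr k w * (fr k t + t) := by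
      have : w = t - fr k w := by rw [← htw]; ring
      have h3 : t = fr k w + w := htw.symm
      linear_combination (w + s * w) * hsw' + (fr k w + fr k t) * hsw - fr k t * htw
        + fr k t * w * h20
    have h2 : (w * fr k w) * (fr k x * (fr k s + s + s * fr k s)) = (w * fr k w) * s := by
      linear_combination fr k x * h1 + fr k w * hx - fr k w * hsw
    exact mul_left_cancel₀ (mul_ne_zero hw hw') h2
  linear_combination x * key + x * s * h20

open Classical in
lemma fiber3 (hq : Fintype.card F = 2 ^ m) {k : ZMod m} (hk : IsUnit k) {x t w : F}
    (ht0 : t ≠ 0) (ht1 : t ≠ 1)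
    (htw : fr k w + w = t) (hx : fr k x * (fr k t + t) = t) :
    3 ≤ (Finset.univ.filter (fun z : F => hh k z = hh k x)).card := by
  have h20 : (2 : F) = 0 := CharTwo.two_eq_zero
  have ht : fr k t + t ≠ 0 := by
    rw [Ne, CharTwo.add_eq_zero]
    intro h
    rcases fr_fix hq hk h with h | h <;> contradiction
  have hw : w ≠ 0 := by
    rintro rfl
    apply ht0; rw [← htw]; simp [fr_zero]
  have hw1 : w + 1 ≠ 0 := by
    rw [Ne, CharTwo.add_eq_zero]
    rintro rfl
    apply ht0; rw [← htw]; simp [fr_one, CharTwo.add_self_eq_zero]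
  have hx0 : x ≠ 0 := by
    rintro rfl
    apply ht0; rw [← hx]; simp [fr_zero]
  have p1 := hh_pre hw ht htw hx
  have p2 := hh_pre (w := w + 1) hw1 ht (by
    rw [fr_add, fr_one]; linear_combination htw + h20) hx
  have n1 : x * t / w ≠ 0 := div_ne_zero (mul_ne_zero hx0 ht0) hw
  have n2 : x * t / (w + 1) ≠ 0 := div_ne_zero (mul_ne_zero hx0 ht0) hw1
  have n3 : x * t / w ≠ x * t / (w + 1) := by
    intro h
    rw [div_eq_div_iff hw hw1] at h
    have := mul_left_cancel₀ (mul_ne_zero hx0 ht0) h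
    simp at this
  have hc : ({x, x + x * t / w, x + x * t / (w + 1)} : Finset F).card = 3 := by
    rw [Finset.card_eq_three]
    refine ⟨_, _, _, ?_, ?_, ?_, rfl⟩
    · simpa using n1
    · simpa using n2
    · simpa using n3
  rw [← hc]
  apply Finset.card_le_card
  intro z hz
  simp only [Finset.mem_insert, Finset.mem_singleton] at hz
  simp only [Finset.mem_filter, Finset.mem_univ, true_and]
  rcases hz with rfl | rfl | rfl
  · rfl
  · exact p1
  · exact p2

open Classical in
lemma count_core (hq : Fintype.card F = 2 ^ m) {k : ZMod m} (hk : IsUnit k) (g : ℕ)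
    (hg : g ≤ ((Finset.univ.image (fun w : F => fr k w + w)).filter
      (fun t => t ≠ 0 ∧ t ≠ 1)).card) :
    2 * g + 3 ≤ 3 * (Finset.univ.filter (fun b : F => ∀ x, hh k x ≠ b)).card := by
  set T := (Finset.univ.image (fun w : F => fr k w + w)).filter (fun t => t ≠ 0 ∧ t ≠ 1) with hT
  set S := Finset.univ.filter (fun x : F => x ≠ 0 ∧ x ≠ 1) with hS
  set G := S.filter (fun x => 3 ≤ (Finset.univ.filter (fun z : F => hh k z = hh k x)).card) with hG
  have htne : ∀ t : F, t ≠ 0 → t ≠ 1 → fr k t + t ≠ 0 := by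
    intro t ht0 ht1
    rw [Ne, CharTwo.add_eq_zero]
    intro h
    rcases fr_fix hq hk h with h | h <;> contradiction
  -- T injects into G
  have hTG : T.card ≤ G.card := by
    choose X hX using fun t : F => fr_surj hq k (t / (fr k t + t))
    refine Finset.card_le_card_of_injOn X ?_ ?_
    · intro t ht
      simp only [hT, Finset.coe_filter, Finset.mem_image, Finset.mem_univ, true_and] at ht
      obtain ⟨⟨w, hw⟩, ht0, ht1⟩ := ht
      have hne := htne t ht0 ht1
      have hx : fr k (X t) * (fr k t + t) = t := by rw [hX]; field_simp
      have := fiber3 hq hk ht0 ht1 hw hx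
      simp only [hG, hS, Finset.coe_filter, Finset.mem_filter, Finset.mem_univ, true_and]
      refine ⟨⟨?_, ?_⟩, this⟩
      · intro h
        rw [h, fr_zero, zero_mul] at hx
        exact ht0 hx.symm
      · intro h
        rw [h, fr_one, one_mul] at hx
        have : fr k t = 0 := by linear_combination hx
        exact ht0 (fr_eq_zero.1 this)
    · intro t ht s hs h
      simp only [hT, Finset.coe_filter, Finset.mem_image, Finset.mem_univ, true_and] at ht hs
      obtain ⟨-, ht0, ht1⟩ := ht
      obtain ⟨-, hs0, hs1⟩ := hs
      have e : t / (fr k t + t) = s / (fr k s + s) := by rw [← hX, ← hX, h]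
      rw [div_eq_div_iff (htne t ht0 ht1) (htne s hs0 hs1)] at e
      obtain ⟨y, hy⟩ : ∃ y, y * s = t := ⟨t / s, by field_simp⟩
      have hfs : fr k s ≠ 0 := fun h => hs0 (fr_eq_zero.1 h)
      have e2 : fr k y = y := by
        rw [← hy, fr_mul] at e
        have : (s * fr k s) * fr k y = (s * fr k s) * y := by linear_combination -e
        exact mul_left_cancel₀ (mul_ne_zero hs0 hfs) this
      rcases fr_fix hq hk e2 with h | h
      · rw [h, zero_mul] at hy; exact absurd hy.symm ht0
      · rw [h, one_mul] at hy; exact hy.symm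
  -- image of G
  have h1 : 3 * (G.image (hh k)).card ≤ G.card := by
    apply Finset.mul_card_image_le_card
    intro a ha
    obtain ⟨x, hx, rfl⟩ := Finset.mem_image.1 ha
    have hx' := hx
    rw [hG, Finset.mem_filter] at hx'
    refine hx'.2.trans (Finset.card_le_card ?_)
    intro z hz
    simp only [Finset.mem_filter, Finset.mem_univ, true_and] at hz
    simp only [hG, hS, Finset.mem_filter, Finset.mem_univ, true_and]
    refine ⟨⟨?_, by rw [hz]; exact hx'.2⟩, hz⟩
    rw [← not_or, ← hh_zero_iff (k := k), hz, hh_zero_iff, not_or]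
    simpa [hS] using hx'.1
  have h2 : ((S \ G).image (hh k)).card ≤ (S \ G).card := Finset.card_image_le
  have h3 : (S \ G).card = S.card - G.card := Finset.card_sdiff_of_subset (Finset.filter_subset _ _)
  have h4 : G.card ≤ S.card := Finset.card_le_card (Finset.filter_subset _ _)
  have h5 : S.card + 2 = Fintype.card F := by
    have : S = Finset.univ \ {0, 1} := by
      ext x; simp [hS]
    have h6 : ({0, 1} : Finset F).card = 2 := Finset.card_pair zero_ne_one
    rw [this, Finset.card_sdiff_of_subset (Finset.subset_univ _), h6, Finset.card_univ]
    have : 2 ≤ Fintype.card F := Fintype.one_lt_card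
    omega
  have h6 : (Finset.univ.image (hh k : F → F)).card
      ≤ 1 + (G.image (hh k)).card + ((S \ G).image (hh k)).card := by
    have : Finset.univ.image (hh k : F → F) ⊆ ({0} ∪ G.image (hh k)) ∪ (S \ G).image (hh k) := by
      intro b hb
      obtain ⟨x, -, rfl⟩ := Finset.mem_image.1 hb
      by_cases hx : x = 0 ∨ x = 1
      · rw [hh_zero_iff.2 hx]; simp
      · by_cases hxG : x ∈ G
        · exact Finset.mem_union_left _ (Finset.mem_union_right _ (Finset.mem_image_of_mem _ hxG))
        · refine Finset.mem_union_right _ (Finset.mem_image_of_mem _ ?_)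
          rw [not_or] at hx
          simp [hxG, hS, hx]
    refine (Finset.card_le_card this).trans ((Finset.card_union_le _ _).trans ?_)
    gcongr
    exact (Finset.card_union_le _ _).trans (by simp)
  have h7 : (Finset.univ.filter (fun b : F => ∀ x, hh k x ≠ b)).card
      + (Finset.univ.image (hh k : F → F)).card = Fintype.card F := by
    have : Finset.univ.filter (fun b : F => ∀ x, hh k x ≠ b) = (Finset.univ.image (hh k : F → F))ᶜ := by
      ext b; simp
    rw [this, Finset.card_compl]
    have := Finset.card_le_univ (Finset.univ.image (hh k : F → F))
    omega
  omega

open Classical in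
lemma count_even (hq : Fintype.card F = 2 ^ m) {k : ZMod m} (hk : IsUnit k) :
    2 ^ m ≤ 3 * (Finset.univ.filter (fun b : F => ∀ x, hh k x ≠ b)).card + 1 := by
  have h1 := card_im hq hk
  have h2 : (Finset.univ.image (fun w : F => fr k w + w)).card ≤
    ((Finset.univ.image (fun w : F => fr k w + w)).filter (fun t => t ≠ 0 ∧ t ≠ 1)).card + 2 := by
    have : Finset.univ.image (fun w : F => fr k w + w) ⊆
      (Finset.univ.image (fun w : F => fr k w + w)).filter (fun t => t ≠ 0 ∧ t ≠ 1) ∪ {0, 1} := by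
      intro t ht
      rw [Finset.mem_union, Finset.mem_filter]
      by_cases h0 : t = 0
      · right; simp [h0]
      by_cases h1 : t = 1
      · right; simp [h1]
      exact Or.inl ⟨ht, h0, h1⟩
    refine (Finset.card_le_card this).trans ((Finset.card_union_le _ _).trans ?_)
    gcongr
    exact Finset.card_le_two
  have := count_core hq hk _ le_rfl
  omega

open Classical in
lemma count_odd (hq : Fintype.card F = 2 ^ m) (hm : Odd m) {k : ZMod m} (hk : IsUnit k) :
    2 ^ m + 1 ≤ 3 * (Finset.univ.filter (fun b : F => ∀ x, hh k x ≠ b)).card := by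
  have h1 := card_im hq hk
  have h2 : (Finset.univ.image (fun w : F => fr k w + w)).card ≤
    ((Finset.univ.image (fun w : F => fr k w + w)).filter (fun t => t ≠ 0 ∧ t ≠ 1)).card + 1 := by
    have : Finset.univ.image (fun w : F => fr k w + w) ⊆
      (Finset.univ.image (fun w : F => fr k w + w)).filter (fun t => t ≠ 0 ∧ t ≠ 1) ∪ {0} := by
      intro t ht
      rw [Finset.mem_union, Finset.mem_filter]
      by_cases h0 : t = 0
      · right; simp [h0]
      by_cases h1 : t = 1
      · exfalso
        obtain ⟨w, -, hw⟩ := Finset.mem_image.1 ht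
        exact no_one hq hm w (hw.trans h1)
      exact Or.inl ⟨ht, h0, h1⟩
    refine (Finset.card_le_card this).trans ((Finset.card_union_le _ _).trans ?_)
    simp
  have := count_core hq hk _ le_rfl
  omega

end I
end Tani

set_option linter.unusedSectionVars false
set_option linter.unusedSimpArgs false
namespace Tani
section J

lemma ccz_refl {V : Type*} [AddCommGroup V] [Module (ZMod 2) V] (f : V → V) :
    CCZEquivalent f f :=
  ⟨id, 0, ⟨fun _ _ => rfl, fun _ _ => rfl⟩, Function.bijective_id, by simp⟩

/-- the index set of exponents -/
def KK (m : ℕ) : Finset ℕ := (Finset.range m).filter (fun k => 0 < k ∧ 2 * k < m ∧ Nat.gcd k m = 1)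

lemma totient_le (m : ℕ) (hm : 3 ≤ m) : Nat.totient m / 2 ≤ (KK m).card := by
  have h : Nat.totient m ≤ (KK m).card + (KK m).card := by
    rw [Nat.totient_eq_card_coprime]
    have : (Finset.range m).filter (fun a => m.Coprime a) ⊆ KK m ∪ (KK m).image (fun a => m - a) := by
      intro a ha
      simp only [Finset.mem_filter, Finset.mem_range] at ha
      obtain ⟨h1, h2⟩ := ha
      have h0 : a ≠ 0 := by
        rintro rfl
        simp at h2; omega
      have hne : 2 * a ≠ m := by
        intro h
        have : a ∣ Nat.gcd m a := Nat.dvd_gcd ⟨2, by omega⟩ dvd_rfl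
        rw [h2] at this
        have := Nat.le_of_dvd one_pos this
        omega
      rw [Finset.mem_union]
      by_cases hlt : 2 * a < m
      · left
        simp only [KK, Finset.mem_filter, Finset.mem_range]
        exact ⟨h1, by omega, hlt, h2.symm⟩
      · right
        refine Finset.mem_image.2 ⟨m - a, ?_, by omega⟩
        simp only [KK, Finset.mem_filter, Finset.mem_range]
        refine ⟨by omega, by omega, by omega, ?_⟩
        exact ((Nat.coprime_self_sub_left h1.le).2 h2.symm)
    exact (Finset.card_le_card this).trans ((Finset.card_union_le _ _).trans
      (Nat.add_le_add_left Finset.card_image_le _))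
  omega

lemma ne_facts {m k : ℕ} [NeZero m] (hm : 4 ≤ m) (hk : Nat.gcd k m = 1) :
    (k : ZMod m) ≠ 0 ∧ 2 * (k : ZMod m) ≠ 0 ∧ 3 * (k : ZMod m) ≠ 0 := by
  have hu : IsUnit (k : ZMod m) := (ZMod.isUnit_iff_coprime k m).2 hk
  have aux : ∀ n : ℕ, 0 < n → n < m → (n : ZMod m) ≠ 0 := by
    intro n h1 h2 h
    rw [ZMod.natCast_eq_zero_iff] at h
    exact absurd (Nat.le_of_dvd h1 h) (by omega)
  refine ⟨?_, ?_, ?_⟩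
  · intro h
    rw [h, isUnit_zero_iff] at hu
    exact aux 1 one_pos (by omega) (by simpa using hu.symm)
  · intro h
    exact aux 2 two_pos (by omega) (by simpa using (hu.mul_left_eq_zero.1 h))
  · intro h
    exact aux 3 three_pos (by omega) (by simpa using (hu.mul_left_eq_zero.1 h))

open Classical in
/-- the good parameters -/
noncomputable def BB (F : Type*) [Field F] [Fintype F] (k : ℕ) : Finset F :=
  Finset.univ.filter (fun b : F => ∀ x : F, x ^ (2 ^ k + 1) + 1 * x + b ≠ 0)

lemma BB_eq {F : Type*} [Field F] [Fintype F] [CharP F 2] {m : ℕ} [NeZero m]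
    (hq : Fintype.card F = 2 ^ m) (k : ℕ) : 
    BB F k = by classical exact Finset.univ.filter (fun b : F => ∀ x, hh (k : ZMod m) x ≠ b) := by
  classical
  unfold BB
  apply Finset.filter_congr
  intro b _
  refine forall_congr' fun x => not_congr ?_
  rw [CharTwo.add_eq_zero, hh, fr_natCast hq, pow_succ, one_mul, mul_comm]

lemma BB_ne {F : Type*} [Field F] [Fintype F] {k : ℕ} {b : F} (hb : b ∈ BB F k) : b ≠ 0 := by
  classical
  simp only [BB, Finset.mem_filter, Finset.mem_univ, true_and] at hb
  have := hb 0
  simpa using this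

lemma BB_pos {F : Type*} [Field F] [Fintype F] [CharP F 2] {m : ℕ} [NeZero m]
    (hq : Fintype.card F = 2 ^ m) {k : ℕ} (hk : Nat.gcd k m = 1) (t : ℕ)
    (ht : (BB F k).card ≤ m * t) : 2 ^ m + 1 ≤ 3 * m * t := by
  classical
  have hu : IsUnit (k : ZMod m) := (ZMod.isUnit_iff_coprime k m).2 hk
  rw [BB_eq hq] at ht
  rcases Nat.even_or_odd m with he | ho
  · have h1 := count_even hq hu
    have h3 : 2 ^ m ≤ 3 * (m * t) + 1 := by
      refine h1.trans ?_
      gcongr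
    obtain ⟨n, hn⟩ := he
    have e1 : 3 * m * t = 2 * (3 * n * t) := by rw [hn]; ring
    have e2 : 2 ^ m = 2 * 2 ^ (m - 1) := by
      rw [← pow_succ']; congr 1; have := NeZero.pos m; omega
    have e3 : 3 * (m * t) = 3 * m * t := by ring
    have h4 : 2 ^ m ≤ 3 * m * t := by omega
    have h5 : 2 ^ m ≠ 3 * m * t := by
      intro h
      have : 3 ∣ 2 ^ m := ⟨m * t, by rw [h]; ring⟩
      have := Nat.Prime.dvd_of_dvd_pow Nat.prime_three this
      omega
    omega
  · have h1 := count_odd hq ho hu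
    rw [mul_assoc]
    refine h1.trans ?_
    gcongr

end J
end Tani

open Tani

/-- For `m ≥ 3`, the number of CCZ-inequivalent APN Taniguchi functions on
`F_{2^m} × F_{2^m}` is at least `(φ(m)/2)·⌈(2^m + 1)/(3m)⌉`; in particular the number of
pairwise CCZ-inequivalent APN functions on `F_{2^(2m)}` grows exponentially in `m`. -/
theorem taniguchi_classes_lower_bound (m : ℕ) (hm : 3 ≤ m) :
    Nat.totient m / 2 * ((2 ^ m + 1) ⌈/⌉ (3 * m)) ≤ numTaniguchiClasses m := by
  classical
  haveI : NeZero m := ⟨by omega⟩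
  haveI : Fintype (GaloisField 2 m) := Fintype.ofFinite _
  have hq : Fintype.card (GaloisField 2 m) = 2 ^ m := by
    rw [← Nat.card_eq_fintype_card, GaloisField.card 2 m (by omega)]
  let cls : ℕ → GaloisField 2 m →
      Set ((GaloisField 2 m × GaloisField 2 m) → (GaloisField 2 m × GaloisField 2 m)) :=
    fun k b => {g | g ∈ TanSet m ∧ CCZEquivalent (taniguchi k 1 b) g}
  have hmem : ∀ k ∈ KK m, ∀ b ∈ BB (GaloisField 2 m) k, taniguchi k 1 b ∈ TanSet m := by
    intro k hk b hb
    have hb0 := BB_ne hb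
    simp only [KK, Finset.mem_filter, Finset.mem_range] at hk
    simp only [BB, Finset.mem_filter, Finset.mem_univ, true_and] at hb
    exact ⟨k, 1, b, hk.2.1, hk.1, hk.2.2.2, hb0, hb, rfl⟩
  have hccz : ∀ k ∈ KK m, ∀ l ∈ KK m, ∀ b ∈ BB (GaloisField 2 m) k,
      ∀ b' ∈ BB (GaloisField 2 m) l, cls k b = cls l b' →
      CCZEquivalent (taniguchi k 1 b) (taniguchi l 1 b') := by
    intro k hk l hl b hb b' hb' h
    have : taniguchi l 1 b' ∈ cls l b' := ⟨hmem l hl b' hb', ccz_refl _⟩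
    rw [← h] at this
    exact this.2
  have hle : ∀ s : Finset (Set ((GaloisField 2 m × GaloisField 2 m) →
      (GaloisField 2 m × GaloisField 2 m))), (∀ C ∈ s, ∃ k ∈ KK m, ∃ b ∈ BB (GaloisField 2 m) k,
      C = cls k b) → s.card ≤ numTaniguchiClasses m := by
    intro s hs
    rw [numTaniguchiClasses, ← Set.ncard_coe_finset]
    refine Set.ncard_le_ncard ?_ (Set.toFinite _)
    intro C hC
    obtain ⟨k, hk, b, hb, rfl⟩ := hs C hC
    exact ⟨_, hmem k hk b hb, rfl⟩
  have htot := totient_le m hm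
  by_cases h3 : m = 3
  · subst h3
    have hk : (1 : ℕ) ∈ KK 3 := by decide
    have hne : (BB (GaloisField 2 3) 1).Nonempty := by
      rw [Finset.nonempty_iff_ne_empty]
      intro h
      have := BB_pos hq (k := 1) (by norm_num) 0 (by simp [h])
      omega
    obtain ⟨b, hb⟩ := hne
    have h1 := hle {cls 1 b} (by simpa using ⟨1, hk, b, hb, rfl⟩)
    have h2 : Nat.totient 3 / 2 * ((2 ^ 3 + 1) ⌈/⌉ (3 * 3)) = 1 := by decide
    rw [h2]
    simpa using h1
  have hm4 : 4 ≤ m := by omega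
  have hmain : ∀ k ∈ KK m, ∀ l ∈ KK m, ∀ b ∈ BB (GaloisField 2 m) k,
      ∀ b' ∈ BB (GaloisField 2 m) l, cls k b = cls l b' → k = l ∧ ∃ i : ZMod m, b' = fr i b := by
    intro k hk l hl b hb b' hb' h
    have hc := hccz k hk l hl b hb b' hb' h
    have hb0 := BB_ne hb
    have hb0' := BB_ne hb'
    simp only [KK, Finset.mem_filter, Finset.mem_range] at hk hl
    obtain ⟨k1, k2, k3⟩ := ne_facts hm4 hk.2.2.2
    obtain ⟨l1, l2, l3⟩ := ne_facts hm4 hl.2.2.2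
    have hkl : (k : ZMod m) + l ≠ 0 := by
      intro h
      have h' : ((k + l : ℕ) : ZMod m) = 0 := by push_cast; exact h
      rw [ZMod.natCast_eq_zero_iff] at h'
      exact absurd (Nat.le_of_dvd (by omega) h') (by omega)
    obtain ⟨e1, e2⟩ := main_ineq hq k1 k2 k3 l1 l2 l3 hkl hb0 hb0' hc
    refine ⟨?_, e2⟩
    rw [ZMod.natCast_eq_natCast_iff'] at e1
    rwa [Nat.mod_eq_of_lt hk.1, Nat.mod_eq_of_lt hl.1] at e1
  have himg : ∀ k ∈ KK m,
      (2 ^ m + 1) ⌈/⌉ (3 * m) ≤ ((BB (GaloisField 2 m) k).image (cls k)).card := by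
    intro k hk
    rw [ceilDiv_le_iff_le_mul (by omega)]
    have hk' := hk
    simp only [KK, Finset.mem_filter, Finset.mem_range] at hk'
    refine BB_pos hq hk'.2.2.2 _ ?_
    apply Finset.card_le_mul_card_image
    intro C hC
    obtain ⟨b, hb, rfl⟩ := Finset.mem_image.1 hC
    have : (BB (GaloisField 2 m) k).filter (fun b' => cls k b' = cls k b) ⊆
        (Finset.univ : Finset (ZMod m)).image (fun i => fr i b) := by
      intro b' hb'
      rw [Finset.mem_filter] at hb'
      obtain ⟨-, i, hi⟩ := hmain k hk k hk b hb b' hb'.1 hb'.2.symm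
      exact Finset.mem_image.2 ⟨i, Finset.mem_univ _, hi.symm⟩
    refine (Finset.card_le_card this).trans (Finset.card_image_le.trans ?_)
    rw [Finset.card_univ, ZMod.card]
  have hdisj : ((KK m : Finset ℕ) : Set ℕ).PairwiseDisjoint
      (fun k => (BB (GaloisField 2 m) k).image (cls k)) := by
    intro k hk l hl hkl
    rw [Function.onFun, Finset.disjoint_left]
    intro C hC hC'
    obtain ⟨b, hb, rfl⟩ := Finset.mem_image.1 hC
    obtain ⟨b', hb', h⟩ := Finset.mem_image.1 hC'
    exact hkl (hmain k hk l hl b hb b' hb' h.symm).1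
  calc Nat.totient m / 2 * ((2 ^ m + 1) ⌈/⌉ (3 * m))
      ≤ (KK m).card * ((2 ^ m + 1) ⌈/⌉ (3 * m)) := Nat.mul_le_mul_right _ htot
    _ = ∑ _k ∈ KK m, ((2 ^ m + 1) ⌈/⌉ (3 * m)) := by rw [Finset.sum_const, smul_eq_mul]
    _ ≤ ∑ k ∈ KK m, ((BB (GaloisField 2 m) k).image (cls k)).card := Finset.sum_le_sum himg
    _ = ((KK m).biUnion (fun k => (BB (GaloisField 2 m) k).image (cls k))).card :=
        (Finset.card_biUnion hdisj).symm
    _ ≤ numTaniguchiClasses m := by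
        apply hle
        intro C hC
        obtain ⟨k, hk, hC⟩ := Finset.mem_biUnion.1 hC
        obtain ⟨b, hb, rfl⟩ := Finset.mem_image.1 hC
        exact ⟨k, hk, b, hb, rfl⟩
end
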